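/- arXiv:1809.01207 — 2 statements merged into one kernel-verified Lean document; each statement's English description precedes it below -/
import Mathlib

section
/- Let P : {0,1}^k → {0,1} be a predicate and let ν be a (t−1)-wise uniform distribution on {0,1}^k (t ≥ 3) supported on the satisfying assignments of P. Then there exist constants c, C > 0 (depending on k, t) such that for every Δ ≥ 10 and every integer B with |B − n/2| ≤ C·√n, with probability 1 − o(1) over a random instance of CSP(P^±) with n variables and m = Δn constraints, there exists a degree-⌊c·n/(Δ^{2/(t−2)}·log Δ)⌋ pseudoexpectation over {0,1}-valued variables x_1,…,x_n that satisfies every constraint of the instance as an identity with pseudovariance zero and also satisfies the global Hamming weight identity Σ_{i=1}^n x_i = B with pseudovariance zero. -/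
open MvPolynomial Finset

/-- Probability of an event under the uniform distribution on a finite sample space. -/
noncomputable def uprob {Ω : Type} [Fintype Ω] (p : Ω → Prop) : ℝ :=
  letI := Classical.decPred p
  ((Finset.univ.filter p).card : ℝ) / (Fintype.card Ω : ℝ)

/-- A distribution `μ` on `ι → Bool` is `j`-wise uniform: its marginal on every set of at most
`j` coordinates is uniform. -/
def kwiseUniform {ι : Type} [Fintype ι] [DecidableEq ι] (j : ℕ) (μ : (ι → Bool) → ℝ) : Prop :=
  ∀ A : Finset ι, A.card ≤ j → ∀ a : ι → Bool,
    ∑ x ∈ Finset.univ.filter (fun x : ι → Bool => ∀ i ∈ A, x i = a i), μ x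
      = (1 / 2 : ℝ) ^ A.card

/-- `μ` is a probability distribution on the finite type `α`. -/
def IsDist {α : Type} [Fintype α] (μ : α → ℝ) : Prop :=
  (∀ x, 0 ≤ μ x) ∧ ∑ x, μ x = 1

/-- A degree-`d` pseudoexpectation over `{0,1}`-valued variables `x_1, …, x_n`. -/
structure PE01 (n d : ℕ) where
  pE : MvPolynomial (Fin n) ℝ →ₗ[ℝ] ℝ
  normalized : pE 1 = 1
  multilin : ∀ p q : MvPolynomial (Fin n) ℝ,
    (∀ x : Fin n → Bool,
        MvPolynomial.eval (fun i => if x i then (1 : ℝ) else 0) p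
          = MvPolynomial.eval (fun i => if x i then (1 : ℝ) else 0) q) →
      pE p = pE q
  psd : ∀ p : MvPolynomial (Fin n) ℝ, 2 * p.totalDegree ≤ d → 0 ≤ pE (p ^ 2)

/-- The pseudoexpectation satisfies the identity `Q = b` with pseudovariance zero. -/
def PE01.satEq {n d : ℕ} (E : PE01 n d) (Q : MvPolynomial (Fin n) ℝ) (b : ℝ) : Prop :=
  E.pE Q = b ∧ E.pE (Q ^ 2) = b ^ 2

/-- The multilinear arithmetization of the 0/1-indicator of the event `x_S = a`. -/
noncomputable def ind01 {n k : ℕ} (S : Fin k → Fin n) (a : Fin k → Bool) :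
    MvPolynomial (Fin n) ℝ :=
  ∏ i, (if a i then MvPolynomial.X (S i) else 1 - MvPolynomial.X (S i))

/-- The multilinear arithmetization of the constraint "`P`, applied to the variables of the
scope `S` negated according to the pattern `z`, equals 1". -/
noncomputable def consPoly01 {n k : ℕ} (P : (Fin k → Bool) → Bool)
    (S : Fin k → Fin n) (z : Fin k → Bool) : MvPolynomial (Fin n) ℝ :=
  ∑ a ∈ Finset.univ.filter
      (fun a : Fin k → Bool => P (fun i => Bool.xor (a i) (z i)) = true),
    ind01 S a

set_option linter.unusedSectionVars false

section Fourier

variable {V : Type} [Fintype V] [DecidableEq V]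

/-- The parity character of the variable set `S`. -/
def chi (S : Finset V) (y : V → Bool) : ℝ := ∏ v ∈ S, if y v then -1 else 1

/-- The average of a function over the uniform distribution on the cube. -/
noncomputable def avg : ((V → Bool) → ℝ) →ₗ[ℝ] ℝ :=
  ((2 : ℝ) ^ Fintype.card V)⁻¹ • ∑ y, LinearMap.proj y

lemma avg_apply (f : (V → Bool) → ℝ) :
    avg f = ((2 : ℝ) ^ Fintype.card V)⁻¹ * ∑ y, f y := by
  simp [avg]

lemma avg_one : avg (1 : (V → Bool) → ℝ) = 1 := by
  simp [avg_apply]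

lemma avg_nonneg {f : (V → Bool) → ℝ} (hf : ∀ y, 0 ≤ f y) : 0 ≤ avg f := by
  rw [avg_apply]
  exact mul_nonneg (by positivity) (Finset.sum_nonneg fun y _ => hf y)

lemma chi_mul_chi (S T : Finset V) : chi S * chi T = chi (symmDiff S T) := by
  funext y
  have hsq : ∀ v, (if y v then (-1 : ℝ) else 1) * (if y v then -1 else 1) = 1 := by
    intro v; split_ifs <;> norm_num
  have h1 : chi S y = chi (S \ T) y * chi (S ∩ T) y := by
    unfold chi
    rw [← Finset.prod_union (Finset.disjoint_sdiff_inter S T), Finset.sdiff_union_inter]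
  have h2 : chi T y = chi (T \ S) y * chi (S ∩ T) y := by
    unfold chi
    rw [Finset.inter_comm, ← Finset.prod_union (Finset.disjoint_sdiff_inter T S),
      Finset.sdiff_union_inter]
  have h3 : chi (symmDiff S T) y = chi (S \ T) y * chi (T \ S) y := by
    unfold chi
    rw [symmDiff_def, Finset.sup_eq_union, Finset.prod_union]
    exact disjoint_sdiff_sdiff
  have h4 : chi (S ∩ T) y * chi (S ∩ T) y = 1 := by
    unfold chi
    rw [← Finset.prod_mul_distrib]
    exact Finset.prod_eq_one fun v _ => hsq v
  rw [Pi.mul_apply, h1, h2, h3]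
  linear_combination chi (S \ T) y * chi (T \ S) y * h4

lemma chi_empty : chi (∅ : Finset V) = 1 := by
  funext y; simp [chi]

lemma chi_dependsOn (S : Finset V) : DependsOn (chi S) (S : Set V) := by
  intro x y h
  unfold chi
  exact Finset.prod_congr rfl fun v hv => by rw [h v hv]

lemma sum_chi_mul_chi (x y : V → Bool) :
    ∑ S : Finset V, chi S x * chi S y = if x = y then (2 : ℝ) ^ Fintype.card V else 0 := by
  have h : ∑ S : Finset V, chi S x * chi S y
      = ∏ v : V, (1 + (if x v then (-1 : ℝ) else 1) * (if y v then -1 else 1)) := by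
    rw [Finset.prod_one_add, Finset.powerset_univ]
    refine Finset.sum_congr rfl fun S _ => ?_
    simp only [chi]
    rw [Finset.prod_mul_distrib]
  rw [h]
  split_ifs with hxy
  · subst hxy
    have : ∀ v ∈ (Finset.univ : Finset V),
        1 + (if x v then (-1 : ℝ) else 1) * (if x v then -1 else 1) = 2 := by
      intro v _; split_ifs <;> norm_num
    rw [Finset.prod_congr rfl this]
    simp
  · obtain ⟨v, hv⟩ := Function.ne_iff.mp hxy
    refine Finset.prod_eq_zero (Finset.mem_univ v) ?_
    cases hx : x v <;> cases hy : y v <;> simp_all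

/-- Fourier inversion on the cube. -/
lemma fourier_inversion (f : (V → Bool) → ℝ) : f = ∑ S, avg (f * chi S) • chi S := by
  funext y
  have h2 : ((2 : ℝ) ^ Fintype.card V) ≠ 0 := by positivity
  simp only [Finset.sum_apply, Pi.smul_apply, smul_eq_mul, avg_apply, Pi.mul_apply]
  have : ∀ S : Finset V, ((2 : ℝ) ^ Fintype.card V)⁻¹ * (∑ x, f x * chi S x) * chi S y
      = ∑ x, ((2 : ℝ) ^ Fintype.card V)⁻¹ * f x * (chi S x * chi S y) := by
    intro S
    rw [Finset.mul_sum, Finset.sum_mul]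
    exact Finset.sum_congr rfl fun x _ => by ring
  simp only [this]
  rw [Finset.sum_comm]
  simp only [← Finset.mul_sum, sum_chi_mul_chi]
  rw [Finset.sum_eq_single y]
  · simp; field_simp
  · intro b _ hb; simp [hb]
  · simp

/-- Negating the variables of `W` is measure preserving. -/
lemma avg_flip (f : (V → Bool) → ℝ) (w : V → Bool) :
    avg (fun y => f (fun v => xor (y v) (w v))) = avg f := by
  rw [avg_apply, avg_apply]
  congr 1
  refine Function.Bijective.sum_comp (e := fun (y : V → Bool) v => xor (y v) (w v)) ?_ f
  refine Function.Involutive.bijective fun y => ?_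
  funext v; simp

lemma avg_mul_chi_eq_zero {g : (V → Bool) → ℝ} {A Q : Finset V}
    (hg : DependsOn g (A : Set V)) (hQ : ¬ Q ⊆ A) : avg (g * chi Q) = 0 := by
  obtain ⟨q, hq, hqA⟩ := Finset.not_subset.mp hQ
  have h := avg_flip (g * chi Q) (fun v => decide (v = q))
  have h2 : (fun y : V → Bool => (g * chi Q) (fun v => xor (y v) (decide (v = q))))
      = -(g * chi Q) := by
    funext y
    have e1 : g (fun v => xor (y v) (decide (v = q))) = g y := by
      refine hg fun v hv => ?_
      have : v ≠ q := fun h => hqA (h ▸ hv)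
      simp [this]
    have e2 : chi Q (fun v => xor (y v) (decide (v = q))) = - chi Q y := by
      unfold chi
      rw [← Finset.mul_prod_erase _ _ hq,
        ← Finset.mul_prod_erase _ (fun v => if y v then _ else _) hq]
      have : ∏ x ∈ Q.erase q, (if xor (y x) (decide (x = q)) then (-1 : ℝ) else 1)
          = ∏ x ∈ Q.erase q, (if y x then (-1 : ℝ) else 1) := by
        refine Finset.prod_congr rfl fun v hv => ?_
        simp [(Finset.mem_erase.mp hv).1]
      rw [this]
      cases h : y q <;> simp [h]
    simp only [Pi.mul_apply, Pi.neg_apply, e1, e2]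
    ring
  rw [h2, map_neg] at h
  linarith

lemma avg_chi_mul_chi (S T : Finset V) : avg (chi S * chi T) = if S = T then 1 else 0 := by
  rw [chi_mul_chi]
  split_ifs with h
  · rw [h, symmDiff_self, Finset.bot_eq_empty, chi_empty, avg_one]
  · have hd : DependsOn (1 : (V → Bool) → ℝ) ((∅ : Finset V) : Set V) := fun _ _ _ => rfl
    have := avg_mul_chi_eq_zero (Q := symmDiff S T) hd (by
      rw [Finset.subset_empty]
      exact fun h0 => h (symmDiff_eq_bot.mp h0))
    simpa using this

/-- Orthogonal projection for the positive semidefinite form with nonnegative weight `ρ`. -/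
lemma exists_weighted_projection {X : Type} [Fintype X] (ρ : X → ℝ) (hρ : ∀ x, 0 ≤ ρ x)
    (W : Submodule ℝ (X → ℝ)) (u : X → ℝ) :
    ∃ w ∈ W, ∀ g ∈ W, ∑ x, (u x - w x) * g x * ρ x = 0 := by
  let T : (X → ℝ) →ₗ[ℝ] EuclideanSpace ℝ X :=
    { toFun := fun f => WithLp.toLp 2 fun x => Real.sqrt (ρ x) * f x
      map_add' := by intro f g; ext x; simp [mul_add]
      map_smul' := by intro c f; ext x; simp; ring }
  obtain ⟨w, hw, hwu⟩ :=
    Submodule.mem_map.mp ((W.map T).starProjection_apply_mem (T u))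
  refine ⟨w, hw, fun g hg => ?_⟩
  have h := (W.map T).starProjection_inner_eq_zero (T u) (T g) (Submodule.mem_map_of_mem hg)
  rw [← hwu, ← map_sub] at h
  simp only [PiLp.inner_apply] at h
  rw [← h]
  refine Finset.sum_congr rfl fun x _ => ?_
  have := Real.mul_self_sqrt (hρ x)
  simp [T]
  linear_combination (-(u x - w x) * g x) * this

end Fourier

section Closure

variable {V J : Type} [Fintype V] [DecidableEq V] [DecidableEq J] {k : ℕ}

/-- The variables occurring in the constraints of `F`, where `leg j i` is the variable in
position `i` of constraint `j`, or `none` if that position holds a constant. -/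
def scopeVars (leg : J → Fin k → Option V) (F : Finset J) : Finset V :=
  {v | ∃ j ∈ F, ∃ i, leg j i = some v}

/-- The positions of the constraints of `F` that hold constants. -/
def constLegs (leg : J → Fin k → Option V) (F : Finset J) : Finset (J × Fin k) :=
  {p ∈ F ×ˢ univ | leg p.1 p.2 = none}

/-- A position is free if its variable is outside `S` and occurs nowhere else in `F`. -/
def IsFreeLeg (leg : J → Fin k → Option V) (S : Finset V) (F : Finset J) (j : J) (i : Fin k) :
    Prop :=
  ∃ v, leg j i = some v ∧ v ∉ S ∧ ∀ j' ∈ F, ∀ i', leg j' i' = some v → j' = j ∧ i' = i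

open Classical in
/-- Every constraint of `F` has at least `t` positions that are not free. -/
def IsClosedSet (leg : J → Fin k → Option V) (t : ℕ) (S : Finset V) (F : Finset J) : Prop :=
  ∀ j ∈ F, t ≤ #{i | ¬ IsFreeLeg leg S F j i}

/-- The potential of `G` relative to the already exposed variables `A`. -/
def potential (leg : J → Fin k → Option V) (t : ℕ) (A : Finset V) (G : Finset J) : ℤ :=
  2 * #(scopeVars leg G \ A) + #(constLegs leg G) - (2 * k - t) * #G

variable {leg : J → Fin k → Option V} {t : ℕ}

lemma mem_scopeVars {F : Finset J} {v : V} :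
    v ∈ scopeVars leg F ↔ ∃ j ∈ F, ∃ i, leg j i = some v := by
  simp [scopeVars]

lemma scopeVars_union (F G : Finset J) :
    scopeVars leg (F ∪ G) = scopeVars leg F ∪ scopeVars leg G := by
  ext v
  simp only [mem_scopeVars, Finset.mem_union]
  constructor
  · rintro ⟨j, hj | hj, i, h⟩
    · exact Or.inl ⟨j, hj, i, h⟩
    · exact Or.inr ⟨j, hj, i, h⟩
  · rintro (⟨j, hj, i, h⟩ | ⟨j, hj, i, h⟩)
    · exact ⟨j, Or.inl hj, i, h⟩
    · exact ⟨j, Or.inr hj, i, h⟩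

lemma IsFreeLeg.anti {S S' : Finset V} {F F' : Finset J} (hS : S ⊆ S') (hF : F ⊆ F') {j : J}
    {i : Fin k} (h : IsFreeLeg leg S' F' j i) : IsFreeLeg leg S F j i := by
  obtain ⟨v, hv, hvS, hvF⟩ := h
  exact ⟨v, hv, fun h => hvS (hS h), fun j' hj' => hvF j' (hF hj')⟩

lemma IsClosedSet.mono {S S' : Finset V} (hS : S ⊆ S') {F : Finset J}
    (h : IsClosedSet leg t S F) : IsClosedSet leg t S' F := by
  classical
  intro j hj
  refine (h j hj).trans (Finset.card_le_card fun i hi => ?_)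
  simp only [Finset.mem_filter, Finset.mem_univ, true_and] at hi ⊢
  exact fun h' => hi (h'.anti hS (Finset.Subset.refl _))

open Classical in
/-- A constraint of a closed subset keeps its non-free positions in a larger set. -/
lemma IsClosedSet.le_card_of_subset {S : Finset V} {F F' : Finset J} (h : IsClosedSet leg t S F)
    (hF : F ⊆ F') {j : J} (hj : j ∈ F) :
    t ≤ #{i | ¬ IsFreeLeg leg S F' j i} := by
  classical
  refine (h j hj).trans (Finset.card_le_card fun i hi => ?_)
  simp only [Finset.mem_filter, Finset.mem_univ, true_and] at hi ⊢
  exact fun h' => hi (h'.anti (Finset.Subset.refl _) hF)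

lemma IsClosedSet.union {S : Finset V} {F G : Finset J} (hF : IsClosedSet leg t S F)
    (hG : IsClosedSet leg t S G) : IsClosedSet leg t S (F ∪ G) := by
  intro j hj
  rcases Finset.mem_union.mp hj with h | h
  · exact hF.le_card_of_subset Finset.subset_union_left h
  · exact hG.le_card_of_subset Finset.subset_union_right h

/-- Removing `F` from a closed set keeps it closed once the variables of `F` are exposed. -/
lemma IsClosedSet.sdiff {S A : Finset V} {K F : Finset J} (hK : IsClosedSet leg t S K)
    (hS : S ⊆ A) (hF : scopeVars leg F ⊆ A) : IsClosedSet leg t A (K \ F) := by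
  classical
  intro j hj
  refine (hK j (Finset.mem_sdiff.mp hj).1).trans (Finset.card_le_card fun i hi => ?_)
  simp only [Finset.mem_filter, Finset.mem_univ, true_and] at hi ⊢
  rintro ⟨v, hv, hvA, hvK⟩
  refine hi ⟨v, hv, fun h => hvA (hS h), fun j' hj' i' hi' => ?_⟩
  by_cases hjF : j' ∈ F
  · exact absurd (hF (mem_scopeVars.mpr ⟨j', hjF, i', hi'⟩)) hvA
  · exact hvK j' (Finset.mem_sdiff.mpr ⟨hj', hjF⟩) i' hi'

lemma potential_empty (A : Finset V) : potential leg t A ∅ = 0 := by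
  have : scopeVars leg (∅ : Finset J) = ∅ := by ext; simp [mem_scopeVars]
  simp [potential, constLegs, this]

lemma potential_union (S : Finset V) {F G : Finset J} (h : Disjoint F G) :
    potential leg t S (F ∪ G) = potential leg t S F + potential leg t (S ∪ scopeVars leg F) G := by
  have h1 : #(scopeVars leg (F ∪ G) \ S)
      = #(scopeVars leg F \ S) + #(scopeVars leg G \ (S ∪ scopeVars leg F)) := by
    rw [scopeVars_union, ← Finset.card_union_of_disjoint]
    · congr 1
      ext v
      simp only [Finset.mem_sdiff, Finset.mem_union]
      tauto
    · rw [Finset.disjoint_left]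
      intro v
      simp only [Finset.mem_sdiff, Finset.mem_union]
      tauto
  have h2 : #(constLegs leg (F ∪ G)) = #(constLegs leg F) + #(constLegs leg G) := by
    unfold constLegs
    rw [Finset.union_product, Finset.filter_union, Finset.card_union_of_disjoint]
    refine Finset.disjoint_filter_filter ?_
    rw [Finset.disjoint_left]
    rintro ⟨j, i⟩ hj hj'
    exact Finset.disjoint_left.mp h (Finset.mem_product.mp hj).1 (Finset.mem_product.mp hj').1
  unfold potential
  rw [h1, h2, Finset.card_union_of_disjoint h]
  push_cast
  ring

lemma potential_ge_empty (S : Finset V) (F : Finset J) :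
    potential leg t ∅ F - 2 * #S ≤ potential leg t S F := by
  have := Finset.le_card_sdiff S (scopeVars leg F)
  unfold potential
  rw [Finset.sdiff_empty]
  omega

/-- The counting inequality behind all size bounds: each variable outside `A ∪ T` occurring
in a closed set occupies either one free position or at least two positions. -/
lemma IsClosedSet.potential_add_card_le {A T : Finset V} {G : Finset J} (hAT : Disjoint A T)
    (hG : IsClosedSet leg t (A ∪ T) G) :
    potential leg t A G + #(scopeVars leg G ∩ A) ≤ #T := by
  classical
  let w : J × Fin k → ℤ := fun p => 1 + if IsFreeLeg leg (A ∪ T) G p.1 p.2 then 1 else 0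
  have hw1 : ∀ p, 1 ≤ w p := by intro p; simp only [w]; split_ifs <;> norm_num
  have hup : ∑ p ∈ G ×ˢ univ, w p ≤ (2 * k - t) * #G := by
    rw [Finset.sum_product, mul_comm, ← nsmul_eq_mul, ← Finset.sum_const]
    refine Finset.sum_le_sum fun j hj => ?_
    simp only [w, Finset.sum_add_distrib, Finset.sum_const, Finset.card_univ, Fintype.card_fin,
      Finset.sum_boole, nsmul_eq_mul, mul_one]
    have h1 := hG j hj
    have h2 := Finset.card_filter_add_card_filter_not (s := (univ : Finset (Fin k)))
      (fun i => IsFreeLeg leg (A ∪ T) G j i)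
    rw [Finset.card_univ, Fintype.card_fin] at h2
    omega
  have hlow : (#(constLegs leg G) : ℤ) + ∑ v ∈ scopeVars leg G,
      (if v ∈ A then 1 else if v ∈ T then 1 else 2) ≤ ∑ p ∈ G ×ˢ univ, w p := by
    rw [← Finset.sum_fiberwise _ (fun p : J × Fin k => leg p.1 p.2), Fintype.sum_option]
    refine add_le_add ?_ ?_
    · rw [Finset.card_eq_sum_ones, Nat.cast_sum]
      exact Finset.sum_le_sum fun p _ => by simpa using hw1 p
    · refine (Finset.sum_le_sum fun v hv => ?_).trans
        (Finset.sum_le_univ_sum_of_nonneg fun v => Finset.sum_nonneg fun p _ =>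
          (zero_le_one.trans (hw1 p)))
      obtain ⟨j, hj, i, hji⟩ := mem_scopeVars.mp hv
      have hmem : (j, i) ∈ {p ∈ G ×ˢ (univ : Finset (Fin k)) | leg p.1 p.2 = some v} := by
        simp [hj, hji]
      have hsingle : w (j, i) ≤ ∑ p ∈ G ×ˢ univ with leg p.1 p.2 = some v, w p :=
        Finset.single_le_sum (f := w) (fun p _ => zero_le_one.trans (hw1 p)) hmem
      have hge1 := (hw1 (j, i)).trans hsingle
      split_ifs with hA hT
      · exact hge1
      · exact hge1
      · by_cases hfree : IsFreeLeg leg (A ∪ T) G j i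
        · have : w (j, i) = 2 := by simp [w, hfree]
          omega
        · have : ∃ j' ∈ G, ∃ i', leg j' i' = some v ∧ ¬ (j' = j ∧ i' = i) := by
            by_contra! hcon
            exact hfree ⟨v, hji, by simp [hA, hT], fun j' hj' i' hi' => hcon j' hj' i' hi'⟩
          obtain ⟨j', hj', i', hi', hne⟩ := this
          have hne' : (j, i) ≠ (j', i') := by
            intro h
            simp only [Prod.mk.injEq] at h
            exact hne ⟨h.1.symm, h.2.symm⟩
          have hpair : ({(j, i), (j', i')} : Finset (J × Fin k)) ⊆
              {p ∈ G ×ˢ (univ : Finset (Fin k)) | leg p.1 p.2 = some v} := by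
            intro p hp
            rcases Finset.mem_insert.mp hp with rfl | hp
            · exact hmem
            · rw [Finset.mem_singleton] at hp
              subst hp
              simp [hj', hi']
          have := Finset.sum_le_sum_of_subset_of_nonneg (f := w) hpair
            (fun p _ _ => zero_le_one.trans (hw1 p))
          rw [Finset.sum_pair hne'] at this
          have a1 := hw1 (j, i)
          have a2 := hw1 (j', i')
          omega
  have hsum : ∑ v ∈ scopeVars leg G, (if v ∈ A then (1 : ℤ) else if v ∈ T then 1 else 2)
      ≥ 2 * #(scopeVars leg G \ A) + #(scopeVars leg G ∩ A) - #T := by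
    have e : ∀ v ∈ scopeVars leg G, (if v ∈ A then (1 : ℤ) else if v ∈ T then 1 else 2)
        = 2 * (if v ∈ A then 0 else 1) + (if v ∈ A then 1 else 0) - (if v ∈ T then 1 else 0) := by
      intro v _
      by_cases hA : v ∈ A
      · simp [hA, Finset.disjoint_left.mp hAT hA]
      · by_cases hT : v ∈ T <;> simp [hA, hT]
    rw [Finset.sum_congr rfl e, Finset.sum_sub_distrib, Finset.sum_add_distrib, ← Finset.mul_sum]
    have e1 : ∑ v ∈ scopeVars leg G, (if v ∈ A then (0 : ℤ) else 1) = #(scopeVars leg G \ A) := by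
      rw [Finset.sdiff_eq_filter, Finset.card_filter]
      push_cast
      exact Finset.sum_congr rfl fun v _ => by split_ifs <;> simp_all
    have e2 : ∑ v ∈ scopeVars leg G, (if v ∈ A then (1 : ℤ) else 0) = #(scopeVars leg G ∩ A) := by
      rw [← Finset.filter_mem_eq_inter, Finset.card_filter]
      push_cast
      rfl
    have e3 : ∑ v ∈ scopeVars leg G, (if v ∈ T then (1 : ℤ) else 0) ≤ #T := by
      rw [Finset.sum_boole]
      exact_mod_cast Finset.card_le_card fun v hv => (Finset.mem_filter.mp hv).2
    rw [e1, e2]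
    linarith
  unfold potential
  linarith

end Closure

section LocalDensity

variable {V J : Type} [Fintype V] [DecidableEq V] [Fintype J] [DecidableEq J] {k : ℕ}

open Classical in
/-- The densities `D j` are nonnegative, depend on the variables of constraint `j` only, and
can be integrated out whenever fewer than `t` positions of the constraint are not free. -/
structure IsLocalDensity (leg : J → Fin k → Option V) (t : ℕ) (D : J → (V → Bool) → ℝ) :
    Prop where
  nonneg : ∀ j y, 0 ≤ D j y
  dependsOn : ∀ j, DependsOn (D j) (scopeVars leg {j} : Set V)
  avg_erase : ∀ (S : Finset V) (F : Finset J), ∀ j ∈ F, #{i | ¬ IsFreeLeg leg S F j i} < t →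
    avg (chi S * ∏ j ∈ F, D j) = avg (chi S * ∏ j ∈ F.erase j, D j)

open Classical in
/-- The union of all closed sets of at most `s` constraints. -/
noncomputable def scopeClosure (leg : J → Fin k → Option V) (t s : ℕ) (S : Finset V) : Finset J :=
  {j | ∃ F : Finset J, #F ≤ s ∧ IsClosedSet leg t S F ∧ j ∈ F}

/-- The pseudoexpectation of a function of the cube: each character is averaged against the
densities of the constraints in its closure. -/
noncomputable def pseudoAvg (leg : J → Fin k → Option V) (t s : ℕ) (D : J → (V → Bool) → ℝ) :
    ((V → Bool) → ℝ) →ₗ[ℝ] ℝ :=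
  ∑ S : Finset V, avg (chi S * ∏ j ∈ scopeClosure leg t s S, D j) •
    (avg ∘ₗ LinearMap.mulRight ℝ (chi S))

variable {leg : J → Fin k → Option V} {t s : ℕ} {D : J → (V → Bool) → ℝ}

lemma pseudoAvg_chi (S : Finset V) :
    pseudoAvg leg t s D (chi S) = avg (chi S * ∏ j ∈ scopeClosure leg t s S, D j) := by
  unfold pseudoAvg
  simp only [LinearMap.sum_apply, LinearMap.smul_apply, LinearMap.comp_apply,
    LinearMap.mulRight_apply, avg_chi_mul_chi, smul_eq_mul]
  simp

lemma IsClosedSet.subset_scopeClosure {S : Finset V} {F : Finset J} (h : IsClosedSet leg t S F)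
    (hF : #F ≤ s) : F ⊆ scopeClosure leg t s S := by
  intro j hj
  simp only [scopeClosure, Finset.mem_filter, Finset.mem_univ, true_and]
  exact ⟨F, hF, h, hj⟩

lemma scopeClosure_subset {S : Finset V} {F : Finset J}
    (h : ∀ K : Finset J, #K ≤ s → IsClosedSet leg t S K → K ⊆ F) : scopeClosure leg t s S ⊆ F := by
  intro j hj
  simp only [scopeClosure, Finset.mem_filter, Finset.mem_univ, true_and] at hj
  obtain ⟨K, hK, hc, hjK⟩ := hj
  exact h K hK hc hjK

lemma isClosedSet_scopeClosure (S : Finset V) : IsClosedSet leg t S (scopeClosure leg t s S) := by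
  intro j hj
  have hj' := hj
  simp only [scopeClosure, Finset.mem_filter, Finset.mem_univ, true_and] at hj'
  obtain ⟨F, hF, hc, hjF⟩ := hj'
  exact hc.le_card_of_subset (hc.subset_scopeClosure hF) hjF

/-- Averaging a character against any small set of constraints containing its closure gives
the same value. -/
lemma IsLocalDensity.avg_eq_pseudoAvg (hD : IsLocalDensity leg t D) {S : Finset V} :
    ∀ (F : Finset J), scopeClosure leg t s S ⊆ F → #F ≤ s →
      avg (chi S * ∏ j ∈ F, D j) = pseudoAvg leg t s D (chi S) := by
  classical
  intro F
  induction F using Finset.strongInduction with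
  | H F ih =>
    intro hF hs
    by_cases hEq : scopeClosure leg t s S = F
    · rw [← hEq, pseudoAvg_chi]
    · have hnot : ¬ IsClosedSet leg t S F := fun h =>
        hEq (Finset.Subset.antisymm hF (h.subset_scopeClosure hs))
      unfold IsClosedSet at hnot
      push Not at hnot
      obtain ⟨j, hj, hjt⟩ := hnot
      have hjc : j ∉ scopeClosure leg t s S := fun h =>
        absurd ((isClosedSet_scopeClosure S).le_card_of_subset hF h) (not_le.mpr hjt)
      rw [hD.avg_erase S F j hj hjt]
      refine ih _ (Finset.erase_ssubset hj) (fun a ha => ?_)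
        ((Finset.card_le_card (Finset.erase_subset _ _)).trans hs)
      exact Finset.mem_erase.mpr ⟨fun h => hjc (h ▸ ha), hF ha⟩

lemma IsLocalDensity.prod_dependsOn (hD : IsLocalDensity leg t D) (F : Finset J) :
    DependsOn (∏ j ∈ F, D j) (scopeVars leg F : Set V) := by
  intro x y h
  simp only [Finset.prod_apply]
  refine Finset.prod_congr rfl fun j hj => hD.dependsOn j fun v hv => h v ?_
  obtain ⟨j', hj', i, hi⟩ := mem_scopeVars.mp hv
  rw [Finset.mem_singleton] at hj'
  exact mem_scopeVars.mpr ⟨j, hj, i, hj' ▸ hi⟩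

lemma IsLocalDensity.prod_nonneg (hD : IsLocalDensity leg t D) (F : Finset J) (y : V → Bool) :
    0 ≤ (∏ j ∈ F, D j) y := by
  rw [Finset.prod_apply]
  exact Finset.prod_nonneg fun j _ => hD.nonneg j y

/-- Small sets of constraints expand: they have potential at least `ζ` per constraint. -/
def IsExpanding (leg : J → Fin k → Option V) (t s : ℕ) (ζ : ℝ) : Prop :=
  ∀ F : Finset J, #F ≤ s → ζ * #F ≤ potential leg t ∅ F

lemma IsExpanding.card_le {ζ : ℝ} (hE : IsExpanding leg t s ζ) {S : Finset V} {K : Finset J}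
    (hK : #K ≤ s) (hc : IsClosedSet leg t S K) : ζ * #K ≤ #S := by
  have h1 := hE K hK
  have h2 := IsClosedSet.potential_add_card_le (A := ∅) (T := S) (Finset.disjoint_empty_left S)
    (by rwa [Finset.empty_union])
  have h3 : (potential leg t ∅ K : ℝ) + #(scopeVars leg K ∩ ∅) ≤ #S := by exact_mod_cast h2
  have h4 : (0 : ℝ) ≤ #(scopeVars leg K ∩ ∅) := by positivity
  linarith

lemma pseudoAvg_one {ζ : ℝ} (hζ : 0 < ζ) (hE : IsExpanding leg t s ζ) :
    pseudoAvg leg t s D 1 = 1 := by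
  rw [← chi_empty, pseudoAvg_chi]
  have : scopeClosure leg t s ∅ = ∅ := by
    refine Finset.subset_empty.mp (scopeClosure_subset fun K hK hc => ?_)
    have h := hE.card_le hK hc
    rw [Finset.card_empty, Nat.cast_zero] at h
    have : (#K : ℝ) ≤ 0 := by
      by_contra! hcon
      nlinarith
    rw [Finset.subset_empty, ← Finset.card_eq_zero]
    exact_mod_cast le_antisymm this (Nat.cast_nonneg _)
  rw [this, Finset.prod_empty, mul_one, chi_empty, avg_one]

/-- A set of constraints of least potential relative to `S`, and of largest size among those. -/
lemma exists_extremal_set (leg : J → Fin k → Option V) (t s : ℕ) (S : Finset V) :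
    ∃ F : Finset J, #F ≤ s ∧ potential leg t S F ≤ 0 ∧
      (∀ G, Disjoint F G → #(F ∪ G) ≤ s → G.Nonempty →
        0 < potential leg t (S ∪ scopeVars leg F) G) := by
  classical
  obtain ⟨F₀, hF₀, hmin⟩ := Finset.exists_min_image
    ({F | #F ≤ s} : Finset (Finset J)) (potential leg t S) ⟨∅, by simp⟩
  simp only [Finset.mem_filter, Finset.mem_univ, true_and] at hF₀ hmin
  obtain ⟨F, hF, hmax⟩ := Finset.exists_max_image
    ({F | #F ≤ s ∧ potential leg t S F ≤ potential leg t S F₀} : Finset (Finset J)) (fun F => #F)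
    ⟨F₀, by simp [hF₀]⟩
  simp only [Finset.mem_filter, Finset.mem_univ, true_and] at hF hmax
  refine ⟨F, hF.1, ?_, fun G hdisj hs hne => ?_⟩
  · have := hmin ∅ (by simp)
    rw [potential_empty] at this
    exact hF.2.trans this
  · by_contra! hcon
    have h1 := potential_union (leg := leg) (t := t) S hdisj
    have h2 := hmax (F ∪ G) ⟨hs, by linarith [hF.2]⟩
    rw [Finset.card_union_of_disjoint hdisj] at h2
    have := hne.card_pos
    omega

lemma avg_mul_nonneg_of_sq {g ρ : (V → Bool) → ℝ} (hρ : ∀ y, 0 ≤ ρ y) :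
    0 ≤ avg (g * g * ρ) :=
  avg_nonneg fun y => mul_nonneg (mul_self_nonneg _) (hρ y)

/-- Local Gram–Schmidt orthogonalization of a character against the preceding ones. -/
lemma IsLocalDensity.exists_orthogonalization (hD : IsLocalDensity leg t D) {ζ : ℝ} (hζ : 0 < ζ)
    (hE : IsExpanding leg t s ζ) {h : ℕ} (hh : 6 * (h : ℝ) ≤ ζ * s) {S : Finset V} (hS : #S ≤ h)
    {𝒯 : Finset (Finset V)} (h𝒯 : ∀ T ∈ 𝒯, #T ≤ #S) (h𝒯' : ∀ T, #T < #S → T ∈ 𝒯) :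
    ∃ w ∈ Submodule.span ℝ (chi '' (𝒯 : Set (Finset V))),
      (∀ T ∈ 𝒯, pseudoAvg leg t s D ((chi S - w) * chi T) = 0) ∧
      0 ≤ pseudoAvg leg t s D ((chi S - w) * (chi S - w)) := by
  classical
  obtain ⟨F, hFs, hFpot, hFmax⟩ := exists_extremal_set leg t s S
  set A := S ∪ scopeVars leg F with hA
  set ρ := ∏ j ∈ F, D j with hρ
  have hρdep : DependsOn ρ (A : Set V) := (hD.prod_dependsOn F).mono (by
    rw [hA]; exact_mod_cast Finset.subset_union_right)
  have hSr : (#S : ℝ) ≤ h := by exact_mod_cast hS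
  -- size bound for sets of bounded potential
  have hsize : ∀ K : Finset J, #K ≤ s → ∀ m : ℤ, potential leg t S K ≤ m →
      ζ * #K ≤ m + 2 * h := by
    intro K hK m hm
    have h1 := hE K hK
    have h2 := potential_ge_empty (leg := leg) (t := t) S K
    have h3 : (potential leg t ∅ K : ℝ) - 2 * #S ≤ m := by exact_mod_cast h2.trans hm
    linarith
  have hFsize : ζ * #F ≤ 2 * h := by simpa using hsize F hFs 0 hFpot
  have hle_s : ∀ a : ℝ, ζ * a ≤ 6 * h → a ≤ s := fun a ha =>
    le_of_mul_le_mul_left (ha.trans hh) hζ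
  have hKsize : ∀ Q : Finset V, #Q ≤ 2 * h → ∀ K : Finset J, #K ≤ s → IsClosedSet leg t Q K →
      #(F ∪ K) ≤ s := by
    intro Q hQ K hK hc
    have h1 := hE.card_le hK hc
    have h2 : (#Q : ℝ) ≤ 2 * h := by exact_mod_cast hQ
    have h3 : (#(F ∪ K) : ℝ) ≤ #F + #K := by exact_mod_cast Finset.card_union_le F K
    have : (#(F ∪ K) : ℝ) ≤ s := hle_s _ (by nlinarith)
    exact_mod_cast this
  have hsymm : ∀ R T : Finset V, #R ≤ #S → #T ≤ #S → #(symmDiff R T) ≤ 2 * h := by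
    intro R T hR hT
    have h1 : symmDiff R T ⊆ R ∪ T := fun v hv => by
      rw [Finset.mem_symmDiff] at hv
      rw [Finset.mem_union]
      tauto
    have h2 := (Finset.card_le_card h1).trans (Finset.card_union_le R T)
    omega
  -- products of characters inside `A` are evaluated by the density `ρ`
  have hlocal : ∀ R T : Finset V, R ⊆ A → T ⊆ A → #R ≤ #S → #T ≤ #S →
      pseudoAvg leg t s D (chi R * chi T) = avg (chi R * chi T * ρ) := by
    intro R T hR hT hRS hTS
    rw [chi_mul_chi]
    refine (hD.avg_eq_pseudoAvg F (scopeClosure_subset fun K hK hc => ?_) hFs).symm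
    have hsub : symmDiff R T ⊆ A := fun v hv => by
      rw [Finset.mem_symmDiff] at hv
      rcases hv with hv | hv
      exacts [hR hv.1, hT hv.1]
    have hcl : IsClosedSet leg t (A ∪ ∅) (K \ F) := by
      rw [Finset.union_empty]
      exact hc.sdiff hsub (by rw [hA]; exact Finset.subset_union_right)
    by_contra hne
    have hne' : (K \ F).Nonempty := Finset.sdiff_nonempty.mpr hne
    have h1 := hFmax (K \ F) Finset.disjoint_sdiff (by
      rw [Finset.union_sdiff_self_eq_union]
      exact hKsize _ (hsymm R T hRS hTS) K hK hc) hne'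
    have h2 := hcl.potential_add_card_le (Finset.disjoint_empty_right A)
    rw [Finset.card_empty] at h2
    omega
  -- the local projection
  let W : Submodule ℝ ((V → Bool) → ℝ) := Submodule.span ℝ (chi '' {T | T ∈ 𝒯 ∧ T ⊆ A})
  obtain ⟨w, hwW, hw⟩ := exists_weighted_projection ρ (hD.prod_nonneg F) W (chi S)
  have hSA : S ⊆ A := by rw [hA]; exact Finset.subset_union_left
  let W' : Submodule ℝ ((V → Bool) → ℝ) := Submodule.span ℝ (chi '' {T | #T ≤ #S ∧ T ⊆ A})
  have hY : chi S - w ∈ W' := by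
    refine Submodule.sub_mem _ (Submodule.subset_span ⟨S, ⟨le_refl _, hSA⟩, rfl⟩) ?_
    refine Submodule.span_mono (Set.image_mono ?_) hwW
    exact fun T hT => ⟨h𝒯 T hT.1, hT.2⟩
  set Y := chi S - w with hYdef
  have hYdep : DependsOn Y (A : Set V) := by
    intro x y hxy
    refine Submodule.span_induction (p := fun g _ => g x = g y) ?_ rfl ?_ ?_ hY
    · rintro _ ⟨T, hT, rfl⟩
      exact chi_dependsOn T fun v hv => hxy v (hT.2 hv)
    · intro f g _ _ hf hg
      simp [hf, hg]
    · intro a f _ hf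
      simp [hf]
  have horth : ∀ T ∈ 𝒯, T ⊆ A → avg (Y * chi T * ρ) = 0 := by
    intro T hT hTA
    rw [avg_apply]
    have := hw (chi T) (Submodule.subset_span ⟨T, ⟨hT, hTA⟩, rfl⟩)
    simp only [Pi.mul_apply, hYdef, Pi.sub_apply]
    rw [this, mul_zero]
  -- evaluating `Y` times a character by a density
  have heval : ∀ (g η : (V → Bool) → ℝ),
      (∀ R, R ⊆ A → #R ≤ #S → pseudoAvg leg t s D (chi R * g) = avg (chi R * g * η)) →
      pseudoAvg leg t s D (Y * g) = avg (Y * g * η) := by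
    intro g η hg
    refine Submodule.span_induction
      (p := fun f _ => pseudoAvg leg t s D (f * g) = avg (f * g * η)) ?_ ?_ ?_ ?_ hY
    · rintro _ ⟨R, hR, rfl⟩
      exact hg R hR.2 hR.1
    · simp
    · intro f f' _ _ hf hf'
      simp only [add_mul, map_add, hf, hf']
    · intro a f _ hf
      simp only [smul_mul_assoc, map_smul, hf]
  refine ⟨w, Submodule.span_mono (Set.image_mono fun T hT => hT.1) hwW, fun T hT => ?_, ?_⟩
  · by_cases hTA : T ⊆ A
    · rw [heval (chi T) ρ fun R hRA hRS => hlocal R T hRA hTA hRS (h𝒯 T hT)]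
      exact horth T hT hTA
    -- the largest closed set attached to `A ∪ T`
    set T' := T \ A with hT'
    have hT'pos : 0 < #T' := (Finset.sdiff_nonempty.mpr hTA).card_pos
    have hT'card : #(T ∩ A) + #T' = #T := by
      rw [add_comm]; exact Finset.card_sdiff_add_card_inter T A
    have hdisj : Disjoint A T' := Finset.disjoint_sdiff
    have hTS := h𝒯 T hT
    have hGsize : ∀ G, Disjoint F G → #(F ∪ G) ≤ s → IsClosedSet leg t (A ∪ T') G →
        ζ * #(F ∪ G) ≤ 3 * h := by
      intro G hFG hs hG
      have h1 := potential_union (leg := leg) (t := t) S hFG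
      have h2 := hG.potential_add_card_le hdisj
      have h3 := hsize (F ∪ G) hs h (by
        rw [h1, ← hA]
        have : (#T' : ℤ) ≤ h := by
          have : #T' ≤ h := by omega
          exact_mod_cast this
        omega)
      push_cast at h3
      linarith
    obtain ⟨G, hGmem, hGmax⟩ := Finset.exists_max_image
      ({G | Disjoint F G ∧ #(F ∪ G) ≤ s ∧ IsClosedSet leg t (A ∪ T') G} : Finset (Finset J))
      (fun G => #G) ⟨∅, by
        simp only [Finset.mem_filter, Finset.mem_univ, true_and]
        exact ⟨Finset.disjoint_empty_right _, by simpa using hFs, fun j hj => by simp at hj⟩⟩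
    simp only [Finset.mem_filter, Finset.mem_univ, true_and] at hGmem hGmax
    obtain ⟨hFG, hGs, hGc⟩ := hGmem
    have hGall : ∀ K, Disjoint F K → #(F ∪ K) ≤ s → IsClosedSet leg t (A ∪ T') K → K ⊆ G := by
      intro K hFK hKs hKc
      have h1 := hGsize K hFK hKs hKc
      have h2 := hGsize G hFG hGs hGc
      have h3 : (#(F ∪ (G ∪ K)) : ℝ) ≤ #(F ∪ G) + #(F ∪ K) := by
        have : F ∪ (G ∪ K) = (F ∪ G) ∪ (F ∪ K) := by
          ext; simp only [Finset.mem_union]; tauto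
        rw [this]
        exact_mod_cast Finset.card_union_le _ _
      have h4 : #(F ∪ (G ∪ K)) ≤ s := by
        have : (#(F ∪ (G ∪ K)) : ℝ) ≤ s := hle_s _ (by nlinarith)
        exact_mod_cast this
      have h5 := hGmax (G ∪ K)
        ⟨Finset.disjoint_union_right.mpr ⟨hFG, hFK⟩, h4, hGc.union hKc⟩
      have h6 := Finset.eq_of_subset_of_card_le Finset.subset_union_left h5
      rw [h6]
      exact Finset.subset_union_right
    have hB : #(scopeVars leg G ∩ A) < #T' := by
      rcases G.eq_empty_or_nonempty with rfl | hne
      · have : scopeVars leg (∅ : Finset J) = ∅ := by ext; simp [mem_scopeVars]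
        simpa [this] using hT'pos
      · have h1 := hFmax G hFG hGs hne
        have h2 := hGc.potential_add_card_le hdisj
        omega
    set r := chi T' * ∏ j ∈ G, D j with hr
    rw [heval (chi T) (∏ j ∈ F ∪ G, D j) fun R hRA hRS => by
      rw [chi_mul_chi]
      refine (hD.avg_eq_pseudoAvg _ (scopeClosure_subset fun K hK hc => ?_) hGs).symm
      have hsub : symmDiff R T ⊆ A ∪ T' := fun v hv => by
        rw [Finset.mem_symmDiff] at hv
        rw [Finset.mem_union, hT', Finset.mem_sdiff]
        rcases hv with hv | hv
        · exact Or.inl (hRA hv.1)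
        · by_cases hvA : v ∈ A
          exacts [Or.inl hvA, Or.inr ⟨hv.1, hvA⟩]
      have h1 := hGall (K \ F) Finset.disjoint_sdiff (by
        rw [Finset.union_sdiff_self_eq_union]
        exact hKsize _ (hsymm R T hRS hTS) K hK hc)
        (hc.sdiff hsub (by
          rw [hA]
          exact Finset.subset_union_right.trans Finset.subset_union_left))
      intro j hj
      by_cases hjF : j ∈ F
      · exact Finset.mem_union_left _ hjF
      · exact Finset.mem_union_right _ (h1 (Finset.mem_sdiff.mpr ⟨hj, hjF⟩))]
    have hsplit : Y * chi T * ∏ j ∈ F ∪ G, D j = Y * chi (T ∩ A) * ρ * r := by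
      have hchi : chi T = chi (T ∩ A) * chi T' := by
        rw [chi_mul_chi]
        congr 1
        ext v
        simp only [hT', Finset.mem_symmDiff, Finset.mem_inter, Finset.mem_sdiff]
        tauto
      rw [Finset.prod_union hFG, hchi, hr, hρ]
      ring
    rw [hsplit, fourier_inversion r, Finset.mul_sum, map_sum]
    refine Finset.sum_eq_zero fun Q _ => ?_
    rw [mul_smul_comm, map_smul, smul_eq_mul]
    by_cases hQA : Q ⊆ A
    · by_cases hQr : Q ⊆ T' ∪ scopeVars leg G
      · have hQB : Q ⊆ scopeVars leg G ∩ A := fun v hv => by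
          rw [Finset.mem_inter]
          refine ⟨?_, hQA hv⟩
          rcases Finset.mem_union.mp (hQr hv) with h' | h'
          · exact absurd (hQA hv) (Finset.mem_sdiff.mp h').2
          · exact h'
        have hsub : symmDiff (T ∩ A) Q ⊆ (T ∩ A) ∪ Q := fun v hv => by
          rw [Finset.mem_symmDiff] at hv
          rw [Finset.mem_union]
          tauto
        have hcard : #(symmDiff (T ∩ A) Q) < #S := by
          have h1 := (Finset.card_le_card hsub).trans (Finset.card_union_le _ _)
          have h2 := Finset.card_le_card hQB
          omega
        have hzero := horth (symmDiff (T ∩ A) Q) (h𝒯' _ hcard)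
          (hsub.trans (Finset.union_subset Finset.inter_subset_right hQA))
        rw [← chi_mul_chi] at hzero
        have : Y * chi (T ∩ A) * ρ * chi Q = Y * (chi (T ∩ A) * chi Q) * ρ := by ring
        rw [this, hzero, mul_zero]
      · have hrdep : DependsOn r ((T' ∪ scopeVars leg G : Finset V) : Set V) := by
          intro x y hxy
          rw [hr, Pi.mul_apply, Pi.mul_apply]
          congr 1
          · exact chi_dependsOn T' fun v hv => hxy v (by
              rw [Finset.mem_coe]; exact Finset.mem_union_left _ hv)
          · exact hD.prod_dependsOn G fun v hv => hxy v (by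
              rw [Finset.mem_coe]; exact Finset.mem_union_right _ hv)
        rw [avg_mul_chi_eq_zero hrdep hQr, zero_mul]
    · have hdep : DependsOn (Y * chi (T ∩ A) * ρ) (A : Set V) := by
        intro x y hxy
        simp only [Pi.mul_apply]
        rw [hYdep hxy, hρdep hxy, chi_dependsOn (T ∩ A) fun v hv => hxy v
          (Finset.inter_subset_right hv)]
      rw [avg_mul_chi_eq_zero hdep hQA, mul_zero]
  · rw [heval Y ρ fun R hRA hRS => by
      rw [mul_comm (chi R) Y]
      exact heval (chi R) ρ fun R' hRA' hRS' => hlocal R' R hRA' hRA hRS' hRS]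
    exact avg_mul_nonneg_of_sq (hD.prod_nonneg F)

/-- The pseudoexpectation is nonnegative on squares of functions of low degree. -/
lemma IsLocalDensity.pseudoAvg_sq_nonneg (hD : IsLocalDensity leg t D) {ζ : ℝ} (hζ : 0 < ζ)
    (hE : IsExpanding leg t s ζ) {h : ℕ} (hh : 6 * (h : ℝ) ≤ ζ * s) {f : (V → Bool) → ℝ}
    (hf : f ∈ Submodule.span ℝ (chi '' {T : Finset V | #T ≤ h})) :
    0 ≤ pseudoAvg leg t s D (f * f) := by
  classical
  have key : ∀ (m : ℕ) (𝒯 : Finset (Finset V)), #𝒯 = m → (∀ T ∈ 𝒯, #T ≤ h) →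
      (∀ S ∈ 𝒯, ∀ T : Finset V, #T < #S → T ∈ 𝒯) →
      ∀ f ∈ Submodule.span ℝ (chi '' (𝒯 : Set (Finset V))),
        0 ≤ pseudoAvg leg t s D (f * f) := by
    intro m
    induction m with
    | zero =>
      intro 𝒯 hm _ _ f hf
      rw [Finset.card_eq_zero.mp hm] at hf
      simp only [Finset.coe_empty, Set.image_empty, Submodule.span_empty,
        Submodule.mem_bot] at hf
      simp [hf]
    | succ m ih =>
      intro 𝒯 hm hcard hdown f hf
      obtain ⟨S, hS, hSmax⟩ := Finset.exists_max_image 𝒯 (fun T => #T)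
        (Finset.card_pos.mp (by omega))
      have hins : chi '' (𝒯 : Set (Finset V))
          = insert (chi S) (chi '' ((𝒯.erase S : Finset (Finset V)) : Set (Finset V))) := by
        rw [← Set.image_insert_eq, ← Finset.coe_insert, Finset.insert_erase hS]
      obtain ⟨w, hw, hworth, hwpos⟩ := hD.exists_orthogonalization hζ hE hh (hcard S hS)
        (𝒯 := 𝒯.erase S) (fun T hT => hSmax T (Finset.mem_of_mem_erase hT))
        (fun T hT => Finset.mem_erase.mpr ⟨fun h => by rw [h] at hT; exact lt_irrefl _ hT,
          hdown S hS T hT⟩)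
      rw [hins] at hf
      obtain ⟨a, g, hg, rfl⟩ := Submodule.mem_span_insert.mp hf
      set Y := chi S - w with hY
      have hg' : g + a • w ∈ Submodule.span ℝ
          (chi '' ((𝒯.erase S : Finset (Finset V)) : Set (Finset V))) :=
        Submodule.add_mem _ hg (Submodule.smul_mem _ _ hw)
      set g' := g + a • w with hgdef
      have hdecomp : a • chi S + g = a • Y + g' := by
        rw [hY, hgdef, smul_sub]; abel
      have hYg : pseudoAvg leg t s D (Y * g') = 0 := by
        refine Submodule.span_induction
          (p := fun f _ => pseudoAvg leg t s D (Y * f) = 0) ?_ ?_ ?_ ?_ hg'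
        · rintro _ ⟨T, hT, rfl⟩
          exact hworth T hT
        · simp
        · intro f f' _ _ hf hf'
          simp only [mul_add, map_add, hf, hf', add_zero]
        · intro a f _ hf
          simp only [mul_smul_comm, map_smul, hf, smul_zero]
      have hgg := ih (𝒯.erase S) (by rw [Finset.card_erase_of_mem hS]; omega)
        (fun T hT => hcard T (Finset.mem_of_mem_erase hT))
        (fun S' hS' T hT => Finset.mem_erase.mpr ⟨fun h => by
          have := hSmax S' (Finset.mem_of_mem_erase hS')
          rw [h] at hT
          exact absurd hT (not_lt.mpr this), hdown S' (Finset.mem_of_mem_erase hS') T hT⟩)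
        g' hg'
      have hexp : (a • Y + g') * (a • Y + g')
          = (a * a) • (Y * Y) + (2 * a) • (Y * g') + g' * g' := by
        funext y
        simp only [Pi.mul_apply, Pi.add_apply, Pi.smul_apply, smul_eq_mul]
        ring
      rw [hdecomp, hexp, map_add, map_add, map_smul, map_smul, hYg, smul_zero, add_zero,
        smul_eq_mul]
      exact add_nonneg (mul_nonneg (mul_self_nonneg a) hwpos) hgg
  refine key _ {T | #T ≤ h} rfl (fun T hT => by simpa using hT)
    (fun S hS T hT => ?_) f (by simpa using hf)
  simp only [Finset.mem_filter, Finset.mem_univ, true_and] at hS ⊢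
  omega

/-- A function supported where the density of constraint `j` vanishes has pseudoexpectation
zero. -/
lemma IsLocalDensity.pseudoAvg_eq_zero (hD : IsLocalDensity leg t D) {ζ : ℝ} (hζ : 0 < ζ)
    (hE : IsExpanding leg t s ζ) (hs : 2 * (k : ℝ) + ζ ≤ ζ * s) {j : J} {f : (V → Bool) → ℝ}
    (hf : DependsOn f (scopeVars leg {j} : Set V)) (hfD : f * D j = 0) :
    pseudoAvg leg t s D f = 0 := by
  classical
  have hcardvars : #(scopeVars leg {j}) ≤ k := by
    have : (scopeVars leg {j}).map Function.Embedding.some ⊆ univ.image (leg j) := by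
      intro o ho
      obtain ⟨v, hv, rfl⟩ := Finset.mem_map.mp ho
      obtain ⟨j', hj', i, hi⟩ := mem_scopeVars.mp hv
      rw [Finset.mem_singleton] at hj'
      subst hj'
      exact Finset.mem_image.mpr ⟨i, Finset.mem_univ _, hi⟩
    have := (Finset.card_le_card this).trans Finset.card_image_le
    simpa using this
  have hsmall : ∀ G : Finset J, #G ≤ s → IsClosedSet leg t (scopeVars leg {j}) G →
      ζ * #G ≤ k := fun G hG hc => (hE.card_le hG hc).trans (by exact_mod_cast hcardvars)
  obtain ⟨G, hGmem, hGmax⟩ := Finset.exists_max_image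
    ({G | #G ≤ s ∧ IsClosedSet leg t (scopeVars leg {j}) G} : Finset (Finset J))
    (fun G => #G) ⟨∅, by
      simp only [Finset.mem_filter, Finset.mem_univ, true_and]
      exact ⟨by simp, fun j hj => by simp at hj⟩⟩
  simp only [Finset.mem_filter, Finset.mem_univ, true_and] at hGmem hGmax
  obtain ⟨hGs, hGc⟩ := hGmem
  have hG := hsmall G hGs hGc
  have hGall : ∀ K, #K ≤ s → IsClosedSet leg t (scopeVars leg {j}) K → K ⊆ G := by
    intro K hKs hKc
    have h1 := hsmall K hKs hKc
    have h2 : (#(G ∪ K) : ℝ) ≤ #G + #K := by exact_mod_cast Finset.card_union_le G K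
    have h3 : (#(G ∪ K) : ℝ) ≤ s := le_of_mul_le_mul_left (by nlinarith) hζ
    have h4 := hGmax (G ∪ K) ⟨by exact_mod_cast h3, hGc.union hKc⟩
    rw [Finset.eq_of_subset_of_card_le Finset.subset_union_left h4]
    exact Finset.subset_union_right
  have hFs : #(insert j G) ≤ s := by
    have h1 : (#(insert j G) : ℝ) ≤ #G + 1 := by exact_mod_cast Finset.card_insert_le j G
    have h2 : (#(insert j G) : ℝ) ≤ s := le_of_mul_le_mul_left (by nlinarith) hζ
    exact_mod_cast h2
  have hEq : pseudoAvg leg t s D f = avg (f * ∏ i ∈ insert j G, D i) := by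
    rw [fourier_inversion f, Finset.sum_mul, map_sum, map_sum]
    refine Finset.sum_congr rfl fun Q _ => ?_
    rw [smul_mul_assoc, map_smul, map_smul]
    by_cases hQ : Q ⊆ scopeVars leg {j}
    · rw [hD.avg_eq_pseudoAvg _ (scopeClosure_subset fun K hK hc => ?_) hFs]
      exact (hGall K hK (hc.mono hQ)).trans (Finset.subset_insert j G)
    · rw [avg_mul_chi_eq_zero hf hQ, zero_smul, zero_smul]
  rw [hEq, ← Finset.mul_prod_erase _ _ (Finset.mem_insert_self j G), ← mul_assoc, hfD, zero_mul,
    map_zero]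

end LocalDensity

section Literals

variable {V J : Type} [Fintype V] [DecidableEq V] [Fintype J] [DecidableEq J] {k : ℕ}

/-- The value of a literal: a constant, or a possibly negated variable. -/
def litVal (l : Option V × Bool) (y : V → Bool) : Bool :=
  l.1.elim l.2 fun v => xor (y v) l.2

/-- The density of the distribution `ν` planted on the literals of constraint `j`. -/
noncomputable def plantedDensity (ν : (Fin k → Bool) → ℝ) (lits : J → Fin k → Option V × Bool)
    (j : J) (y : V → Bool) : ℝ :=
  2 ^ k * ν fun i => litVal (lits j i) y

lemma card_agree_mul {ι : Type} [Fintype ι] [DecidableEq ι] (A : Finset ι) (a : ι → Bool) :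
    #{x : ι → Bool | ∀ i ∈ A, x i = a i} * 2 ^ #A = 2 ^ Fintype.card ι := by
  have h : ({x : ι → Bool | ∀ i ∈ A, x i = a i} : Finset (ι → Bool))
      = Fintype.piFinset fun i => if i ∈ A then {a i} else univ := by
    ext x
    simp only [Finset.mem_filter, Finset.mem_univ, true_and, Fintype.mem_piFinset]
    refine forall_congr' fun i => ?_
    by_cases hi : i ∈ A <;> simp [hi]
  rw [h, Fintype.card_piFinset]
  have h2 : ∀ i, #(if i ∈ A then {a i} else (univ : Finset Bool)) = if i ∈ A then 1 else 2 := by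
    intro i; split_ifs <;> simp
  simp only [h2]
  rw [Finset.prod_ite, Finset.prod_const_one, one_mul, Finset.prod_const, ← pow_add]
  congr 1
  rw [Finset.filter_not, Finset.filter_mem_eq_inter, Finset.univ_inter]
  exact Finset.card_sdiff_add_card_eq_card (Finset.subset_univ A)

lemma sum_xor_of_kwiseUniform {m : ℕ} {ν : (Fin k → Bool) → ℝ} (hν : kwiseUniform m ν)
    {A : Finset (Fin k)} (hA : #A ≤ m) (x : Fin k → Bool) :
    ∑ u ∈ univ.filter (fun u : Fin k → Bool => ∀ i ∈ A, u i = false),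
      ν (fun i => xor (x i) (u i)) = (1 / 2 : ℝ) ^ #A := by
  rw [← hν A hA x]
  refine Finset.sum_bij' (fun u _ i => xor (x i) (u i)) (fun u _ i => xor (x i) (u i))
    ?_ ?_ ?_ ?_ ?_
  · intro u hu
    simp only [Finset.mem_filter, Finset.mem_univ, true_and] at hu ⊢
    intro i hi; simp [hu i hi]
  · intro u hu
    simp only [Finset.mem_filter, Finset.mem_univ, true_and] at hu ⊢
    intro i hi; simp [hu i hi]
  · intro u _; funext i; simp
  · intro u _; funext i; simp
  · intro u _; rfl

lemma plantedDensity_dependsOn (ν : (Fin k → Bool) → ℝ) (lits : J → Fin k → Option V × Bool)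
    (j : J) : DependsOn (plantedDensity ν lits j)
      (scopeVars (fun j i => (lits j i).1) {j} : Set V) := by
  intro x y h
  unfold plantedDensity
  congr 2
  funext i
  unfold litVal
  cases hl : (lits j i).1 with
  | none => rfl
  | some v =>
    have := h v (by
      rw [Finset.mem_coe, mem_scopeVars]
      exact ⟨j, Finset.mem_singleton_self j, i, hl⟩)
    simp [this]

lemma isLocalDensity_plantedDensity {t : ℕ} (ht : 1 ≤ t) {ν : (Fin k → Bool) → ℝ}
    (hν0 : ∀ x, 0 ≤ ν x) (hν : kwiseUniform (t - 1) ν) (lits : J → Fin k → Option V × Bool) :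
    IsLocalDensity (fun j i => (lits j i).1) t (plantedDensity ν lits) where
  nonneg j y := mul_nonneg (by positivity) (hν0 _)
  dependsOn j := plantedDensity_dependsOn ν lits j
  avg_erase S F j hj hlt := by
    classical
    set leg : J → Fin k → Option V := fun j i => (lits j i).1 with hleg
    set A : Finset (Fin k) := {i | ¬ IsFreeLeg leg S F j i} with hA
    set g : (V → Bool) → ℝ := chi S * ∏ i ∈ F.erase j, plantedDensity ν lits i with hg
    have hprod : chi S * ∏ i ∈ F, plantedDensity ν lits i = g * plantedDensity ν lits j := by
      rw [hg, ← Finset.mul_prod_erase F _ hj]; ring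
    rw [hprod]
    have hflip : ∀ u : Fin k → Bool, (∀ i ∈ A, u i = false) →
        avg (g * plantedDensity ν lits j)
          = avg (fun y => g y * (2 ^ k * ν fun i => xor (litVal (lits j i) y) (u i))) := by
      intro u hu
      let w : V → Bool := fun v => decide (∃ i, IsFreeLeg leg S F j i ∧ leg j i = some v ∧ u i)
      rw [← avg_flip _ w]
      congr 1
      funext y
      rw [Pi.mul_apply]
      have hoff : ∀ v, (v ∈ S ∨ v ∈ scopeVars leg (F.erase j)) → w v = false := by
        intro v hv
        simp only [w, decide_eq_false_iff_not]
        rintro ⟨i, ⟨v', hv', hvS, huniq⟩, hiv, -⟩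
        have hvv : v' = v := Option.some_injective _ (hv'.symm.trans hiv)
        subst hvv
        rcases hv with hv | hv
        · exact hvS hv
        · obtain ⟨j', hj', i', hi'⟩ := mem_scopeVars.mp hv
          exact (Finset.mem_erase.mp hj').1
            (huniq j' (Finset.mem_of_mem_erase hj') i' hi').1
      congr 1
      · rw [hg, Pi.mul_apply, Pi.mul_apply, Finset.prod_apply, Finset.prod_apply]
        congr 1
        · exact chi_dependsOn S fun v hv => by simp [hoff v (Or.inl hv)]
        · refine Finset.prod_congr rfl fun j' hj' =>
            plantedDensity_dependsOn ν lits j' fun v hv => ?_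
          have : v ∈ scopeVars leg (F.erase j) := by
            obtain ⟨j'', hj'', i, hi⟩ := mem_scopeVars.mp hv
            rw [Finset.mem_singleton] at hj''
            subst hj''
            exact mem_scopeVars.mpr ⟨j'', hj', i, hi⟩
          simp [hoff v (Or.inr this)]
      · unfold plantedDensity
        congr 2
        funext i
        have hlegi : leg j i = (lits j i).1 := rfl
        unfold litVal
        cases hl : (lits j i).1 with
        | none =>
          have : u i = false := hu i (by
            simp only [hA, Finset.mem_filter, Finset.mem_univ, true_and]
            rintro ⟨v, hv, -⟩
            rw [hlegi, hl] at hv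
            exact absurd hv (by simp))
          simp [this]
        | some v =>
          have hwv : w v = u i := by
            by_cases hi : IsFreeLeg leg S F j i
            · obtain ⟨v', hv', -, huniq⟩ := id hi
              have hvv : v' = v := Option.some_injective _ (hv'.symm.trans (hlegi.trans hl))
              subst hvv
              rw [Bool.eq_iff_iff]
              simp only [w, decide_eq_true_eq]
              constructor
              · rintro ⟨i', -, hi', hui'⟩
                rwa [(huniq j hj i' hi').2] at hui'
              · exact fun h => ⟨i, hi, hv', h⟩
            · rw [hu i (by simpa [hA] using hi)]
              simp only [w, decide_eq_false_iff_not]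
              rintro ⟨i', ⟨v', hv', hvS, huniq⟩, hiv, -⟩
              have hvv : v' = v := Option.some_injective _ (hv'.symm.trans hiv)
              subst hvv
              have := (huniq j hj i (hlegi.trans hl)).2
              exact hi (this ▸ ⟨v', hv', hvS, huniq⟩)
          simp only [Option.elim_some, hwv]
          cases y v <;> cases u i <;> cases (lits j i).2 <;> rfl
    have hAt : #A ≤ t - 1 := by omega
    have hsum : (#(univ.filter fun u : Fin k → Bool => ∀ i ∈ A, u i = false) : ℝ)
        * avg (g * plantedDensity ν lits j) = 2 ^ k * (1 / 2 : ℝ) ^ #A * avg g := by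
      rw [← nsmul_eq_mul, ← Finset.sum_const]
      rw [Finset.sum_congr rfl fun u hu => hflip u (Finset.mem_filter.mp hu).2, ← map_sum,
        ← smul_eq_mul (a := 2 ^ k * (1 / 2 : ℝ) ^ #A), ← map_smul]
      congr 1
      funext y
      rw [Finset.sum_apply, ← Finset.mul_sum, ← Finset.mul_sum,
        sum_xor_of_kwiseUniform hν hAt, Pi.smul_apply, smul_eq_mul]
      ring
    have hcount : #(univ.filter fun u : Fin k → Bool => ∀ i ∈ A, u i = false) * 2 ^ #A = 2 ^ k := by
      have h := card_agree_mul A (fun _ => false)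
      rw [Fintype.card_fin] at h
      convert h
    have hcount' : (#(univ.filter fun u : Fin k → Bool => ∀ i ∈ A, u i = false) : ℝ)
        = 2 ^ k * (1 / 2 : ℝ) ^ #A := by
      rw [one_div, inv_pow, ← div_eq_mul_inv, eq_div_iff (by positivity)]
      exact_mod_cast hcount
    rw [hcount'] at hsum
    exact mul_left_cancel₀ (by positivity) hsum

end Literals

section Pseudoexpectation

variable {V : Type} [Fintype V] [DecidableEq V] {n k : ℕ}

/-- The assignment of reals to the variables `x_i` obtained by substituting literals. -/
def litPoint (xlit : Fin n → Option V × Bool) (y : V → Bool) : Fin n → ℝ :=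
  fun i => if litVal (xlit i) y then 1 else 0

/-- Restriction of a polynomial to the cube after substituting literals. -/
noncomputable def substLits (xlit : Fin n → Option V × Bool) :
    MvPolynomial (Fin n) ℝ →ₗ[ℝ] (V → Bool) → ℝ :=
  LinearMap.pi fun y => (MvPolynomial.aeval (litPoint xlit y)).toLinearMap

lemma substLits_apply (xlit : Fin n → Option V × Bool) (p : MvPolynomial (Fin n) ℝ)
    (y : V → Bool) : substLits xlit p y = MvPolynomial.eval (litPoint xlit y) p := by
  simp [substLits, MvPolynomial.aeval_eq_eval]

lemma substLits_mem_span (xlit : Fin n → Option V × Bool) {p : MvPolynomial (Fin n) ℝ} {h : ℕ}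
    (hp : p.totalDegree ≤ h) :
    substLits xlit p ∈ Submodule.span ℝ (chi '' {T : Finset V | #T ≤ h}) := by
  classical
  rw [MvPolynomial.as_sum p, map_sum]
  refine Submodule.sum_mem _ fun m hm => ?_
  have hmdeg : #m.support ≤ h := by
    refine le_trans ?_ ((MvPolynomial.le_totalDegree hm).trans hp)
    rw [Finset.card_eq_sum_ones]
    refine Finset.sum_le_sum fun i hi => ?_
    exact Nat.one_le_iff_ne_zero.mpr (Finsupp.mem_support_iff.mp hi)
  let B : Finset V := {v | ∃ i ∈ m.support, (xlit i).1 = some v}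
  have hB : #B ≤ h := by
    have hsub : B.map Function.Embedding.some ⊆ m.support.image fun i => (xlit i).1 := by
      intro o ho
      obtain ⟨v, hv, rfl⟩ := Finset.mem_map.mp ho
      obtain ⟨i, hi, hiv⟩ := (Finset.mem_filter.mp hv).2
      exact Finset.mem_image.mpr ⟨i, hi, hiv⟩
    have := (Finset.card_le_card hsub).trans Finset.card_image_le
    rw [Finset.card_map] at this
    exact this.trans hmdeg
  have hdep : DependsOn (substLits xlit (MvPolynomial.monomial m (p.coeff m))) (B : Set V) := by
    intro x y hxy
    rw [substLits_apply, substLits_apply, MvPolynomial.eval_monomial, MvPolynomial.eval_monomial]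
    congr 1
    refine Finset.prod_congr rfl fun i hi => ?_
    have : litVal (xlit i) x = litVal (xlit i) y := by
      unfold litVal
      cases hl : (xlit i).1 with
      | none => rfl
      | some v =>
        have := hxy v (by
          simp only [B, Finset.coe_filter, Finset.mem_univ, true_and]
          exact ⟨i, hi, hl⟩)
        simp [this]
    simp [litPoint, this]
  rw [fourier_inversion (substLits xlit _)]
  refine Submodule.sum_mem _ fun S _ => ?_
  by_cases hS : S ⊆ B
  · exact Submodule.smul_mem _ _ (Submodule.subset_span
      ⟨S, (Finset.card_le_card hS).trans hB, rfl⟩)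
  · rw [avg_mul_chi_eq_zero hdep hS, zero_smul]
    exact Submodule.zero_mem _

lemma eval_ind01 (S : Fin k → Fin n) (a : Fin k → Bool) (x : Fin n → Bool) :
    MvPolynomial.eval (fun i => if x i then (1 : ℝ) else 0) (ind01 S a)
      = if (fun i => x (S i)) = a then 1 else 0 := by
  unfold ind01
  rw [map_prod]
  have h : ∀ i, MvPolynomial.eval (fun i => if x i then (1 : ℝ) else 0)
      (if a i then MvPolynomial.X (S i) else 1 - MvPolynomial.X (S i))
      = if x (S i) = a i then 1 else 0 := by
    intro i
    cases ha : a i <;> cases hx : x (S i) <;> simp [hx]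
  simp only [h]
  rw [Finset.prod_ite_zero, Finset.prod_const_one]
  congr 1
  simp [funext_iff]

lemma eval_consPoly01 (P : (Fin k → Bool) → Bool) (S : Fin k → Fin n) (z : Fin k → Bool)
    (x : Fin n → Bool) :
    MvPolynomial.eval (fun i => if x i then (1 : ℝ) else 0) (consPoly01 P S z)
      = if P (fun i => xor (x (S i)) (z i)) then 1 else 0 := by
  unfold consPoly01
  simp only [map_sum, eval_ind01]
  rw [Finset.sum_ite_eq]
  simp

/-- Substituting literals into a random-like instance gives a pseudoexpectation satisfying all
constraints, and any polynomial identity that holds identically after the substitution. -/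
lemma exists_pseudoexpectation {J : Type} [Fintype J] [DecidableEq J] {t s d : ℕ} (ht : 1 ≤ t)
    {P : (Fin k → Bool) → Bool} {ν : (Fin k → Bool) → ℝ}
    (hν0 : ∀ x, 0 ≤ ν x) (hν : kwiseUniform (t - 1) ν) (hsupp : ∀ a, ν a ≠ 0 → P a = true)
    (xlit : Fin n → Option V × Bool) (S : J → Fin k → Fin n) (z : J → Fin k → Bool)
    {ζ : ℝ} (hζ : 0 < ζ) (hE : IsExpanding (fun j i => (xlit (S j i)).1) t s ζ)
    (hd : 3 * (d : ℝ) ≤ ζ * s) (hs : 2 * (k : ℝ) + ζ ≤ ζ * s)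
    {Q : MvPolynomial (Fin n) ℝ} {b : ℝ}
    (hQ : ∀ y, MvPolynomial.eval (litPoint xlit y) Q = b) :
    ∃ E : PE01 n d, (∀ j, E.satEq (consPoly01 P (S j) (z j)) 1) ∧ E.satEq Q b := by
  let lits : J → Fin k → Option V × Bool :=
    fun j i => ((xlit (S j i)).1, xor (xlit (S j i)).2 (z j i))
  have hlits : ∀ j i y, litVal (lits j i) y = xor (litVal (xlit (S j i)) y) (z j i) := by
    intro j i y
    simp only [lits, litVal]
    cases (xlit (S j i)).1 <;> simp
  have hD := isLocalDensity_plantedDensity ht hν0 hν lits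
  set leg : J → Fin k → Option V := fun j i => (lits j i).1 with hleg
  have hE' : IsExpanding leg t s ζ := hE
  set L := pseudoAvg leg t s (plantedDensity ν lits) with hL
  have hL1 : L 1 = 1 := pseudoAvg_one hζ hE'
  have hconst : ∀ c : ℝ, L (fun _ => c) = c := by
    intro c
    have : (fun _ => c : (V → Bool) → ℝ) = c • 1 := by funext y; simp
    rw [this, map_smul, hL1, smul_eq_mul, mul_one]
  have hpoint : ∀ y, litPoint xlit y
      = fun i => if (fun i => litVal (xlit i) y) i then (1 : ℝ) else 0 := fun y => rfl
  let E : PE01 n d :=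
    { pE := L ∘ₗ substLits xlit
      normalized := by
        have : substLits xlit (1 : MvPolynomial (Fin n) ℝ) = 1 := by
          funext y; rw [substLits_apply]; simp
        rw [LinearMap.comp_apply, this, hL1]
      multilin := by
        intro p q hpq
        rw [LinearMap.comp_apply, LinearMap.comp_apply]
        congr 1
        funext y
        rw [substLits_apply, substLits_apply, hpoint]
        exact hpq _
      psd := by
        intro p hp
        have hsq : substLits xlit (p ^ 2) = substLits xlit p * substLits xlit p := by
          funext y
          simp only [substLits_apply, Pi.mul_apply, map_pow]
          ring
        rw [LinearMap.comp_apply, hsq]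
        refine hD.pseudoAvg_sq_nonneg hζ hE' (h := p.totalDegree) ?_
          (substLits_mem_span xlit (le_refl _))
        have : (2 : ℝ) * p.totalDegree ≤ d := by exact_mod_cast hp
        linarith }
  have hEapp : ∀ p, E.pE p = L (substLits xlit p) := fun p => rfl
  refine ⟨E, fun j => ?_, ?_⟩
  · have hval : ∀ y, substLits xlit (consPoly01 P (S j) (z j)) y
        = if P (fun i => litVal (lits j i) y) then 1 else 0 := by
      intro y
      rw [substLits_apply, hpoint, eval_consPoly01]
      simp only [hlits]
    have hone : L (substLits xlit (consPoly01 P (S j) (z j))) = 1 := by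
      have hzero : L (1 - substLits xlit (consPoly01 P (S j) (z j))) = 0 := by
        refine hD.pseudoAvg_eq_zero hζ hE' hs (j := j) ?_ ?_
        · intro x y hxy
          simp only [Pi.sub_apply, Pi.one_apply, hval]
          have : ∀ i, litVal (lits j i) x = litVal (lits j i) y := by
            intro i
            unfold litVal
            cases hl : (lits j i).1 with
            | none => rfl
            | some v =>
              have := hxy v (by
                rw [Finset.mem_coe, mem_scopeVars]
                exact ⟨j, Finset.mem_singleton_self j, i, hl⟩)
              simp [this]
          simp only [this]
        · funext y
          simp only [Pi.mul_apply, Pi.sub_apply, Pi.one_apply, Pi.zero_apply, hval]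
          split_ifs with hP
          · simp
          · have : ν (fun i => litVal (lits j i) y) = 0 := by
              by_contra hne
              exact hP (hsupp _ hne)
            simp [plantedDensity, this]
      rw [map_sub, hL1] at hzero
      linarith
    refine ⟨by rw [hEapp, hone], ?_⟩
    have hsq : substLits xlit (consPoly01 P (S j) (z j) ^ 2)
        = substLits xlit (consPoly01 P (S j) (z j)) := by
      funext y
      rw [substLits_apply, map_pow, ← substLits_apply, hval]
      split_ifs <;> norm_num
    rw [hEapp, hsq, hone]
    norm_num
  · constructor
    · rw [hEapp, show substLits xlit Q = fun _ => b from funext fun y => by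
        rw [substLits_apply, hQ], hconst]
    · rw [hEapp, show substLits xlit (Q ^ 2) = fun _ => b ^ 2 from funext fun y => by
        rw [substLits_apply, map_pow, hQ], hconst]

end Pseudoexpectation

section Balanced

/-- Literals pairing each of the first `min B (n - B)` variables with the negation of its mirror
image, the remaining variables being constant. -/
def balancedLits (n B : ℕ) (i : Fin n) : Option (Fin n) × Bool :=
  if (i : ℕ) < min B (n - B) then (some i, false)
  else if (i.rev : ℕ) < min B (n - B) then (some i.rev, true)
  else (none, decide (n ≤ 2 * B))

lemma litPoint_balancedLits_add_rev {n B : ℕ} (hB : B ≤ n) (y : Fin n → Bool) (i : Fin n) :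
    litPoint (balancedLits n B) y i + litPoint (balancedLits n B) y i.rev
      = 1 + if min B (n - B) ≤ (i : ℕ) ∧ (i : ℕ) < n - min B (n - B)
          then (if n ≤ 2 * B then (1 : ℝ) else -1) else 0 := by
  have hi := i.isLt
  have hr : (i.rev : ℕ) = n - (i + 1) := Fin.val_rev i
  have e1 : balancedLits n B i = if (i : ℕ) < min B (n - B) then (some i, false)
    else if (i.rev : ℕ) < min B (n - B) then (some i.rev, true)
    else (none, decide (n ≤ 2 * B)) := rfl
  have e2 : balancedLits n B i.rev = if (i.rev : ℕ) < min B (n - B) then (some i.rev, false)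
    else if (i : ℕ) < min B (n - B) then (some i, true)
    else (none, decide (n ≤ 2 * B)) := by rw [balancedLits, Fin.rev_rev]
  by_cases h1 : (i : ℕ) < min B (n - B)
  · have h2 : ¬ (i.rev : ℕ) < min B (n - B) := by omega
    have h3 : ¬ (min B (n - B) ≤ (i : ℕ) ∧ (i : ℕ) < n - min B (n - B)) := by omega
    rw [if_pos h1] at e1
    rw [if_neg h2, if_pos h1] at e2
    rw [if_neg h3]
    cases hy : y i <;> simp [litPoint, litVal, e1, e2, hy]
  · by_cases h2 : (i.rev : ℕ) < min B (n - B)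
    · have h3 : ¬ (min B (n - B) ≤ (i : ℕ) ∧ (i : ℕ) < n - min B (n - B)) := by omega
      rw [if_neg h1, if_pos h2] at e1
      rw [if_pos h2] at e2
      rw [if_neg h3]
      cases hy : y i.rev <;> simp [litPoint, litVal, e1, e2, hy]
    · have h3 : min B (n - B) ≤ (i : ℕ) ∧ (i : ℕ) < n - min B (n - B) := by omega
      rw [if_neg h1, if_neg h2] at e1
      rw [if_neg h2, if_neg h1] at e2
      rw [if_pos h3]
      by_cases h4 : n ≤ 2 * B <;> simp [litPoint, litVal, e1, e2, h4]

lemma card_middle {n m : ℕ} :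
    #(univ.filter fun i : Fin n => m ≤ (i : ℕ) ∧ (i : ℕ) < n - m) = n - m - m := by
  rw [← Nat.card_Ico m (n - m), ← Finset.card_map Fin.valEmbedding]
  congr 1
  ext a
  simp only [Finset.mem_map, Finset.mem_filter, Finset.mem_univ, true_and, Fin.valEmbedding_apply,
    Finset.mem_Ico]
  constructor
  · rintro ⟨i, hi, rfl⟩
    exact hi
  · intro h
    exact ⟨⟨a, by omega⟩, h, rfl⟩

/-- Under the balanced substitution every point of the cube has Hamming weight `B`. -/
lemma sum_litPoint_balancedLits {n B : ℕ} (hB : B ≤ n) (y : Fin n → Bool) :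
    ∑ i, litPoint (balancedLits n B) y i = B := by
  have hrev : ∑ i, litPoint (balancedLits n B) y (Fin.rev i)
      = ∑ i, litPoint (balancedLits n B) y i :=
    Equiv.sum_comp Fin.revPerm _
  have h2 : ∑ i, litPoint (balancedLits n B) y i + ∑ i, litPoint (balancedLits n B) y i
      = 2 * (B : ℝ) := by
    nth_rewrite 2 [← hrev]
    rw [← Finset.sum_add_distrib,
      Finset.sum_congr rfl fun i _ => litPoint_balancedLits_add_rev hB y i,
      Finset.sum_add_distrib, ← Finset.sum_filter, Finset.sum_const, Finset.sum_const, card_middle,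
      Finset.card_univ, Fintype.card_fin, nsmul_eq_mul, nsmul_eq_mul]
    split_ifs with h
    · have : min B (n - B) = n - B := by omega
      rw [this, show n - (n - B) - (n - B) = 2 * B - n by omega, Nat.cast_sub h]
      push_cast
      ring
    · have : min B (n - B) = B := by omega
      rw [this, show n - B - B = n - 2 * B by omega, Nat.cast_sub (by omega)]
      push_cast
      ring
  linarith

lemma card_balancedLits_eq_some {n B : ℕ} (v : Fin n) :
    #(univ.filter fun i : Fin n => (balancedLits n B i).1 = some v) ≤ 2 := by
  refine (Finset.card_le_card (t := {v, v.rev}) fun i hi => ?_).trans Finset.card_le_two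
  replace hi := (Finset.mem_filter.mp hi).2
  rw [balancedLits] at hi
  simp only [Finset.mem_insert, Finset.mem_singleton]
  split_ifs at hi with h1 h2
  · exact Or.inl (Option.some_injective _ hi)
  · exact Or.inr (by rw [← Option.some_injective _ hi, Fin.rev_rev])

lemma card_balancedLits_eq_none {n B : ℕ} (hB : B ≤ n) :
    (#(univ.filter fun i : Fin n => (balancedLits n B i).1 = none) : ℝ) ≤ |2 * (B : ℝ) - n| := by
  have h : #(univ.filter fun i : Fin n => (balancedLits n B i).1 = none)
      ≤ n - min B (n - B) - min B (n - B) := by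
    rw [← card_middle]
    refine Finset.card_le_card fun i hi => ?_
    replace hi := (Finset.mem_filter.mp hi).2
    rw [balancedLits] at hi
    simp only [Finset.mem_filter, Finset.mem_univ, true_and]
    have hr : (i.rev : ℕ) = n - (i + 1) := Fin.val_rev i
    have hi' := i.isLt
    split_ifs at hi with h1 h2
    omega
  refine (Nat.cast_le.mpr h).trans ?_
  rcases le_total n (2 * B) with h' | h'
  · rw [show n - min B (n - B) - min B (n - B) = 2 * B - n by omega, Nat.cast_sub h']
    push_cast
    exact le_abs_self _
  · rw [show n - min B (n - B) - min B (n - B) = n - 2 * B by omega, Nat.cast_sub h', abs_sub_comm]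
    push_cast
    exact le_abs_self _

end Balanced

section FirstMoment

variable {X J V : Type} [Fintype X] [Fintype J] [DecidableEq J] [DecidableEq V]

/-- Resampling one coordinate preserves averages over a product space. -/
lemma sum_sum_update (j : J) (g : (J → X) → ℝ) :
    ∑ ω : J → X, ∑ x, g (Function.update ω j x) = Fintype.card X * ∑ ω : J → X, g ω := by
  have hinv : Function.Involutive
      fun p : (J → X) × X => (Function.update p.1 j p.2, p.1 j) := by
    rintro ⟨ω, x⟩
    simp
  have h := Equiv.sum_comp hinv.toPerm (fun p : (J → X) × X => g p.1)
  rw [Fintype.sum_prod_type, Fintype.sum_prod_type] at h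
  simp only [Function.Involutive.coe_toPerm, Finset.sum_const, Finset.card_univ,
    nsmul_eq_mul, ← Finset.mul_sum] at h
  exact h

/-- A one-coordinate exponential moment bound tensorizes. -/
lemma sum_pow_weight_le (c : X → ℕ) (s : X → Finset V) {μ ρ : ℝ} {κ r : ℕ} (hμ : 0 ≤ μ)
    (hρ : 0 ≤ ρ) (hs : ∀ x, #(s x) ≤ κ)
    (hstep : ∀ R : Finset V, #R ≤ r →
      ∑ x, μ ^ (c x + 2 * #(s x ∪ R)) ≤ ρ * Fintype.card X * μ ^ (2 * #R))
    (F : Finset J) (R : Finset V) (hR : #R + κ * #F ≤ r) :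
    ∑ ω : J → X, μ ^ (∑ j ∈ F, c (ω j) + 2 * #((F.biUnion fun j => s (ω j)) ∪ R))
      ≤ ρ ^ #F * Fintype.card (J → X) * μ ^ (2 * #R) := by
  induction F using Finset.induction_on with
  | empty => simp
  | insert j F hj ih =>
    rw [Finset.card_insert_of_notMem hj] at hR ⊢
    rw [mul_add_one] at hR
    rcases isEmpty_or_nonempty X with hX | hX
    · have : IsEmpty (J → X) := ⟨fun ω => hX.elim (ω j)⟩
      simp
    have hpos : (0 : ℝ) < Fintype.card X := by exact_mod_cast Fintype.card_pos
    refine le_of_mul_le_mul_left ?_ hpos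
    rw [← sum_sum_update j]
    have hinner : ∀ ω : J → X, ∑ x, μ ^ (∑ i ∈ insert j F, c (Function.update ω j x i)
          + 2 * #(((insert j F).biUnion fun i => s (Function.update ω j x i)) ∪ R))
        ≤ (ρ * Fintype.card X) *
          μ ^ (∑ i ∈ F, c (ω i) + 2 * #((F.biUnion fun i => s (ω i)) ∪ R)) := by
      intro ω
      have hne : ∀ x, ∀ i ∈ F, Function.update ω j x i = ω i := fun x i hi =>
        Function.update_of_ne (fun h : i = j => hj (h ▸ hi)) _ _
      have hcard : #((F.biUnion fun i => s (ω i)) ∪ R) ≤ r := by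
        have h1 := Finset.card_union_le (F.biUnion fun i => s (ω i)) R
        have h2 := Finset.card_biUnion_le_card_mul F (fun i => s (ω i)) κ fun i _ => hs _
        rw [mul_comm] at h2
        omega
      calc _ = ∑ x, μ ^ (∑ i ∈ F, c (ω i)) *
            μ ^ (c x + 2 * #(s x ∪ ((F.biUnion fun i => s (ω i)) ∪ R))) := by
            refine Finset.sum_congr rfl fun x _ => ?_
            rw [Finset.sum_insert hj, Finset.biUnion_insert, Function.update_self,
              Finset.sum_congr rfl fun i hi => congrArg c (hne x i hi),
              Finset.biUnion_congr rfl fun i hi => congrArg s (hne x i hi),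
              Finset.union_assoc, ← pow_add]
            congr 1
            ring
        _ ≤ μ ^ (∑ i ∈ F, c (ω i)) *
            (ρ * Fintype.card X * μ ^ (2 * #((F.biUnion fun i => s (ω i)) ∪ R))) := by
            rw [← Finset.mul_sum]
            exact mul_le_mul_of_nonneg_left (hstep _ hcard) (by positivity)
        _ = _ := by
            rw [pow_add]
            ring
    refine (Finset.sum_le_sum fun ω _ => hinner ω).trans ?_
    rw [← Finset.mul_sum]
    refine (mul_le_mul_of_nonneg_left (ih (by omega)) (by positivity)).trans (le_of_eq ?_)
    ring

/-- The exponential moment bound for a single position of a constraint. -/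
lemma sum_pow_leg_le {n : ℕ} (π : Fin n → Option V)
    (hsome : ∀ v, #(univ.filter fun i => π i = some v) ≤ 2) {μ : ℝ} (hμ : 0 ≤ μ)
    (hnone : (#(univ.filter fun i => π i = none) : ℝ) ≤ n * μ)
    {r : ℕ} (hr : 2 * (r : ℝ) ≤ n * μ ^ 2) (R : Finset V) (hR : #R ≤ r) :
    ∑ x, μ ^ ((if π x = none then 1 else 0) + 2 * #((π x).toFinset ∪ R))
      ≤ 3 * μ ^ 2 * Fintype.card (Fin n) * μ ^ (2 * #R) := by
  classical
  have hterm : ∀ x, μ ^ ((if π x = none then 1 else 0) + 2 * #((π x).toFinset ∪ R))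
      ≤ ((if π x = none then μ else 0) + (if ∃ v ∈ R, π x = some v then 1 else 0) + μ ^ 2)
        * μ ^ (2 * #R) := by
    intro x
    have hm : 0 ≤ μ ^ (2 * #R) := by positivity
    have hm2 : 0 ≤ μ ^ 2 := by positivity
    rcases hx : π x with _ | v
    · simp only [if_true, Option.toFinset_none, Finset.empty_union, reduceCtorEq, and_false,
        exists_false, if_false, pow_add, pow_one]
      nlinarith
    · by_cases hv : v ∈ R
      · have hu : (some v).toFinset ∪ R = R := by simpa using hv
        have he : ∃ w ∈ R, some v = some w := ⟨v, hv, rfl⟩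
        rw [hu, if_pos he]
        simp only [reduceCtorEq, if_false, zero_add]
        nlinarith
      · have hu : #((some v).toFinset ∪ R) = #R + 1 := by
          rw [Option.toFinset_some, Finset.singleton_union, Finset.card_insert_of_notMem hv]
        have he : ¬ ∃ w ∈ R, some v = some w := by
          rintro ⟨w, hw, h⟩
          exact hv (Option.some_injective _ h ▸ hw)
        rw [hu, if_neg he]
        simp only [reduceCtorEq, if_false, zero_add, mul_add, mul_one, pow_add]
        exact (mul_comm _ _).le
  have hrep : (#(univ.filter fun x => ∃ v ∈ R, π x = some v) : ℝ) ≤ 2 * r := by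
    have h1 : (univ.filter fun x => ∃ v ∈ R, π x = some v)
        ⊆ R.biUnion fun v => univ.filter fun x => π x = some v := by
      intro x hx
      obtain ⟨v, hv, h⟩ := (Finset.mem_filter.mp hx).2
      exact Finset.mem_biUnion.mpr ⟨v, hv, Finset.mem_filter.mpr ⟨Finset.mem_univ _, h⟩⟩
    have h2 := (Finset.card_le_card h1).trans
      (Finset.card_biUnion_le_card_mul R _ 2 fun v _ => hsome v)
    have h3 : #(univ.filter fun x => ∃ v ∈ R, π x = some v) ≤ 2 * r := by omega
    exact_mod_cast h3
  refine (Finset.sum_le_sum fun x _ => hterm x).trans ?_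
  rw [← Finset.sum_mul]
  refine mul_le_mul_of_nonneg_right ?_ (by positivity)
  rw [Finset.sum_add_distrib, Finset.sum_add_distrib, ← Finset.sum_filter, ← Finset.sum_filter,
    Finset.sum_const, Finset.sum_const, Finset.sum_const, Finset.card_univ, Fintype.card_fin,
    nsmul_eq_mul, nsmul_eq_mul, nsmul_eq_mul, mul_one]
  have := mul_le_mul_of_nonneg_right hnone hμ
  nlinarith

end FirstMoment

section RandomConstraints

variable {V J : Type} [Fintype V] [DecidableEq V] [Fintype J] [DecidableEq J] {n k : ℕ}

lemma pow_le_two_pow_mul_card_embedding (hn : 2 * k ≤ n) :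
    n ^ k ≤ 2 ^ k * Fintype.card (Fin k ↪ Fin n) := by
  rw [Fintype.card_embedding_eq, Fintype.card_fin, Fintype.card_fin]
  calc n ^ k ≤ (2 * (n + 1 - k)) ^ k := Nat.pow_le_pow_left (by omega) k
    _ = 2 ^ k * (n + 1 - k) ^ k := mul_pow _ _ _
    _ ≤ 2 ^ k * n.descFactorial k := Nat.mul_le_mul_left _ (Nat.pow_sub_le_descFactorial n k)

/-- The exponential moment bound for a random constraint. -/
lemma sum_pow_constraint_le (π : Fin n → Option V) (hn : 2 * k ≤ n)
    (hsome : ∀ v, #(univ.filter fun i => π i = some v) ≤ 2) {μ : ℝ} (hμ : 0 ≤ μ)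
    (hnone : (#(univ.filter fun i => π i = none) : ℝ) ≤ n * μ)
    {r : ℕ} (hr : 2 * ((r + k : ℕ) : ℝ) ≤ n * μ ^ 2) (R : Finset V) (hR : #R ≤ r) :
    ∑ x : (Fin k ↪ Fin n) × (Fin k → Bool),
        μ ^ (∑ i, (if π (x.1 i) = none then 1 else 0)
          + 2 * #((univ.biUnion fun i => (π (x.1 i)).toFinset) ∪ R))
      ≤ (6 * μ ^ 2) ^ k * Fintype.card ((Fin k ↪ Fin n) × (Fin k → Bool)) * μ ^ (2 * #R) := by
  set w : (Fin k → Fin n) → ℝ := fun f => μ ^ (∑ i, (if π (f i) = none then 1 else 0)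
    + 2 * #((univ.biUnion fun i => (π (f i)).toFinset) ∪ R)) with hw
  have hfun : ∑ f, w f ≤ (3 * μ ^ 2) ^ k * (n : ℝ) ^ k * μ ^ (2 * #R) := by
    have h := sum_pow_weight_le (J := Fin k) (fun x => if π x = none then 1 else 0)
      (fun x => (π x).toFinset) (κ := 1) hμ (by positivity : (0 : ℝ) ≤ 3 * μ ^ 2)
      (fun x => by rcases π x with _ | v <;> simp) (sum_pow_leg_le π hsome hμ hnone hr)
      univ R (by simpa using hR)
    simpa [hw] using h
  have hemb : ∑ e : Fin k ↪ Fin n, w e ≤ ∑ f, w f := by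
    refine (Finset.sum_map univ ⟨fun e : Fin k ↪ Fin n => (e : Fin k → Fin n),
      DFunLike.coe_injective⟩ w).symm.trans_le ?_
    exact Finset.sum_le_sum_of_subset_of_nonneg (Finset.subset_univ _) fun f _ _ => by
      simp only [hw]; positivity
  have hcard : (n : ℝ) ^ k ≤ 2 ^ k * Fintype.card (Fin k ↪ Fin n) := by
    exact_mod_cast pow_le_two_pow_mul_card_embedding hn
  rw [Fintype.sum_prod_type]
  change ∑ e : Fin k ↪ Fin n, ∑ _z : Fin k → Bool, w e ≤ _
  simp only [Finset.sum_const, nsmul_eq_mul, Finset.card_univ]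
  rw [← Finset.mul_sum, Fintype.card_prod]
  calc _ ≤ (Fintype.card (Fin k → Bool) : ℝ) * ((3 * μ ^ 2) ^ k *
          (2 ^ k * Fintype.card (Fin k ↪ Fin n)) * μ ^ (2 * #R)) := by
        refine mul_le_mul_of_nonneg_left ((hemb.trans hfun).trans ?_) (by positivity)
        gcongr
    _ = _ := by
        rw [show (6 : ℝ) * μ ^ 2 = 3 * μ ^ 2 * 2 by ring, mul_pow (3 * μ ^ 2)]
        push_cast
        ring

/-- The positions of the constraints of an instance, after the variables have been substituted. -/
abbrev instanceLegs (π : Fin n → Option V) (ω : J → (Fin k ↪ Fin n) × (Fin k → Bool)) :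
    J → Fin k → Option V :=
  fun j i => π ((ω j).1 i)

lemma scopeVars_instanceLegs (π : Fin n → Option V)
    (ω : J → (Fin k ↪ Fin n) × (Fin k → Bool)) (F : Finset J) :
    scopeVars (instanceLegs π ω) F
      = F.biUnion fun j => univ.biUnion fun i => (π ((ω j).1 i)).toFinset := by
  ext v
  simp [mem_scopeVars]

lemma card_constLegs_instanceLegs (π : Fin n → Option V)
    (ω : J → (Fin k ↪ Fin n) × (Fin k → Bool)) (F : Finset J) :
    #(constLegs (instanceLegs π ω) F)
      = ∑ j ∈ F, ∑ i, (if π ((ω j).1 i) = none then 1 else 0) := by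
  rw [constLegs, Finset.card_filter, Finset.sum_product]

open Classical in
/-- Few instances have a given set of constraints of small potential. -/
lemma card_small_potential_le (π : Fin n → Option V) (hn : 2 * k ≤ n)
    (hsome : ∀ v, #(univ.filter fun i => π i = some v) ≤ 2) {μ : ℝ} (hμ : 0 < μ) (hμ1 : μ ≤ 1)
    (hnone : (#(univ.filter fun i => π i = none) : ℝ) ≤ n * μ) (t : ℕ) (ζ : ℝ) (F : Finset J)
    (hF : 2 * ((k * #F + k : ℕ) : ℝ) ≤ n * μ ^ 2) :
    (#(univ.filter fun ω : J → (Fin k ↪ Fin n) × (Fin k → Bool) =>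
        (potential (instanceLegs π ω) t ∅ F : ℝ) < ζ * #F) : ℝ)
      ≤ (6 ^ k * μ ^ ((t : ℝ) - ζ)) ^ #F
        * Fintype.card (J → (Fin k ↪ Fin n) × (Fin k → Bool)) := by
  have hmoment := sum_pow_weight_le (J := J) (X := (Fin k ↪ Fin n) × (Fin k → Bool))
    (fun x => ∑ i, (if π (x.1 i) = none then 1 else 0))
    (fun x => univ.biUnion fun i => (π (x.1 i)).toFinset) (κ := k) hμ.le
    (by positivity : (0 : ℝ) ≤ (6 * μ ^ 2) ^ k)
    (fun x => by
      refine (Finset.card_biUnion_le_card_mul univ _ 1 fun i _ => ?_).trans (by simp)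
      rcases π (x.1 i) with _ | v <;> simp)
    (sum_pow_constraint_le π hn hsome hμ.le hnone hF) F ∅ (by simp)
  simp only [Finset.union_empty, Finset.card_empty, mul_zero, pow_zero, mul_one] at hmoment
  simp only [← scopeVars_instanceLegs, ← card_constLegs_instanceLegs] at hmoment
  set bad := univ.filter fun ω : J → (Fin k ↪ Fin n) × (Fin k → Bool) =>
        (potential (instanceLegs π ω) t ∅ F : ℝ) < ζ * #F with hbad
  set θ : ℝ := (2 * k - t + ζ) * #F with hθ
  have hlow : (#bad : ℝ) * μ ^ θ ≤ ((6 * μ ^ 2) ^ k) ^ #F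
      * Fintype.card (J → (Fin k ↪ Fin n) × (Fin k → Bool)) := by
    refine le_trans ?_ hmoment
    rw [← nsmul_eq_mul, ← Finset.sum_const]
    refine (Finset.sum_le_sum fun ω hω => ?_).trans
      (Finset.sum_le_sum_of_subset_of_nonneg (Finset.subset_univ bad) fun ω _ _ => by positivity)
    have h := (Finset.mem_filter.mp hω).2
    rw [potential, Finset.sdiff_empty] at h
    rw [← Real.rpow_natCast]
    refine Real.rpow_le_rpow_of_exponent_ge hμ hμ1 ?_
    push_cast at h ⊢
    rw [hθ]
    linarith
  have hfac : ((6 * μ ^ 2) ^ k) ^ #F = (6 ^ k * μ ^ ((t : ℝ) - ζ)) ^ #F * μ ^ θ := by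
    have h1 : μ ^ θ = (μ ^ (2 * k - t + ζ : ℝ)) ^ #F := by
      rw [hθ, Real.rpow_mul_natCast hμ.le]
    have h2 : ((μ ^ 2) ^ k : ℝ) = μ ^ ((t : ℝ) - ζ) * μ ^ (2 * k - t + ζ : ℝ) := by
      rw [← Real.rpow_add hμ, ← pow_mul, ← Real.rpow_natCast]
      congr 1
      push_cast
      ring
    rw [h1, ← mul_pow, mul_pow 6, h2, mul_assoc]
  rw [hfac] at hlow
  have hpos : 0 < μ ^ θ := Real.rpow_pos_of_pos hμ _
  refine le_of_mul_le_mul_right (hlow.trans (le_of_eq ?_)) hpos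
  ring

end RandomConstraints

section UnionBound

open Classical in
/-- Union bound over the sets of at most `s` constraints. -/
lemma card_not_isExpanding_le {V J : Type} [Fintype V] [DecidableEq V] [Fintype J] [DecidableEq J]
    {n k : ℕ} (π : Fin n → Option V) (t s : ℕ) (ζ : ℝ) (τ : ℕ → ℝ)
    (hτ : ∀ F : Finset J, #F ≤ s →
      (#(univ.filter fun ω : J → (Fin k ↪ Fin n) × (Fin k → Bool) =>
        (potential (instanceLegs π ω) t ∅ F : ℝ) < ζ * #F) : ℝ) ≤ τ #F) :
    (#(univ.filter fun ω : J → (Fin k ↪ Fin n) × (Fin k → Bool) =>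
        ¬ IsExpanding (instanceLegs π ω) t s ζ) : ℝ)
      ≤ ∑ σ ∈ range (s + 1), (Fintype.card J).choose σ * τ σ := by
  set bad : Finset J → Finset (J → (Fin k ↪ Fin n) × (Fin k → Bool)) := fun F =>
    univ.filter fun ω => (potential (instanceLegs π ω) t ∅ F : ℝ) < ζ * #F with hbad
  have hsub : (univ.filter fun ω : J → (Fin k ↪ Fin n) × (Fin k → Bool) =>
      ¬ IsExpanding (instanceLegs π ω) t s ζ)
      ⊆ (univ.filter fun F : Finset J => #F ≤ s).biUnion bad := by
    intro ω hω
    have h := (Finset.mem_filter.mp hω).2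
    rw [IsExpanding] at h
    push Not at h
    obtain ⟨F, hF, hlt⟩ := h
    exact Finset.mem_biUnion.mpr ⟨F, Finset.mem_filter.mpr ⟨Finset.mem_univ _, hF⟩,
      Finset.mem_filter.mpr ⟨Finset.mem_univ _, hlt⟩⟩
  have hcard : (#(univ.filter fun ω : J → (Fin k ↪ Fin n) × (Fin k → Bool) =>
      ¬ IsExpanding (instanceLegs π ω) t s ζ) : ℝ)
      ≤ ∑ F ∈ univ.filter (fun F : Finset J => #F ≤ s), (#(bad F) : ℝ) := by
    exact_mod_cast (Finset.card_le_card hsub).trans Finset.card_biUnion_le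
  refine hcard.trans ?_
  rw [← Finset.sum_fiberwise_of_maps_to (s := univ.filter fun F : Finset J => #F ≤ s)
    (t := range (s + 1)) (g := fun F => #F) fun F hF =>
      Finset.mem_range_succ_iff.mpr (Finset.mem_filter.mp hF).2]
  refine Finset.sum_le_sum fun σ hσ => ?_
  have hset : ((univ.filter fun F : Finset J => #F ≤ s).filter fun F => #F = σ)
      = powersetCard σ univ := by
    ext F
    have := Finset.mem_range_succ_iff.mp hσ
    simp only [Finset.mem_filter, Finset.mem_univ, true_and, Finset.mem_powersetCard,
      Finset.subset_univ]
    omega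
  rw [hset, ← Finset.card_univ, ← Finset.card_powersetCard, ← nsmul_eq_mul, ← Finset.sum_const]
  refine Finset.sum_le_sum fun F hF => ?_
  have hFσ := (Finset.mem_powersetCard.mp hF).2
  rw [← hFσ]
  exact hτ F (hFσ ▸ Finset.mem_range_succ_iff.mp hσ)

end UnionBound

section Estimates

lemma choose_mul_pow_le {m σ : ℕ} (hσ : 0 < σ) {a : ℝ} (ha : 0 ≤ a) :
    (m.choose σ : ℝ) * a ^ σ ≤ (Real.exp 1 * (m / σ) * a) ^ σ := by
  have hσ' : (0 : ℝ) < σ := by exact_mod_cast hσ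
  have h1 : (m.choose σ : ℝ) ≤ (Real.exp 1 * (m / σ)) ^ σ := by
    have h2 := Real.pow_div_factorial_le_exp (σ : ℝ) hσ'.le σ
    calc (m.choose σ : ℝ) ≤ (m : ℝ) ^ σ / (σ.factorial : ℝ) := Nat.choose_le_pow_div σ m
      _ = ((m : ℝ) / σ) ^ σ * ((σ : ℝ) ^ σ / σ.factorial) := by
          rw [div_pow]
          field_simp
      _ ≤ ((m : ℝ) / σ) ^ σ * Real.exp σ := by gcongr
      _ = _ := by
          rw [mul_pow, ← Real.exp_nat_mul, mul_one, mul_comm]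
  rw [mul_pow _ a]
  gcongr

/-- The contribution of the sets of `σ` constraints to the union bound. -/
lemma choose_mul_moment_le {k t n Δ σ : ℕ} {K ζ : ℝ} (hK : 0 < K) (hn : 0 < n) (hσ : 0 < σ) :
    ((Δ * n).choose σ : ℝ) * (6 ^ k * √(K * σ / n) ^ ((t : ℝ) - ζ)) ^ σ
      ≤ (Real.exp 1 * 6 ^ k * K * Δ * (K * σ / n) ^ (((t : ℝ) - ζ) / 2 - 1)) ^ σ := by
  have hn' : (0 : ℝ) < n := by exact_mod_cast hn
  have hσ' : (0 : ℝ) < σ := by exact_mod_cast hσ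
  have hy : 0 < K * σ / n := by positivity
  refine (choose_mul_pow_le hσ (by positivity)).trans (le_of_eq ?_)
  congr 1
  have h1 : √(K * σ / n) ^ ((t : ℝ) - ζ) = (K * σ / n) ^ (((t : ℝ) - ζ) / 2) := by
    rw [Real.sqrt_eq_rpow, ← Real.rpow_mul hy.le]
    congr 1
    ring
  rw [h1, Real.rpow_sub_one hy.ne']
  push_cast
  field_simp

/-- The base of the union bound is at most `1 / 2` for sets of size up to `n / Δ ^ (2 / (t - 2))`
times a small constant. -/
lemma base_le_half {t : ℕ} (ht : 3 ≤ t) {A Δ ζ y : ℝ} (hA : 1 ≤ A) (hΔ : 1 ≤ Δ) (hζ0 : 0 ≤ ζ)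
    (hζ : ζ ≤ 1 / 2) (hζΔ : ζ * Real.log Δ ≤ 1 / 2) (hy : 0 < y)
    (hyY : y ≤ (1 / (4 * A)) ^ 4 / Δ ^ ((2 : ℝ) / ((t : ℝ) - 2))) :
    A * Δ * y ^ (((t : ℝ) - ζ) / 2 - 1) ≤ 1 / 2 := by
  have ht' : (3 : ℝ) ≤ t := by exact_mod_cast ht
  have hΔ0 : 0 < Δ := by linarith
  have hA0 : 0 < A := by linarith
  set α : ℝ := ((t : ℝ) - ζ) / 2 - 1 with hα
  have hα4 : 1 / 4 ≤ α := by rw [hα]; linarith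
  set Y : ℝ := (1 / (4 * A)) ^ 4 with hY
  have hY0 : 0 < Y := by positivity
  have hbase : 1 / (4 * A) ≤ 1 := by
    rw [div_le_one (by positivity)]
    linarith
  have hY1 : Y ≤ 1 := pow_le_one₀ (by positivity) hbase
  have h1 : Y ^ α ≤ 1 / (4 * A) := by
    refine (Real.rpow_le_rpow_of_exponent_ge hY0 hY1 hα4).trans (le_of_eq ?_)
    rw [hY, ← Real.rpow_natCast, ← Real.rpow_mul (by positivity)]
    norm_num
  have h2 : y ^ α ≤ Y ^ α / (Δ ^ ((2 : ℝ) / ((t : ℝ) - 2))) ^ α := by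
    rw [← Real.div_rpow hY0.le (by positivity)]
    exact Real.rpow_le_rpow hy.le hyY (by linarith)
  have h3 : Δ / (Δ ^ ((2 : ℝ) / ((t : ℝ) - 2))) ^ α ≤ 2 := by
    have ht2 : (t : ℝ) - 2 ≠ 0 := by linarith
    have h4 : Δ / (Δ ^ ((2 : ℝ) / ((t : ℝ) - 2))) ^ α = Δ ^ (ζ / ((t : ℝ) - 2)) := by
      rw [← Real.rpow_mul hΔ0.le]
      nth_rewrite 1 [← Real.rpow_one Δ]
      rw [← Real.rpow_sub hΔ0]
      congr 1
      rw [hα]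
      field_simp
      ring
    rw [h4, Real.rpow_def_of_pos hΔ0]
    have h5 : Real.log Δ * (ζ / ((t : ℝ) - 2)) ≤ 1 / 2 := by
      have : ζ / ((t : ℝ) - 2) ≤ ζ := div_le_self hζ0 (by linarith)
      nlinarith [Real.log_nonneg hΔ]
    refine (Real.exp_le_exp.mpr h5).trans ?_
    have h6 : Real.exp (1 / 2) * Real.exp (1 / 2) = Real.exp 1 := by
      rw [← Real.exp_add]
      norm_num
    nlinarith [Real.exp_one_lt_three, Real.exp_pos (1 / 2)]
  calc A * Δ * y ^ α ≤ A * Δ * (Y ^ α / (Δ ^ ((2 : ℝ) / ((t : ℝ) - 2))) ^ α) := by gcongr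
    _ = A * Y ^ α * (Δ / (Δ ^ ((2 : ℝ) / ((t : ℝ) - 2))) ^ α) := by ring
    _ ≤ A * (1 / (4 * A)) * 2 := by gcongr
    _ = 1 / 2 := by
        field_simp
        norm_num

lemma sum_range_mul_half_pow_le (N : ℕ) : ∑ σ ∈ range N, (σ : ℝ) * (1 / 2) ^ σ ≤ 2 := by
  have h : ∑ σ ∈ range N, (σ : ℝ) * (1 / 2) ^ σ = 2 - (N + 1) * 2 * (1 / 2) ^ N := by
    induction N with
    | zero => simp
    | succ N ih =>
      rw [Finset.sum_range_succ, ih]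
      push_cast
      ring
  rw [h]
  have : (0 : ℝ) ≤ (N + 1) * 2 * (1 / 2) ^ N := by positivity
  linarith

lemma pow_le_mul_half_pow {G K n α : ℝ} {σ : ℕ} (hG : 0 ≤ G) (hK : 0 < K) (hn : 0 < n)
    (hσ : 0 < σ) (hα : 1 / 4 ≤ α) (hy1 : K * σ / n ≤ 1)
    (hhalf : G * (K * σ / n) ^ α ≤ 1 / 2) :
    (G * (K * σ / n) ^ α) ^ σ ≤ σ * (1 / 2) ^ σ * (2 * G * (K / n) ^ (1 / 4 : ℝ)) := by
  have hσ' : (1 : ℝ) ≤ σ := by exact_mod_cast hσ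
  have hy : 0 < K * σ / n := by positivity
  have hb : G * (K * σ / n) ^ α ≤ G * (K / n) ^ (1 / 4 : ℝ) * σ := by
    rw [mul_assoc]
    refine mul_le_mul_of_nonneg_left ?_ hG
    refine (Real.rpow_le_rpow_of_exponent_ge hy hy1 hα).trans ?_
    rw [mul_div_right_comm, Real.mul_rpow (by positivity) (by positivity)]
    refine mul_le_mul_of_nonneg_left ?_ (by positivity)
    calc (σ : ℝ) ^ (1 / 4 : ℝ) ≤ (σ : ℝ) ^ (1 : ℝ) :=
          Real.rpow_le_rpow_of_exponent_le hσ' (by norm_num)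
      _ = σ := Real.rpow_one _
  obtain ⟨τ, rfl⟩ : ∃ τ, σ = τ + 1 := ⟨σ - 1, by omega⟩
  have hb0 : 0 ≤ G * (K * (τ + 1 : ℕ) / n) ^ α := by positivity
  calc (G * (K * (τ + 1 : ℕ) / n) ^ α) ^ (τ + 1)
      = (G * (K * (τ + 1 : ℕ) / n) ^ α) ^ τ * (G * (K * (τ + 1 : ℕ) / n) ^ α) := pow_succ _ _
    _ ≤ (1 / 2) ^ τ * (G * (K / n) ^ (1 / 4 : ℝ) * (τ + 1 : ℕ)) := by gcongr
    _ = _ := by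
        rw [pow_succ (1 / 2 : ℝ)]
        ring

end Estimates

section Expansion

open Classical in
/-- All but a small fraction of the instances are expanding. -/
lemma card_not_isExpanding_le_of_large {V : Type} [Fintype V] [DecidableEq V] {n k t s Δ : ℕ}
    (ht : 3 ≤ t) (π : Fin n → Option V) (hn : 2 * k ≤ n) (hn0 : 0 < n) (hΔ : 1 ≤ Δ)
    (hsome : ∀ v, #(univ.filter fun i => π i = some v) ≤ 2)
    (hnone : (#(univ.filter fun i => π i = none) : ℝ) ≤ 2 * √n) {ζ A : ℝ} (hζ0 : 0 ≤ ζ)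
    (hζ : ζ ≤ 1 / 2) (hζΔ : ζ * Real.log Δ ≤ 1 / 2) (hA : A = Real.exp 1 * 6 ^ k * (4 * k + 4))
    (hs : (4 * k + 4) * (s : ℝ) / n ≤ (1 / (4 * A)) ^ 4 / (Δ : ℝ) ^ ((2 : ℝ) / ((t : ℝ) - 2))) :
    (#(univ.filter fun ω : Fin (Δ * n) → (Fin k ↪ Fin n) × (Fin k → Bool) =>
        ¬ IsExpanding (instanceLegs π ω) t s ζ) : ℝ)
      ≤ 4 * (A * Δ) * ((4 * k + 4) / n : ℝ) ^ (1 / 4 : ℝ)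
        * Fintype.card (Fin (Δ * n) → (Fin k ↪ Fin n) × (Fin k → Bool)) := by
  set K : ℝ := 4 * k + 4 with hK
  set Ω : ℝ := (Fintype.card (Fin (Δ * n) → (Fin k ↪ Fin n) × (Fin k → Bool)) : ℝ) with hΩ
  have hk0 : (0 : ℝ) ≤ k := Nat.cast_nonneg k
  have hK0 : 0 < K := by positivity
  have hn' : (0 : ℝ) < n := by exact_mod_cast hn0
  have hΔ' : (1 : ℝ) ≤ Δ := by exact_mod_cast hΔ
  have ht' : (3 : ℝ) ≤ t := by exact_mod_cast ht
  have hA1 : 1 ≤ A := by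
    have h1 : 1 ≤ Real.exp 1 := Real.one_le_exp zero_le_one
    have h2 : (1 : ℝ) ≤ 6 ^ k := one_le_pow₀ (by norm_num)
    have h3 : 1 ≤ K := by linarith
    rw [hA]
    exact one_le_mul_of_one_le_of_one_le (one_le_mul_of_one_le_of_one_le h1 h2) h3
  have hA0 : 0 < A := by linarith
  have hY1 : (1 / (4 * A)) ^ 4 / (Δ : ℝ) ^ ((2 : ℝ) / ((t : ℝ) - 2)) ≤ 1 := by
    have h1 : (1 / (4 * A)) ^ 4 ≤ 1 := by
      refine pow_le_one₀ (by positivity) ?_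
      rw [div_le_one (by positivity)]
      linarith
    have h2 : 1 ≤ (Δ : ℝ) ^ ((2 : ℝ) / ((t : ℝ) - 2)) :=
      Real.one_le_rpow hΔ' (div_nonneg (by norm_num) (by linarith))
    exact (div_le_self (by positivity) h2).trans h1
  set τ : ℕ → ℝ := fun σ =>
    if σ = 0 then 0 else (6 ^ k * √(K * σ / n) ^ ((t : ℝ) - ζ)) ^ σ * Ω with hτ
  have hy : ∀ σ : ℕ, σ ≤ s → K * σ / n ≤ K * s / n := by
    intro σ hσ
    have : (σ : ℝ) ≤ s := by exact_mod_cast hσ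
    gcongr
  have hfix : ∀ F : Finset (Fin (Δ * n)), #F ≤ s →
      (#(univ.filter fun ω : Fin (Δ * n) → (Fin k ↪ Fin n) × (Fin k → Bool) =>
        (potential (instanceLegs π ω) t ∅ F : ℝ) < ζ * #F) : ℝ) ≤ τ #F := by
    intro F hF
    rcases Finset.eq_empty_or_nonempty F with rfl | hne
    · simp [hτ, potential, scopeVars, constLegs]
    · have hpos : 0 < #F := hne.card_pos
      have hpos' : (1 : ℝ) ≤ #F := by exact_mod_cast hpos
      have hy0 : 0 < K * #F / n := by positivity
      simp only [hτ, if_neg hpos.ne']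
      refine card_small_potential_le π hn hsome (Real.sqrt_pos.mpr hy0) ?_ (hnone.trans ?_) t ζ F ?_
      · exact Real.sqrt_le_one.mpr ((hy _ hF).trans (hs.trans hY1))
      · have h1 : (n : ℝ) * √(K * #F / n) = √(K * #F) * √n := by
          rw [Real.sqrt_div' _ hn'.le, mul_div_assoc', div_eq_iff (Real.sqrt_pos.mpr hn').ne',
            mul_assoc, Real.mul_self_sqrt hn'.le, mul_comm]
        rw [h1]
        refine mul_le_mul_of_nonneg_right ?_ (Real.sqrt_nonneg _)
        refine Real.le_sqrt_of_sq_le ?_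
        nlinarith
      · rw [Real.sq_sqrt hy0.le, mul_div_cancel₀ _ hn'.ne']
        push_cast
        nlinarith
  refine (card_not_isExpanding_le π t s ζ τ hfix).trans ?_
  rw [Fintype.card_fin]
  have hterm : ∀ σ ∈ range (s + 1), ((Δ * n).choose σ : ℝ) * τ σ
      ≤ σ * (1 / 2) ^ σ * (2 * (A * Δ) * (K / n) ^ (1 / 4 : ℝ) * Ω) := by
    intro σ hσ
    rcases Nat.eq_zero_or_pos σ with rfl | hpos
    · simp [hτ]
    · have hle := hy σ (Finset.mem_range_succ_iff.mp hσ)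
      have hpos' : (0 : ℝ) < σ := by exact_mod_cast hpos
      have h1 := choose_mul_moment_le (k := k) (t := t) (Δ := Δ) (ζ := ζ) hK0 hn0 hpos
      have h2 := pow_le_mul_half_pow (G := A * Δ) (α := ((t : ℝ) - ζ) / 2 - 1) (by positivity) hK0
        hn' hpos (by linarith) (hle.trans (hs.trans hY1))
        (base_le_half ht hA1 hΔ' hζ0 hζ hζΔ (by positivity) (hle.trans hs))
      rw [← hA] at h1
      have h3 := mul_le_mul_of_nonneg_right (h1.trans h2) (Nat.cast_nonneg _ : 0 ≤ Ω)
      simp only [hτ, if_neg hpos.ne']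
      linarith
  refine (Finset.sum_le_sum hterm).trans ?_
  rw [← Finset.sum_mul]
  have h4 := sum_range_mul_half_pow_le (s + 1)
  have h5 : 0 ≤ 2 * (A * Δ) * (K / n) ^ (1 / 4 : ℝ) * Ω := by positivity
  nlinarith

lemma one_sub_le_uprob {Ω : Type} [Fintype Ω] [Nonempty Ω] {p q : Ω → Prop} [DecidablePred q]
    {δ : ℝ} (h : (#(univ.filter fun ω => ¬ q ω) : ℝ) ≤ δ * Fintype.card Ω)
    (hqp : ∀ ω, q ω → p ω) : 1 - δ ≤ uprob p := by
  classical
  have hpos : (0 : ℝ) < Fintype.card Ω := by exact_mod_cast Fintype.card_pos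
  rw [uprob, le_div_iff₀ hpos]
  have h1 : #(univ.filter q) + #(univ.filter fun ω => ¬ q ω) = Fintype.card Ω := by
    rw [Finset.card_filter_add_card_filter_not, Finset.card_univ]
  have h2 : #(univ.filter q) ≤ #(@Finset.filter Ω p (Classical.decPred p) univ) :=
    Finset.card_le_card fun ω hω => by
      rw [Finset.mem_filter] at hω ⊢
      exact ⟨hω.1, hqp ω hω.2⟩
  have h1' : (#(univ.filter q) : ℝ) + #(univ.filter fun ω => ¬ q ω) = Fintype.card Ω := by
    exact_mod_cast h1
  have h2' : (#(univ.filter q) : ℝ) ≤ #(@Finset.filter Ω p (Classical.decPred p) univ) := by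
    exact_mod_cast h2
  linarith

end Expansion

/-- random CSP(P^±) lower bounds with a hard global Hamming weight constraint. -/
theorem stmt0 (k t : ℕ) (ht : 3 ≤ t)
    (P : (Fin k → Bool) → Bool) (ν : (Fin k → Bool) → ℝ)
    (hdist : IsDist ν) (hwise : kwiseUniform (t - 1) ν)
    (hsupp : ∀ a, ν a ≠ 0 → P a = true) :
    ∃ c C : ℝ, 0 < c ∧ 0 < C ∧
      ∀ Δ : ℕ, 10 ≤ Δ →
        ∀ δ : ℝ, 0 < δ →
          ∃ N : ℕ, ∀ n : ℕ, N ≤ n →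
            ∀ B : ℕ, |(B : ℝ) - (n : ℝ) / 2| ≤ C * Real.sqrt (n : ℝ) →
              1 - δ ≤
                uprob (fun ω : Fin (Δ * n) → (Fin k ↪ Fin n) × (Fin k → Bool) =>
                  ∃ E : PE01 n
                      ⌊c * (n : ℝ) / ((Δ : ℝ) ^ ((2 : ℝ) / ((t : ℝ) - 2)) * Real.log Δ)⌋₊,
                    (∀ j : Fin (Δ * n),
                      E.satEq (consPoly01 P (fun i => (ω j).1 i) (ω j).2) 1) ∧
                    E.satEq (∑ i, MvPolynomial.X i) (B : ℝ)) := by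
  classical
  have hk0 : (0 : ℝ) ≤ k := Nat.cast_nonneg k
  set A : ℝ := Real.exp 1 * 6 ^ k * (4 * k + 4) with hA
  have hA0 : 0 < A := by positivity
  set c' : ℝ := (1 / (4 * A)) ^ 4 / (4 * k + 4) with hc'
  have hc'0 : 0 < c' := by positivity
  refine ⟨c' / 12, 1, by positivity, one_pos, fun Δ hΔ δ hδ => ?_⟩
  have hΔ' : (10 : ℝ) ≤ Δ := by exact_mod_cast hΔ
  set D : ℝ := (Δ : ℝ) ^ ((2 : ℝ) / ((t : ℝ) - 2)) with hD
  have hD0 : 0 < D := by positivity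
  have hlog : 1 ≤ Real.log Δ := by
    rw [Real.le_log_iff_exp_le (by linarith)]
    linarith [Real.exp_one_lt_three]
  set ζ : ℝ := 1 / (2 * Real.log Δ) with hζ
  have hζ0 : 0 < ζ := by positivity
  have hζ1 : ζ ≤ 1 / 2 := by
    rw [hζ]
    gcongr
    linarith
  have hζΔ : ζ * Real.log Δ = 1 / 2 := by
    rw [hζ]
    field_simp
  have hlarge : ∀ᶠ n : ℕ in Filter.atTop, 4 * k * Real.log Δ + 2 ≤ c' * n / D := by
    have h : Filter.Tendsto (fun n : ℕ => c' / D * (n : ℝ)) Filter.atTop Filter.atTop :=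
      tendsto_natCast_atTop_atTop.const_mul_atTop (by positivity)
    filter_upwards [h.eventually_ge_atTop (4 * k * Real.log Δ + 2)] with n hn
    rwa [div_mul_eq_mul_div] at hn
  have hsmall : ∀ᶠ n : ℕ in Filter.atTop,
      4 * (A * Δ) * ((4 * k + 4) / n : ℝ) ^ (1 / 4 : ℝ) ≤ δ := by
    have h1 : Filter.Tendsto (fun n : ℕ => ((4 * k + 4) / n : ℝ)) Filter.atTop (nhds 0) :=
      tendsto_const_div_atTop_nhds_zero_nat _
    have h2 := (h1.rpow_const (p := 1 / 4) (Or.inr (by norm_num))).const_mul (4 * (A * Δ))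
    rw [Real.zero_rpow (by norm_num), mul_zero] at h2
    exact h2.eventually_le_const hδ
  obtain ⟨N, hN⟩ := Filter.eventually_atTop.mp
    ((hlarge.and hsmall).and (Filter.eventually_ge_atTop (2 * k + 4)))
  refine ⟨N, fun n hn B hB => ?_⟩
  obtain ⟨⟨hlarge, hsmall⟩, hnk⟩ := hN n hn
  have hn0 : (0 : ℝ) < n := by exact_mod_cast (by omega : 0 < n)
  have hBn : B ≤ n := by
    have h1 : (B : ℝ) ≤ n / 2 + √n := by linarith [(abs_le.mp hB).2]
    have h2 : 2 ≤ √(n : ℝ) := by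
      refine Real.le_sqrt_of_sq_le ?_
      exact_mod_cast (by omega : 2 ^ 2 ≤ n)
    have h3 : (B : ℝ) ≤ n := by nlinarith [Real.sq_sqrt hn0.le]
    exact_mod_cast h3
  have hnone : (#(univ.filter fun i : Fin n => (balancedLits n B i).1 = none) : ℝ) ≤ 2 * √n := by
    refine (card_balancedLits_eq_none hBn).trans ?_
    rw [show 2 * (B : ℝ) - n = 2 * (B - n / 2) by ring, abs_mul, abs_two]
    linarith
  set s : ℕ := ⌊c' * n / D⌋₊ with hs
  have hs_le : (s : ℝ) ≤ c' * n / D := Nat.floor_le (by positivity)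
  have hs_gt : c' * n / D - 1 < s := Nat.sub_one_lt_floor _
  have hs_ratio : (4 * k + 4) * (s : ℝ) / n ≤ (1 / (4 * A)) ^ 4 / D := by
    calc (4 * k + 4) * (s : ℝ) / n ≤ (4 * k + 4) * (c' * n / D) / n := by gcongr
      _ = _ := by
        rw [hc']
        field_simp
  have hcount := card_not_isExpanding_le_of_large ht (fun i => (balancedLits n B i).1)
    (by omega : 2 * k ≤ n) (by omega) (by omega) card_balancedLits_eq_some hnone hζ0.le hζ1
    hζΔ.le hA hs_ratio
  have : Nonempty (Fin k ↪ Fin n) := ⟨Fin.castLEEmb (by omega)⟩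
  refine one_sub_le_uprob (hcount.trans (mul_le_mul_of_nonneg_right hsmall (Nat.cast_nonneg _)))
    fun ω hω => ?_
  refine exists_pseudoexpectation (by omega) hdist.1 hwise hsupp (balancedLits n B)
    (fun j i => (ω j).1 i) (fun j => (ω j).2) hζ0 hω ?_ ?_ fun y => ?_
  · have h1 : (⌊c' / 12 * n / (D * Real.log Δ)⌋₊ : ℝ) ≤ c' / 12 * n / (D * Real.log Δ) :=
      Nat.floor_le (by positivity)
    have h2 : c' / 12 * n / (D * Real.log Δ) = ζ * (c' * n / D) / 6 := by
      rw [hζ]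
      field_simp
      norm_num
    have h3 : 2 ≤ c' * n / D := by nlinarith
    nlinarith
  · have h1 : 2 * (k : ℝ) = ζ * (4 * k * Real.log Δ) := by
      rw [hζ]
      field_simp
      ring
    nlinarith
  · rw [map_sum]
    simp only [eval_X]
    exact sum_litPoint_balancedLits hBn y
end

section
/- Let 0 < ζ < 1 and SMALL ≤ n, and let G be a factor graph over alphabet Ω in which every constraint-vertex h has arity k_h ≤ ζ·SMALL and carries a (t_h−1)-wise uniform local distribution ν_h. Suppose that every nonempty constraint-induced subgraph H of G with c(H) ≤ SMALL satisfies v(H) ≥ e(H) − T(H)/2 + ζ·c(H). Then there exists a pseudoexpectation of degree (1/3)·ζ·SMALL (over the {0,1}-indicator variables 1_c(x_i) for each variable-vertex i and letter c ∈ Ω) that weakly satisfies every constraint of G. -/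
open MvPolynomial Finset

/-- The support of a real-valued weight function on a finite type, as a `Finset`. -/
noncomputable def rsupp {α : Type} [Fintype α] (μ : α → ℝ) : Finset α :=
  letI := Classical.decPred (fun a : α => μ a ≠ 0)
  Finset.univ.filter (fun a : α => μ a ≠ 0)

/-- A distribution `μ` on `ι → Ω` is `j`-wise uniform: its marginal on every set of at most
`j` coordinates is uniform. -/
def kwiseUniformA {ι Ω : Type} [Fintype ι] [DecidableEq ι] [Fintype Ω] [DecidableEq Ω]
    (j : ℕ) (μ : (ι → Ω) → ℝ) : Prop :=
  ∀ A : Finset ι, A.card ≤ j → ∀ a : ι → Ω,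
    ∑ x ∈ Finset.univ.filter (fun x : ι → Ω => ∀ i ∈ A, x i = a i), μ x
      = (1 / (Fintype.card Ω : ℝ)) ^ A.card

/-- A degree-`d` (here `d : ℝ`) pseudoexpectation in the indicator variables `1_c(x_i)`,
`i ∈ [n]`, `c ∈ Ω`, of an assignment of letters from `Ω` to `n` variables. -/
structure PEind (n : ℕ) (Ω : Type) [Fintype Ω] [DecidableEq Ω] (d : ℝ) where
  pE : MvPolynomial (Fin n × Ω) ℝ →ₗ[ℝ] ℝ
  normalized : pE 1 = 1
  multilin : ∀ p q : MvPolynomial (Fin n × Ω) ℝ,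
    (∀ x : Fin n → Ω,
        MvPolynomial.eval (fun ic : Fin n × Ω => if x ic.1 = ic.2 then (1 : ℝ) else 0) p
          = MvPolynomial.eval (fun ic : Fin n × Ω => if x ic.1 = ic.2 then (1 : ℝ) else 0) q) →
      pE p = pE q
  psd : ∀ p : MvPolynomial (Fin n × Ω) ℝ, 2 * (p.totalDegree : ℝ) ≤ d → 0 ≤ pE (p ^ 2)

set_option linter.unusedSectionVars false

namespace PlantedPseudoexpectation

section LinearAlgebra

variable {E ι : Type*} [AddCommGroup E] [Module ℝ E] [FiniteDimensional ℝ E]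

/-- A symmetric form that is nonnegative on `M` admits orthogonal decompositions with respect to
any subspace `L` of `M`, even when it is degenerate. -/
lemma exists_orthogonal_decomposition (B : LinearMap.BilinForm ℝ E) (hB : ∀ x y, B x y = B y x)
    {L M : Submodule ℝ E} (hLM : L ≤ M) (hM : ∀ x ∈ M, 0 ≤ B x x) {m : E} (hm : m ∈ M) :
    ∃ l ∈ L, ∀ z ∈ L, B (m - l) z = 0 := by
  set R : L →ₗ[ℝ] L →ₗ[ℝ] ℝ := B.domRestrict₁₂ L L with hR
  have hflip : R.flip = R := by
    ext x y
    exact hB y x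
  have hmem : (B m).domRestrict L ∈ (LinearMap.ker R).dualAnnihilator := by
    rw [Submodule.mem_dualAnnihilator]
    intro l hl
    have hll : B l l = 0 := LinearMap.congr_fun (LinearMap.mem_ker.1 hl) l
    have hcs : B m l * B l m ≤ B m m * B l l :=
      LinearMap.BilinForm.apply_mul_apply_le_of_forall_zero_le (B.restrict M)
        (fun x => hM x x.2) ⟨m, hm⟩ ⟨l, hLM l.2⟩
    rw [hll, mul_zero, hB l m] at hcs
    simpa using mul_self_eq_zero.1 (le_antisymm hcs (mul_self_nonneg _))
  rw [LinearMap.dualAnnihilator_ker_eq_range_flip, hflip] at hmem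
  obtain ⟨l, hl⟩ := hmem
  refine ⟨l, l.2, fun z hz => ?_⟩
  have h : B l z = B m z := LinearMap.congr_fun hl ⟨z, hz⟩
  simp [h]

/-- Gram–Schmidt for subspaces: if each `M j` is nonnegative and every vector of `M j` orthogonal
to all earlier subspaces contained in `M j` is orthogonal to all earlier subspaces, then the form
is nonnegative on the sum of the subspaces. -/
lemma nonneg_of_mem_iSup [DecidableEq ι] {α : Type*} [LinearOrder α] (B : LinearMap.BilinForm ℝ E)
    (hB : ∀ x y, B x y = B y x) (key : ι → α) (M : ι → Submodule ℝ E) (J : Finset ι)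
    (hM : ∀ j ∈ J, ∀ x ∈ M j, 0 ≤ B x x)
    (horth : ∀ j ∈ J, ∀ y ∈ M j,
      (∀ i ∈ J, key i < key j → M i ≤ M j → ∀ z ∈ M i, B y z = 0) →
        ∀ i ∈ J, i ≠ j → key i ≤ key j → ∀ z ∈ M i, B y z = 0) :
    ∀ x ∈ ⨆ i ∈ J, M i, 0 ≤ B x x := by
  suffices h : ∀ s : Finset ι, s ⊆ J → (∀ j ∈ s, ∀ i ∈ J, key i < key j → i ∈ s) →
      ∀ x ∈ ⨆ i ∈ s, M i, 0 ≤ B x x from h J subset_rfl fun _ _ i hi _ => hi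
  intro s
  induction s using Finset.induction_on_max_value key with
  | empty => simp
  | insert a s has hmax ih =>
    classical
    intro hsJ hdown x hx
    have haJ : a ∈ J := hsJ (mem_insert_self a s)
    have hsJ' : s ⊆ J := (subset_insert a s).trans hsJ
    have ih' := ih hsJ' fun j hj i hi hij => by
      rcases mem_insert.1 (hdown j (mem_insert_of_mem hj) i hi hij) with rfl | h
      · exact absurd hij (hmax j hj).not_gt
      · exact h
    rw [Finset.iSup_insert, Submodule.mem_sup] at hx
    obtain ⟨m, hm, b, hb, rfl⟩ := hx
    set L : Submodule ℝ E := ⨆ i ∈ s.filter (fun i => key i < key a ∧ M i ≤ M a), M i with hL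
    have hLs : L ≤ ⨆ i ∈ s, M i := biSup_mono fun i hi => (mem_filter.1 hi).1
    have hLa : L ≤ M a := iSup₂_le fun i hi => (mem_filter.1 hi).2.2
    obtain ⟨l, hl, hlz⟩ := exists_orthogonal_decomposition B hB hLa (hM a haJ) hm
    have hy : m - l ∈ M a := sub_mem hm (hLa hl)
    have hperp : ∀ i ∈ s, ∀ z ∈ M i, B (m - l) z = 0 := fun i hi =>
      horth a haJ _ hy (fun i hi hia hMi z hz => hlz z <| by
        refine Submodule.mem_iSup_of_mem i (Submodule.mem_iSup_of_mem ?_ hz)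
        rcases mem_insert.1 (hdown a (mem_insert_self a s) i hi hia) with rfl | h
        · exact absurd hia (lt_irrefl _)
        · exact mem_filter.2 ⟨h, hia, hMi⟩) i (hsJ' hi) (fun h => has (h ▸ hi)) (hmax i hi)
    have hker : (⨆ i ∈ s, M i) ≤ LinearMap.ker (B (m - l)) :=
      iSup₂_le fun i hi z hz => hperp i hi z hz
    have hz : B (m - l) (b + l) = 0 := hker (add_mem hb (hLs hl))
    have hsplit : m + b = (m - l) + (b + l) := by abel
    rw [hsplit]
    simp only [map_add, LinearMap.add_apply] at hz ⊢
    have h1 := hM a haJ _ hy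
    have h2 := ih' _ (add_mem hb (hLs hl))
    simp only [map_add, LinearMap.add_apply] at h2
    rw [hB b (m - l), hB l (m - l)]
    linarith

end LinearAlgebra

section Averages

variable {V Ω : Type*} [Fintype V] [DecidableEq V] [Fintype Ω] [DecidableEq Ω] [Nonempty Ω]

/-- The expectation of a function of a uniformly random assignment. -/
noncomputable def mean : ((V → Ω) → ℝ) →ₗ[ℝ] ℝ :=
  (Fintype.card (V → Ω) : ℝ)⁻¹ • ∑ x : V → Ω, LinearMap.proj x

lemma mean_apply (f : (V → Ω) → ℝ) : mean f = (Fintype.card (V → Ω) : ℝ)⁻¹ * ∑ x, f x := by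
  simp [mean]

lemma mean_const (c : ℝ) : mean (fun _ : V → Ω => c) = c := by
  rw [mean_apply, Finset.sum_const, card_univ, nsmul_eq_mul, inv_mul_cancel_left₀]
  exact_mod_cast Fintype.card_ne_zero

lemma mean_one : mean (1 : (V → Ω) → ℝ) = 1 := mean_const 1

lemma mean_nonneg {f : (V → Ω) → ℝ} (hf : ∀ x, 0 ≤ f x) : 0 ≤ mean f := by
  rw [mean_apply]
  exact mul_nonneg (by positivity) (Finset.sum_nonneg fun x _ => hf x)

lemma _root_.DependsOn.mul {f g : (V → Ω) → ℝ} {s : Set V} (hf : DependsOn f s)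
    (hg : DependsOn g s) : DependsOn (f * g) s := fun x y h => by
  simp [hf h, hg h]

lemma _root_.DependsOn.prod {κ : Type*} {f : κ → (V → Ω) → ℝ} {s : Set V} (J : Finset κ)
    (hf : ∀ j ∈ J, DependsOn (f j) s) : DependsOn (∏ j ∈ J, f j) s := fun x y h => by
  simp only [Finset.prod_apply]
  exact Finset.prod_congr rfl fun j hj => hf j hj h

/-- The conditional expectation of `f` given the values of the variables in `W`. -/
noncomputable def condMean (W : Finset V) (f : (V → Ω) → ℝ) (x : V → Ω) : ℝ :=
  mean fun z => f (W.piecewise x z)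

lemma condMean_dependsOn (W S : Finset V) {f : (V → Ω) → ℝ} (hf : DependsOn f (S : Set V)) :
    DependsOn (condMean W f) ((S ∩ W : Finset V) : Set V) := fun x y h => by
  refine congrArg mean (funext fun z => hf fun i hi => ?_)
  by_cases hiW : i ∈ W
  · simp only [hiW, Finset.piecewise_eq_of_mem]
    exact h i (by simpa [hiW] using hi)
  · simp [hiW]

lemma sum_sum_piecewise (W : Finset V) (K : (V → Ω) → ℝ) :
    ∑ x : V → Ω, ∑ z : V → Ω, K (W.piecewise x z) = Fintype.card (V → Ω) * ∑ x, K x := by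
  have hinv : Function.Involutive fun p : (V → Ω) × (V → Ω) =>
      (W.piecewise p.1 p.2, W.piecewise p.2 p.1) := fun p => by
    ext i <;> by_cases hi : i ∈ W <;> simp [hi]
  rw [← Fintype.sum_prod_type' fun x z => K (W.piecewise x z)]
  refine (Equiv.sum_comp (hinv.toPerm _) fun p => K p.1).trans ?_
  simp [Fintype.sum_prod_type, Finset.mul_sum]

lemma mean_mul_condMean (W : Finset V) {m : (V → Ω) → ℝ} (hm : DependsOn m (W : Set V))
    (u : (V → Ω) → ℝ) : mean (m * condMean W u) = mean (m * u) := by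
  have hcard : (Fintype.card (V → Ω) : ℝ) ≠ 0 := by exact_mod_cast Fintype.card_ne_zero
  have h : ∀ x z : V → Ω, m x * u (W.piecewise x z) = (m * u) (W.piecewise x z) := fun x z => by
    rw [Pi.mul_apply, hm (x := W.piecewise x z) (y := x)]
    exact fun i hi => Finset.piecewise_eq_of_mem _ _ _ (by simpa using hi)
  rw [mean_apply (m * condMean W u), mean_apply (m * u)]
  congr 1
  simp only [Pi.mul_apply, condMean, mean_apply, mul_left_comm _ (Fintype.card (V → Ω) : ℝ)⁻¹]
  rw [← Finset.mul_sum]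
  simp only [Finset.mul_sum _ _ (m _), h]
  rw [sum_sum_piecewise, inv_mul_cancel_left₀ hcard]
  rfl

lemma sum_sum_update (v : V) (K : (V → Ω) → ℝ) :
    ∑ x : V → Ω, ∑ c : Ω, K (Function.update x v c) = Fintype.card Ω * ∑ x, K x := by
  have hinv : Function.Involutive fun p : (V → Ω) × Ω => (Function.update p.1 v p.2, p.1 v) :=
    fun p => by simp
  rw [← Fintype.sum_prod_type' fun x c => K (Function.update x v c)]
  refine (Equiv.sum_comp (hinv.toPerm _) fun p => K p.1).trans ?_
  simp [Fintype.sum_prod_type, Finset.mul_sum]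

/-- If `f` ignores `x_v` and `g` averages to zero over `x_v`, then `f * g` has mean zero. -/
lemma mean_mul_eq_zero (v : V) {f g : (V → Ω) → ℝ} (hf : DependsOn f ({v}ᶜ : Set V))
    (hg : ∀ x, ∑ c : Ω, g (Function.update x v c) = 0) : mean (f * g) = 0 := by
  have hcard : (Fintype.card Ω : ℝ) ≠ 0 := by exact_mod_cast Fintype.card_ne_zero
  have h : ∑ x : V → Ω, ∑ c : Ω, (f * g) (Function.update x v c) = 0 := by
    refine Finset.sum_eq_zero fun x _ => ?_
    have hfx : ∀ c, f (Function.update x v c) = f x := fun c =>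
      hf fun i hi => Function.update_of_ne (by simpa using hi) _ _
    simp only [Pi.mul_apply, hfx, ← Finset.mul_sum, hg, mul_zero]
  rw [sum_sum_update] at h
  rw [mean_apply, (mul_eq_zero.1 h).resolve_left hcard, mul_zero]

lemma mean_comp_embedding {K : Type*} [Fintype K] [DecidableEq K] (e : K ↪ V)
    (F : (K → Ω) → ℝ) : mean (fun x : V → Ω => F (x ∘ e)) = mean F := by
  have hV : (Fintype.card (V → Ω) : ℝ) ≠ 0 := by exact_mod_cast Fintype.card_ne_zero
  have hK : (Fintype.card (K → Ω) : ℝ) ≠ 0 := by exact_mod_cast Fintype.card_ne_zero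
  have hinv : Function.Involutive fun p : (V → Ω) × (K → Ω) =>
      (Function.extend e p.2 p.1, p.1 ∘ e) := fun p => by
    ext i
    · by_cases hi : ∃ j, e j = i
      · obtain ⟨j, rfl⟩ := hi
        simp [e.injective.extend_apply]
      · simp [Function.extend_apply' _ _ _ hi]
    · simp [e.injective.extend_apply]
  have h := Equiv.sum_comp (hinv.toPerm _) fun p => F p.2
  simp only [Function.Involutive.coe_toPerm, Fintype.sum_prod_type, Finset.sum_const,
    card_univ, nsmul_eq_mul, ← Finset.mul_sum] at h
  rw [mean_apply, mean_apply]
  field_simp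
  linarith

end Averages

section Components

variable {V Ω : Type*} [Fintype V] [DecidableEq V] [Fintype Ω] [DecidableEq Ω] [Nonempty Ω]

/-- The mean-zero kernel `q·1[a = b] - 1` on the alphabet. -/
noncomputable def kern (a b : Ω) : ℝ := (if a = b then (Fintype.card Ω : ℝ) else 0) - 1

lemma sum_kern_left (b : Ω) : ∑ a : Ω, kern a b = 0 := by simp [kern]

lemma sum_kern_right (a : Ω) : ∑ b : Ω, kern a b = 0 := by simp [kern]

/-- The Efron–Stein component of `f` on the set of variables `A`. -/
noncomputable def component (f : (V → Ω) → ℝ) (A : Finset V) (x : V → Ω) : ℝ :=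
  mean fun z => f z * ∏ i ∈ A, kern (x i) (z i)

lemma component_dependsOn (f : (V → Ω) → ℝ) (A : Finset V) :
    DependsOn (component f A) (A : Set V) := fun x y h => by
  refine congrArg mean (funext fun z => ?_)
  rw [Finset.prod_congr rfl fun i hi => by rw [h i (by simpa using hi)]]

lemma component_empty (f : (V → Ω) → ℝ) : component f ∅ = fun _ => mean f := by
  ext x
  simp [component]

lemma sum_component (f : (V → Ω) → ℝ) : ∑ A : Finset V, component f A = f := by
  ext x
  have hV : (Fintype.card (V → Ω) : ℝ) ≠ 0 := by exact_mod_cast Fintype.card_ne_zero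
  have hker : ∀ z : V → Ω, ∑ A : Finset V, ∏ i ∈ A, kern (x i) (z i)
      = if x = z then (Fintype.card (V → Ω) : ℝ) else 0 := fun z => by
    rw [← Finset.powerset_univ, ← Finset.prod_one_add]
    simp only [kern, add_sub_cancel]
    split_ifs with h
    · simp [h]
    · obtain ⟨i, hi⟩ := Function.ne_iff.1 h
      exact Finset.prod_eq_zero (mem_univ i) (if_neg hi)
  simp only [Finset.sum_apply, component, ← map_sum]
  rw [mean_apply]
  simp only [Finset.sum_apply, ← Finset.mul_sum, hker]
  simp [mul_comm]

lemma sum_component_update (f : (V → Ω) → ℝ) {A : Finset V} {v : V} (hv : v ∈ A) (x : V → Ω) :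
    ∑ c : Ω, component f A (Function.update x v c) = 0 := by
  simp only [component, ← map_sum]
  rw [← map_zero (mean (V := V) (Ω := Ω))]
  congr 1
  ext z
  rw [Finset.sum_apply, Pi.zero_apply]
  simp only [← Finset.mul_sum, ← Finset.mul_prod_erase _ _ hv, Function.update_self]
  have h : ∀ c, ∏ i ∈ A.erase v, kern (Function.update x v c i) (z i)
      = ∏ i ∈ A.erase v, kern (x i) (z i) := fun c =>
    Finset.prod_congr rfl fun i hi => by rw [Function.update_of_ne (Finset.ne_of_mem_erase hi)]
  simp only [h, ← Finset.sum_mul, sum_kern_left, zero_mul, mul_zero]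

lemma component_eq_zero_of_not_subset {f : (V → Ω) → ℝ} {N A : Finset V}
    (hf : DependsOn f (N : Set V)) (hA : ¬ A ⊆ N) : component f A = 0 := by
  obtain ⟨v, hvA, hvN⟩ := Finset.not_subset.1 hA
  ext x
  refine mean_mul_eq_zero v (f := f) (g := fun z => ∏ i ∈ A, kern (x i) (z i)) ?_ fun z => ?_
  · exact hf.mono fun i hi => by rintro rfl; exact hvN (by simpa using hi)
  · have h : ∀ c, ∏ i ∈ A.erase v, kern (x i) (Function.update z v c i)
        = ∏ i ∈ A.erase v, kern (x i) (z i) := fun c =>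
      Finset.prod_congr rfl fun i hi => by rw [Function.update_of_ne (Finset.ne_of_mem_erase hi)]
    simp only [← Finset.mul_prod_erase _ _ hvA, Function.update_self, h, ← Finset.sum_mul,
      sum_kern_right, zero_mul]

end Components

section Potential

variable {V H : Type*} [DecidableEq V] [DecidableEq H]

/-- The potential `|W| + T(C)/2 - e(W, C)` of a set of variables `W` and a set of constraints `C`,
where `e(W, C)` counts the edges between `W` and `C`. -/
noncomputable def potential (N : H → Finset V) (t : H → ℕ) (Q : Finset V × Finset H) : ℝ :=
  Q.1.card + (∑ h ∈ Q.2, (t h : ℝ)) / 2 - (Q.2.sigma fun h => N h ∩ Q.1).card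

lemma potential_eq_sum (N : H → Finset V) (t : H → ℕ) (W : Finset V) (C : Finset H) :
    potential N t (W, C) = W.card - ∑ h ∈ C, (((N h ∩ W).card : ℝ) - t h / 2) := by
  simp only [potential, Finset.card_sigma, Finset.sum_sub_distrib, Finset.sum_div, Nat.cast_sum]
  ring

lemma potential_sup_add_inf_le (N : H → Finset V) (t : H → ℕ) (Q R : Finset V × Finset H) :
    potential N t (Q ⊔ R) + potential N t (Q ⊓ R) ≤ potential N t Q + potential N t R := by
  have h1 : ((Q ⊔ R).1.card : ℝ) + (Q ⊓ R).1.card = Q.1.card + R.1.card := by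
    exact_mod_cast Finset.card_union_add_card_inter Q.1 R.1
  have h2 : (∑ h ∈ (Q ⊔ R).2, (t h : ℝ)) + ∑ h ∈ (Q ⊓ R).2, (t h : ℝ)
      = (∑ h ∈ Q.2, (t h : ℝ)) + ∑ h ∈ R.2, (t h : ℝ) := Finset.sum_union_inter
  have h3 := Finset.card_union_add_card_inter (Q.2.sigma fun h => N h ∩ Q.1)
    (R.2.sigma fun h => N h ∩ R.1)
  have h4 : (Q.2.sigma fun h => N h ∩ Q.1) ∩ (R.2.sigma fun h => N h ∩ R.1)
      = (Q ⊓ R).2.sigma fun h => N h ∩ (Q ⊓ R).1 := by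
    ext ⟨h, v⟩
    simp only [mem_inter, mem_sigma, Prod.fst_inf, Prod.snd_inf, Finset.inf_eq_inter]
    tauto
  have h5 : (Q.2.sigma fun h => N h ∩ Q.1) ∪ (R.2.sigma fun h => N h ∩ R.1)
      ⊆ (Q ⊔ R).2.sigma fun h => N h ∩ (Q ⊔ R).1 := by
    rintro ⟨h, v⟩
    simp only [mem_inter, mem_union, mem_sigma, Prod.fst_sup, Prod.snd_sup, Finset.sup_eq_union]
    tauto
  rw [h4] at h3
  have h6 : ((Q.2.sigma fun h => N h ∩ Q.1).card : ℝ) + (R.2.sigma fun h => N h ∩ R.1).card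
      ≤ ((Q ⊔ R).2.sigma fun h => N h ∩ (Q ⊔ R).1).card
        + ((Q ⊓ R).2.sigma fun h => N h ∩ (Q ⊓ R).1).card := by
    rw [← Nat.cast_add, ← h3]
    exact_mod_cast Nat.add_le_add_right (Finset.card_le_card h5) _
  simp only [potential]
  linarith

/-- A pair with at most `m` constraints is closed if its potential is smaller than that of any
larger pair with at most `m` constraints. -/
def IsClosedPair (N : H → Finset V) (t : H → ℕ) (m : ℕ) (Q : Finset V × Finset H) : Prop :=
  Q.2.card ≤ m ∧ ∀ R, Q < R → R.2.card ≤ m → potential N t Q < potential N t R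

lemma exists_isClosedPair_ge [Fintype V] [Fintype H] (N : H → Finset V) (t : H → ℕ) {m : ℕ}
    (Q : Finset V × Finset H) (hQ : Q.2.card ≤ m) :
    ∃ R, Q ≤ R ∧ IsClosedPair N t m R ∧ potential N t R ≤ potential N t Q := by
  induction Q using WellFoundedGT.induction with
  | ind Q ih =>
    by_cases hcl : IsClosedPair N t m Q
    · exact ⟨Q, le_rfl, hcl, le_rfl⟩
    · simp only [IsClosedPair, hQ, true_and, not_forall, not_lt] at hcl
      obtain ⟨R, hQR, hR, hle⟩ := hcl
      obtain ⟨R', h1, h2, h3⟩ := ih R hQR hR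
      exact ⟨R', hQR.le.trans h1, h2, h3.trans hle⟩

lemma IsClosedPair.subset {N : H → Finset V} {t : H → ℕ} {m : ℕ} {Q : Finset V × Finset H}
    (hQ : IsClosedPair N t m Q) {h : H} (hh : h ∈ Q.2) : N h ⊆ Q.1 := by
  intro v hv
  by_contra hvW
  obtain ⟨W, C⟩ := Q
  have hlt := hQ.2 (insert v W, C)
    (Prod.mk_lt_mk_iff_left.2 (Finset.ssubset_insert hvW)) hQ.1
  rw [potential_eq_sum, potential_eq_sum, Finset.card_insert_of_notMem hvW] at hlt
  have hsum : ∑ h ∈ C, (((N h ∩ W).card : ℝ) - t h / 2) + 1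
      ≤ ∑ h ∈ C, (((N h ∩ insert v W).card : ℝ) - t h / 2) := by
    rw [← Finset.add_sum_erase _ _ hh, ← Finset.add_sum_erase _ _ hh]
    have h1 : ((N h ∩ insert v W).card : ℝ) = (N h ∩ W).card + 1 := by
      rw [Finset.inter_insert_of_mem hv, Finset.card_insert_of_notMem (by simp [hvW])]
      push_cast
      ring
    have h2 : ∑ h ∈ C.erase h, (((N h ∩ W).card : ℝ) - t h / 2)
        ≤ ∑ h ∈ C.erase h, (((N h ∩ insert v W).card : ℝ) - t h / 2) := by
      gcongr
      exact Finset.subset_insert v W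
    linarith
  push_cast at hlt
  linarith

lemma IsClosedPair.inf {N : H → Finset V} {t : H → ℕ} {m : ℕ} {Q R : Finset V × Finset H}
    (hQ : IsClosedPair N t m Q) (hR : IsClosedPair N t m R)
    (hsup : ∀ X : Finset V × Finset H, X.2.card ≤ m → potential N t X ≤ potential N t (Q ⊓ R) →
      (X.2 ∪ Q.2).card ≤ m ∧ (X.2 ∪ R.2).card ≤ m) :
    IsClosedPair N t m (Q ⊓ R) := by
  have key : ∀ {P : Finset V × Finset H}, IsClosedPair N t m P → ∀ X : Finset V × Finset H,
      (X.2 ∪ P.2).card ≤ m → ¬ X ≤ P → potential N t (X ⊓ P) < potential N t X := by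
    intro P hP X hX hXP
    have h1 := hP.2 (X ⊔ P) (right_lt_sup.2 hXP) hX
    have h2 := potential_sup_add_inf_le N t X P
    linarith
  refine ⟨(Finset.card_le_card Finset.inter_subset_left).trans hQ.1, fun X hX hXm => ?_⟩
  by_contra! hle
  obtain ⟨hXQ, hXR⟩ := hsup X hXm hle
  have hXR' : ((X ⊓ Q).2 ∪ R.2).card ≤ m :=
    (Finset.card_le_card (Finset.union_subset_union_left Finset.inter_subset_left)).trans hXR
  have hinf : X ⊓ Q ⊓ R = Q ⊓ R := by rw [inf_assoc, inf_eq_right.2 hX.le]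
  by_cases h1 : X ≤ Q
  · rw [inf_eq_left.2 h1] at hinf hXR'
    have h2 : ¬ X ≤ R := fun h2 => hX.not_ge (le_inf h1 h2)
    have h3 := key hR X hXR h2
    rw [hinf] at h3
    linarith
  · have h3 := key hQ X hXQ h1
    by_cases h2 : X ⊓ Q ≤ R
    · rw [← hinf, inf_eq_left.2 h2] at hle
      linarith
    · have h4 := key hR _ hXR' h2
      rw [hinf] at h4
      linarith

lemma potential_inf_le {N : H → Finset V} {t : H → ℕ} {m : ℕ} {Q R : Finset V × Finset H}
    (hQ : IsClosedPair N t m Q) (hm : (Q.2 ∪ R.2).card ≤ m) :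
    potential N t (Q ⊓ R) ≤ potential N t R := by
  have h := potential_sup_add_inf_le N t Q R
  rcases (le_sup_left : Q ≤ Q ⊔ R).eq_or_lt with h1 | h1
  · rw [← h1] at h
    linarith
  · have h2 := hQ.2 _ h1 hm
    linarith

/-- A choice of edges `A` is `S`-closed if every constraint it uses has at least `t h` chosen edges
and every variable outside `S` that it touches lies on at least two chosen edges. -/
def IsClosedEdgeSet (N : H → Finset V) (t : H → ℕ) (S : Finset V) (A : H → Finset V) : Prop :=
  (∀ h, (A h).Nonempty → A h ⊆ N h ∧ t h ≤ (A h).card) ∧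
    ∀ v ∉ S, ∀ h, v ∈ A h → ∃ h', h' ≠ h ∧ v ∈ A h'

variable [Fintype H]

/-- The constraints used by a choice of edges. -/
def usedConstraints (A : H → Finset V) : Finset H := univ.filter fun h => (A h).Nonempty

lemma mem_usedConstraints {A : H → Finset V} {h : H} :
    h ∈ usedConstraints A ↔ (A h).Nonempty := by
  simp [usedConstraints]

/-- How the potential changes when a closed choice of edges is added to a pair. -/
lemma potential_extend_le {N : H → Finset V} {t : H → ℕ} {W : Finset V} {C : Finset H}
    (hWC : ∀ h ∈ C, N h ⊆ W) {S T : Finset V} (hS : S ⊆ W) {A : H → Finset V}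
    (hA : IsClosedEdgeSet N t (S ∪ T) A) :
    2 * potential N t (W ∪ univ.biUnion A, C ∪ usedConstraints A) + ∑ h ∈ Cᶜ, ((A h ∩ W).card : ℝ)
      ≤ 2 * potential N t (W, C) + (T \ W).card := by
  set X := univ.biUnion A \ W with hX
  set D := usedConstraints A \ C with hD
  have hcompl : ∀ B : Finset V → ℕ, B ∅ = 0 →
      ∑ h ∈ Cᶜ, (B (A h) : ℝ) = ∑ h ∈ D, (B (A h) : ℝ) := fun B hB => by
    refine (Finset.sum_subset (fun h hh => ?_) fun h hh hhD => ?_).symm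
    · simpa using (mem_sdiff.1 hh).2
    · have : ¬ (A h).Nonempty := fun h' =>
        hhD (mem_sdiff.2 ⟨mem_usedConstraints.2 h', by simpa using hh⟩)
      rw [Finset.not_nonempty_iff_eq_empty.1 this, hB, Nat.cast_zero]
  have hdeg : 2 * X.card ≤ ∑ h ∈ D, (A h \ W).card + (T \ W).card := by
    have h1 : ∀ v ∈ X, 2 ≤ (D.filter fun h => v ∈ A h).card + if v ∈ T then 1 else 0 := by
      intro v hv
      obtain ⟨hvA, hvW⟩ := mem_sdiff.1 hv
      obtain ⟨h, -, hh⟩ := Finset.mem_biUnion.1 hvA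
      have hmem : ∀ h, v ∈ A h → h ∈ D.filter fun h => v ∈ A h := fun h hh =>
        mem_filter.2 ⟨mem_sdiff.2 ⟨mem_usedConstraints.2 ⟨v, hh⟩, fun hC =>
          hvW (hWC h hC ((hA.1 h ⟨v, hh⟩).1 hh))⟩, hh⟩
      by_cases hvT : v ∈ T
      · have := Finset.card_pos.2 ⟨h, hmem h hh⟩
        simp only [hvT, if_true]
        omega
      · obtain ⟨h', hne, hh'⟩ := hA.2 v
          (by simpa [hvT] using fun hvS => hvW (hS hvS)) h hh
        have := Finset.one_lt_card.2 ⟨h', hmem h' hh', h, hmem h hh, hne⟩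
        omega
    have h2 := Finset.sum_le_sum h1
    rw [Finset.sum_const, smul_eq_mul, Finset.sum_add_distrib, mul_comm] at h2
    refine h2.trans (Nat.add_le_add ?_ ?_)
    · simp only [Finset.card_filter]
      rw [Finset.sum_comm]
      simp only [← Finset.card_filter]
      refine Finset.sum_le_sum fun h _ => Finset.card_le_card fun v hv => ?_
      obtain ⟨hvX, hvA⟩ := mem_filter.1 hv
      exact mem_sdiff.2 ⟨hvA, (mem_sdiff.1 hvX).2⟩
    · rw [← Finset.card_filter]
      refine Finset.card_le_card fun v hv => ?_
      obtain ⟨hvX, hvT⟩ := mem_filter.1 hv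
      exact mem_sdiff.2 ⟨hvT, (mem_sdiff.1 hvX).2⟩
  have hcard : ((W ∪ univ.biUnion A).card : ℝ) = W.card + X.card := by
    rw [← Finset.union_sdiff_self_eq_union, Finset.card_union_of_disjoint Finset.disjoint_sdiff]
    push_cast
    rfl
  have hsplit : C ∪ usedConstraints A = C ∪ D := Finset.union_sdiff_self_eq_union.symm
  have hC : ∑ h ∈ C, (((N h ∩ W).card : ℝ) - t h / 2)
      ≤ ∑ h ∈ C, (((N h ∩ (W ∪ univ.biUnion A)).card : ℝ) - t h / 2) := by
    gcongr
    exact Finset.subset_union_left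
  have hDsum : ∑ h ∈ D, (((A h ∩ W).card : ℝ) + (A h \ W).card) / 2
      ≤ ∑ h ∈ D, (((N h ∩ (W ∪ univ.biUnion A)).card : ℝ) - t h / 2) := by
    refine Finset.sum_le_sum fun h hh => ?_
    obtain ⟨hN, ht⟩ := hA.1 h (mem_usedConstraints.1 (mem_sdiff.1 hh).1)
    have h1 : ((A h ∩ W).card : ℝ) + (A h \ W).card = (A h).card := by
      exact_mod_cast Finset.card_inter_add_card_sdiff (A h) W
    have h2 : ((A h).card : ℝ) ≤ (N h ∩ (W ∪ univ.biUnion A)).card := by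
      refine Nat.cast_le.2 (Finset.card_le_card (Finset.subset_inter hN ?_))
      exact (Finset.subset_biUnion_of_mem A (mem_univ h)).trans Finset.subset_union_right
    have h3 : (t h : ℝ) ≤ (A h).card := by exact_mod_cast ht
    rw [h1]
    linarith
  rw [← Finset.sum_div, Finset.sum_add_distrib] at hDsum
  have hdeg' : 2 * (X.card : ℝ) ≤ ∑ h ∈ D, ((A h \ W).card : ℝ) + (T \ W).card := by
    exact_mod_cast hdeg
  rw [hcompl (fun B => (B ∩ W).card) (by simp), potential_eq_sum, potential_eq_sum, hcard, hsplit,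
    Finset.sum_union Finset.disjoint_sdiff]
  linarith

end Potential

section Degree

variable {V Ω : Type*} [Fintype V] [DecidableEq V] [Fintype Ω] [DecidableEq Ω] [Nonempty Ω]

/-- The span of the functions that depend on fewer than `s` variables, all of them in `W`. -/
def degLT (W : Finset V) (s : ℕ) : Submodule ℝ ((V → Ω) → ℝ) :=
  Submodule.span ℝ {f | ∃ T ⊆ W, T.card < s ∧ DependsOn f (T : Set V)}

lemma mem_degLT {W T : Finset V} {s : ℕ} {f : (V → Ω) → ℝ} (hT : T ⊆ W) (hs : T.card < s)
    (hf : DependsOn f (T : Set V)) : f ∈ degLT W s :=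
  Submodule.subset_span ⟨T, hT, hs, hf⟩

lemma degLT_mono {W W' : Finset V} {s s' : ℕ} (hW : W ⊆ W') (hs : s ≤ s') :
    degLT (Ω := Ω) W s ≤ degLT W' s' :=
  Submodule.span_mono fun _ ⟨T, hT, hTs, hf⟩ => ⟨T, hT.trans hW, hTs.trans_le hs, hf⟩

lemma dependsOn_of_mem_degLT {W : Finset V} {s : ℕ} {f : (V → Ω) → ℝ} (hf : f ∈ degLT W s) :
    DependsOn f (W : Set V) := by
  induction hf using Submodule.span_induction with
  | mem f hf =>
    obtain ⟨T, hT, -, hf⟩ := hf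
    exact hf.mono (by exact_mod_cast hT)
  | zero => exact fun _ _ _ => rfl
  | add f g _ _ hf hg => exact fun x y h => congrArg₂ (· + ·) (hf h) (hg h)
  | smul c f _ hf => exact fun x y h => congrArg (c * ·) (hf h)

end Degree

section System

variable {V H Ω : Type*} [Fintype V] [DecidableEq V] [Fintype H] [DecidableEq H]
  [Fintype Ω] [DecidableEq Ω] [Nonempty Ω]

variable (V H Ω) in
/-- A family of local densities `φ h` on the variables `N h`, whose Efron–Stein components of
positive degree below `t h` vanish, over a factor graph in which every set of at most `m`
constraints expands. -/
structure ExpandingSystem (ζ : ℝ) (m : ℕ) where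
  φ : H → (V → Ω) → ℝ
  N : H → Finset V
  t : H → ℕ
  φ_nonneg : ∀ h x, 0 ≤ φ h x
  φ_dependsOn : ∀ h, DependsOn (φ h) (N h : Set V)
  mean_φ : ∀ h, mean (φ h) = 1
  component_eq_zero : ∀ h A, A.Nonempty → A ⊆ N h → A.card < t h → component (φ h) A = 0
  ζ_pos : 0 < ζ
  expansion : ∀ W C, C.card ≤ m → ζ * C.card ≤ potential N t (W, C)

namespace ExpandingSystem

variable {ζ : ℝ} {m : ℕ} (G : ExpandingSystem V H Ω ζ m)

/-- The product of the components of the local densities on the chosen edges. -/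
noncomputable def term (A : H → Finset V) : (V → Ω) → ℝ := ∏ h, component (G.φ h) (A h)

/-- The (unnormalized) planted density of a set of constraints. -/
noncomputable def density (C : Finset H) : (V → Ω) → ℝ := ∏ h ∈ C, G.φ h

/-- The pseudoexpectation: the planted expectation of a function, keeping only the terms that use
at most `m` constraints. -/
noncomputable def pexp : ((V → Ω) → ℝ) →ₗ[ℝ] ℝ :=
  ∑ A ∈ univ.filter fun A : H → Finset V => (usedConstraints A).card ≤ m,
    mean ∘ₗ LinearMap.mulRight ℝ (G.term A)

lemma pexp_apply (f : (V → Ω) → ℝ) :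
    G.pexp f = ∑ A ∈ univ.filter fun A : H → Finset V => (usedConstraints A).card ≤ m,
      mean (f * G.term A) := by
  simp [pexp]

lemma density_nonneg (C : Finset H) (x : V → Ω) : 0 ≤ G.density C x := by
  rw [density, Finset.prod_apply]
  exact Finset.prod_nonneg fun h _ => G.φ_nonneg h x

lemma isClosedEdgeSet_of_mean_ne_zero {S : Finset V} {f : (V → Ω) → ℝ}
    (hf : DependsOn f (S : Set V)) {A : H → Finset V} (hA : mean (f * G.term A) ≠ 0) :
    IsClosedEdgeSet G.N G.t S A := by
  have hne : ∀ h, component (G.φ h) (A h) ≠ 0 := fun h h0 => hA <| by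
    rw [term, Finset.prod_eq_zero (mem_univ h) h0, mul_zero, map_zero]
  refine ⟨fun h hh => ?_, fun v hvS h hv => ?_⟩
  · have hN : A h ⊆ G.N h := by
      by_contra hN
      exact hne h (component_eq_zero_of_not_subset (G.φ_dependsOn h) hN)
    refine ⟨hN, ?_⟩
    by_contra! ht
    exact hne h (G.component_eq_zero h _ hh hN ht)
  · by_contra! hno
    refine hA ?_
    rw [term, ← Finset.mul_prod_erase univ _ (mem_univ h), mul_left_comm, mul_comm]
    refine mean_mul_eq_zero v (DependsOn.mul ?_ ?_) (sum_component_update _ hv)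
    · exact hf.mono fun i hi => by rintro rfl; exact hvS (by simpa using hi)
    · refine DependsOn.prod _ fun h' hh' => (component_dependsOn _ _).mono fun i hi => ?_
      rintro rfl
      exact hno h' (Finset.ne_of_mem_erase hh') (by simpa using hi)

/-- Closed choices of edges use few constraints. -/
lemma card_usedConstraints_le {S : Finset V} {A : H → Finset V}
    (hA : IsClosedEdgeSet G.N G.t S A) (hm : (usedConstraints A).card ≤ m) :
    2 * ζ * (usedConstraints A).card ≤ S.card := by
  have h1 := potential_extend_le (N := G.N) (t := G.t) (W := ∅) (C := ∅) (S := ∅) (T := S)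
    (by simp) (subset_refl _) (A := A) (by simpa using hA)
  have h2 := G.expansion (∅ ∪ univ.biUnion A) (∅ ∪ usedConstraints A) (by simpa using hm)
  have h3 : potential G.N G.t (∅, ∅) = 0 := by simp [potential]
  have h4 : 0 ≤ ∑ h ∈ (∅ : Finset H)ᶜ, ((A h ∩ ∅).card : ℝ) := by positivity
  rw [h3] at h1
  simp only [Finset.empty_union, Finset.sdiff_empty] at h1 h2
  linarith

variable {G} {Q : Finset V × Finset H}

/-- A closed choice of edges leaving a closed pair crosses its boundary few times. -/
lemma crossing_lt (hQ : IsClosedPair G.N G.t m Q) {S T : Finset V} (hS : S ⊆ Q.1)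
    (hT : ¬ T ⊆ Q.1) {A : H → Finset V} (hA : IsClosedEdgeSet G.N G.t (S ∪ T) A)
    (hm : (Q.2 ∪ usedConstraints A).card ≤ m) :
    ∑ h ∈ Q.2ᶜ, (A h ∩ Q.1).card < (T \ Q.1).card := by
  have h1 := potential_extend_le (fun h hh => hQ.subset hh) hS hA
  have hle : Q ≤ (Q.1 ∪ univ.biUnion A, Q.2 ∪ usedConstraints A) :=
    ⟨Finset.subset_union_left, Finset.subset_union_left⟩
  rcases hle.eq_or_lt with h2 | h2
  · have hsum : ∑ h ∈ Q.2ᶜ, (A h ∩ Q.1).card = 0 := by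
      refine Finset.sum_eq_zero fun h hh => ?_
      have hused : h ∉ usedConstraints A := fun hh' => (mem_compl.1 hh) <| by
        rw [congrArg Prod.snd h2]
        exact mem_union_right _ hh'
      rw [mem_usedConstraints, Finset.not_nonempty_iff_eq_empty] at hused
      simp [hused]
    rw [hsum]
    exact Finset.card_pos.2 (Finset.sdiff_nonempty.2 hT)
  · have h3 := hQ.2 _ h2 hm
    have h4 : ∑ h ∈ Q.2ᶜ, ((A h ∩ Q.1).card : ℝ) < (T \ Q.1).card := by linarith
    exact_mod_cast h4

/-- A closed pair contains every small choice of edges that is closed for a subset of its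
variables. -/
lemma usedConstraints_subset (hQ : IsClosedPair G.N G.t m Q) {S : Finset V} (hS : S ⊆ Q.1)
    {A : H → Finset V} (hA : IsClosedEdgeSet G.N G.t S A)
    (hm : (Q.2 ∪ usedConstraints A).card ≤ m) : usedConstraints A ⊆ Q.2 := by
  have h1 := potential_extend_le (T := ∅) (fun h hh => hQ.subset hh) hS (A := A)
    (by simpa using hA)
  have h4 : 0 ≤ ∑ h ∈ Q.2ᶜ, ((A h ∩ Q.1).card : ℝ) := by positivity
  have hle : Q ≤ (Q.1 ∪ univ.biUnion A, Q.2 ∪ usedConstraints A) :=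
    ⟨Finset.subset_union_left, Finset.subset_union_left⟩
  rcases hle.eq_or_lt with h2 | h2
  · intro h hh
    rw [congrArg Prod.snd h2]
    exact mem_union_right _ hh
  · have h3 := hQ.2 _ h2 hm
    simp only [Finset.empty_sdiff, Finset.card_empty, Nat.cast_zero] at h1
    linarith

lemma card_union_usedConstraints_le (hQ : IsClosedPair G.N G.t m Q) {S : Finset V}
    (hsize : S.card + 2 * potential G.N G.t Q ≤ 2 * (ζ * m)) {A : H → Finset V}
    (hA : IsClosedEdgeSet G.N G.t S A) (hm : (usedConstraints A).card ≤ m) :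
    (Q.2 ∪ usedConstraints A).card ≤ m := by
  have h1 := G.card_usedConstraints_le hA hm
  have h2 := G.expansion Q.1 Q.2 hQ.1
  refine (Finset.card_union_le _ _).trans ?_
  have h3 : ζ * (Q.2.card + (usedConstraints A).card) ≤ ζ * m := by linarith
  exact_mod_cast le_of_mul_le_mul_left h3 G.ζ_pos

variable (G) in
/-- Summing the terms over all choices of edges that are prescribed outside `C`. -/
lemma sum_term_eq (C : Finset H) (A₀ : H → Finset V) :
    ∑ A ∈ univ.filter (fun A : H → Finset V => ∀ h ∉ C, A h = A₀ h), G.term A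
      = G.density C * ∏ h ∈ Cᶜ, component (G.φ h) (A₀ h) := by
  have hset : univ.filter (fun A : H → Finset V => ∀ h ∉ C, A h = A₀ h)
      = Fintype.piFinset fun h => if h ∈ C then univ else {A₀ h} := by
    ext A
    simp only [mem_filter, mem_univ, true_and, Fintype.mem_piFinset]
    refine forall_congr' fun h => ?_
    by_cases hh : h ∈ C <;> simp [hh]
  simp only [hset, term]
  rw [← Finset.prod_univ_sum, ← Finset.prod_mul_prod_compl C, density]
  congr 1
  · exact Finset.prod_congr rfl fun h hh => by rw [if_pos hh, sum_component]
  · exact Finset.prod_congr rfl fun h hh => by rw [if_neg (mem_compl.1 hh), Finset.sum_singleton]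

/-- The pseudoexpectation agrees with a planted expectation on functions of few variables. -/
lemma pexp_eq_mean (hQ : IsClosedPair G.N G.t m Q) {S : Finset V} (hS : S ⊆ Q.1)
    (hsize : S.card + 2 * potential G.N G.t Q ≤ 2 * (ζ * m)) {f : (V → Ω) → ℝ}
    (hf : DependsOn f (S : Set V)) : G.pexp f = mean (f * G.density Q.2) := by
  have hone : ∏ h ∈ Q.2ᶜ, component (G.φ h) ((fun _ => ∅ : H → Finset V) h) = 1 :=
    Finset.prod_eq_one fun h _ => by rw [component_empty, G.mean_φ]; rfl
  have h1 := G.sum_term_eq Q.2 fun _ => ∅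
  rw [hone, mul_one] at h1
  rw [← h1, Finset.mul_sum, map_sum, pexp_apply, Finset.sum_filter, Finset.sum_filter]
  refine Finset.sum_congr rfl fun A _ => ?_
  by_cases h0 : mean (f * G.term A) = 0
  · simp [h0]
  have hA := G.isClosedEdgeSet_of_mean_ne_zero hf h0
  refine if_congr ⟨fun hm h hh => ?_, fun h => ?_⟩ rfl rfl
  · have hsub := usedConstraints_subset hQ hS hA (card_union_usedConstraints_le hQ hsize hA hm)
    by_contra hne
    exact hh (hsub (mem_usedConstraints.2 (Finset.nonempty_iff_ne_empty.2 hne)))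
  · refine (Finset.card_le_card fun h' hh' => ?_).trans hQ.1
    by_contra hC
    exact (mem_usedConstraints.1 hh').ne_empty (h h' hC)

variable (G) in
lemma pexp_one : G.pexp 1 = 1 := by
  have hdep : DependsOn (1 : (V → Ω) → ℝ) ((∅ : Finset V) : Set V) := fun _ _ _ => rfl
  rw [pexp_apply, Finset.sum_eq_single fun _ => ∅]
  · rw [term, Finset.prod_eq_one fun h _ => ?_, one_mul, mean_one]
    rw [component_empty, G.mean_φ]
    rfl
  · intro A hA hne
    by_contra h0
    have h1 := G.card_usedConstraints_le (G.isClosedEdgeSet_of_mean_ne_zero hdep h0)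
      (mem_filter.1 hA).2
    have hpos : 0 < (usedConstraints A).card := by
      obtain ⟨h, hh⟩ := Function.ne_iff.1 hne
      exact Finset.card_pos.2 ⟨h, mem_usedConstraints.2 (Finset.nonempty_iff_ne_empty.2 hh)⟩
    have h2 : (0 : ℝ) < (usedConstraints A).card := by exact_mod_cast hpos
    have h3 := mul_pos G.ζ_pos h2
    simp only [Finset.card_empty, Nat.cast_zero] at h1
    linarith
  · intro h
    exact absurd (mem_filter.2 ⟨mem_univ _, by simp [usedConstraints]⟩) h

lemma pexp_mul_eq_mean (hQ : IsClosedPair G.N G.t m Q) {D : ℕ}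
    (hD : 2 * (D : ℝ) ≤ ζ * m) (hP : potential G.N G.t Q ≤ D) {y z : (V → Ω) → ℝ}
    (hy : y ∈ degLT Q.1 (D + 1)) (hz : z ∈ degLT Q.1 (D + 1)) :
    G.pexp (y * z) = mean (y * z * G.density Q.2) := by
  induction hy, hz using Submodule.span_induction₂ with
  | mem_mem y z hy hz =>
    obtain ⟨S, hS, hSs, hy⟩ := hy
    obtain ⟨T, hT, hTs, hz⟩ := hz
    refine pexp_eq_mean hQ (Finset.union_subset hS hT) ?_
      ((hy.mono (by simp)).mul (hz.mono (by simp)))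
    have h1 := Finset.card_union_le S T
    have h2 : ((S ∪ T).card : ℝ) ≤ 2 * D := by
      exact_mod_cast (by omega : (S ∪ T).card ≤ 2 * D)
    linarith
  | zero_left => simp
  | zero_right => simp
  | add_left _ _ _ _ _ _ h1 h2 => simp only [add_mul, map_add, h1, h2]
  | add_right _ _ _ _ _ _ h1 h2 => simp only [mul_add, add_mul, map_add, h1, h2]
  | smul_left _ _ _ _ _ h => simp only [smul_mul_assoc, map_smul, h]
  | smul_right _ _ _ _ _ h => simp only [mul_smul_comm, smul_mul_assoc, map_smul, h]

lemma pexp_sq_nonneg_of_isClosedPair (hQ : IsClosedPair G.N G.t m Q) {D : ℕ}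
    (hD : 2 * (D : ℝ) ≤ ζ * m) (hP : potential G.N G.t Q ≤ D) {y : (V → Ω) → ℝ}
    (hy : y ∈ degLT Q.1 (D + 1)) : 0 ≤ G.pexp (y * y) := by
  rw [pexp_mul_eq_mean hQ hD hP hy hy]
  exact mean_nonneg fun x => mul_nonneg (mul_self_nonneg _) (G.density_nonneg _ x)

/-- Only choices of edges that cross the boundary of a closed pair few times contribute. -/
lemma pexp_mul_eq_sum (hQ : IsClosedPair G.N G.t m Q) {D : ℕ}
    (hD : 2 * (D : ℝ) ≤ ζ * m) (hP : potential G.N G.t Q ≤ D) {T : Finset V} (hTD : T.card ≤ D)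
    (hT : ¬ T ⊆ Q.1) {y f : (V → Ω) → ℝ} (hy : y ∈ degLT Q.1 (D + 1))
    (hf : DependsOn f (T : Set V)) :
    G.pexp (y * f) = ∑ A ∈ univ.filter (fun A : H → Finset V =>
      (Q.2 ∪ usedConstraints A).card ≤ m ∧ ∑ h ∈ Q.2ᶜ, (A h ∩ Q.1).card < (T \ Q.1).card),
        mean (y * f * G.term A) := by
  induction hy using Submodule.span_induction with
  | mem y hy =>
    obtain ⟨S, hS, hSs, hy⟩ := hy
    rw [pexp_apply, Finset.sum_filter, Finset.sum_filter]
    refine Finset.sum_congr rfl fun A _ => ?_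
    by_cases h0 : mean (y * f * G.term A) = 0
    · simp [h0]
    have hdep : DependsOn (y * f) ((S ∪ T : Finset V) : Set V) :=
      (hy.mono (by simp)).mul (hf.mono (by simp))
    have hA := G.isClosedEdgeSet_of_mean_ne_zero hdep h0
    refine if_congr ⟨fun hm => ?_, fun h => ?_⟩ rfl rfl
    · have h1 := Finset.card_union_le S T
      have h2 : ((S ∪ T).card : ℝ) ≤ 2 * D := by
        exact_mod_cast (by omega : (S ∪ T).card ≤ 2 * D)
      have h3 := card_union_usedConstraints_le hQ (by linarith) hA hm
      exact ⟨h3, crossing_lt hQ hS hT hA h3⟩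
    · exact (Finset.card_le_card Finset.subset_union_right).trans h.1
  | zero => simp
  | add y z _ _ hy hz => simp only [add_mul, map_add, hy, hz, Finset.sum_add_distrib]
  | smul c y _ hy => simp only [smul_mul_assoc, map_smul, hy, Finset.smul_sum]

/-- A function on a closed pair that is orthogonal to the functions on it of lower degree is
orthogonal to every function of a set of variables of the same degree that leaves the pair. -/
lemma pexp_mul_eq_zero (hQ : IsClosedPair G.N G.t m Q) {D : ℕ}
    (hD : 2 * (D : ℝ) ≤ ζ * m) (hP : potential G.N G.t Q ≤ D) {T : Finset V} (hTD : T.card ≤ D)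
    (hT : ¬ T ⊆ Q.1) {y f : (V → Ω) → ℝ} (hy : y ∈ degLT Q.1 (D + 1))
    (hyz : ∀ z ∈ degLT Q.1 T.card, G.pexp (y * z) = 0) (hf : DependsOn f (T : Set V)) :
    G.pexp (y * f) = 0 := by
  rw [pexp_mul_eq_sum hQ hD hP hTD hT hy hf,
    ← Finset.sum_fiberwise _ fun (A : H → Finset V) h => if h ∈ Q.2 then ∅ else A h]
  refine Finset.sum_eq_zero fun A₀ _ => ?_
  rcases Finset.eq_empty_or_nonempty (Finset.filter
    (fun A : H → Finset V => (fun h => if h ∈ Q.2 then ∅ else A h) = A₀)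
    (univ.filter (fun A : H → Finset V => (Q.2 ∪ usedConstraints A).card ≤ m ∧
      ∑ h ∈ Q.2ᶜ, (A h ∩ Q.1).card < (T \ Q.1).card))) with hE | ⟨B, hB⟩
  · rw [hE, Finset.sum_empty]
  obtain ⟨⟨-, hBm, hBc⟩, rfl⟩ := by simpa only [mem_filter] using hB
  have hset : Finset.filter (fun A : H → Finset V => (fun h => if h ∈ Q.2 then ∅ else A h)
        = fun h => if h ∈ Q.2 then ∅ else B h)
      (univ.filter (fun A : H → Finset V => (Q.2 ∪ usedConstraints A).card ≤ m ∧
        ∑ h ∈ Q.2ᶜ, (A h ∩ Q.1).card < (T \ Q.1).card))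
      = univ.filter (fun A : H → Finset V => ∀ h ∉ Q.2, A h = B h) := by
    ext A
    have hiff : ((fun h => if h ∈ Q.2 then ∅ else A h) = fun h => if h ∈ Q.2 then ∅ else B h)
        ↔ ∀ h ∉ Q.2, A h = B h := by
      rw [funext_iff]
      refine forall_congr' fun h => ?_
      by_cases hh : h ∈ Q.2 <;> simp [hh]
    rw [mem_filter, mem_filter, mem_filter, hiff]
    refine ⟨fun h => ⟨mem_univ _, h.2⟩, fun h => ⟨⟨mem_univ _, ?_, ?_⟩, h.2⟩⟩
    · have hU : Q.2 ∪ usedConstraints A = Q.2 ∪ usedConstraints B := by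
        ext h'
        by_cases hh : h' ∈ Q.2 <;> simp [hh, mem_usedConstraints, h.2 h']
      rwa [hU]
    · rwa [Finset.sum_congr rfl fun h' hh' => by rw [h.2 h' (mem_compl.1 hh')]]
  rw [hset, ← map_sum, ← Finset.mul_sum, G.sum_term_eq]
  set u := f * ∏ h ∈ Q.2ᶜ, component (G.φ h) (B h) with hu
  have hudep : DependsOn u ((T ∪ Q.2ᶜ.biUnion B : Finset V) : Set V) := by
    refine DependsOn.mul (hf.mono (by simp)) (DependsOn.prod _ fun h hh =>
      (component_dependsOn _ _).mono ?_)
    exact_mod_cast (Finset.subset_biUnion_of_mem B hh).trans Finset.subset_union_right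
  have hmdep : DependsOn (y * G.density Q.2) (Q.1 : Set V) := by
    refine (dependsOn_of_mem_degLT hy).mul (DependsOn.prod _ fun h hh =>
      (G.φ_dependsOn h).mono ?_)
    exact_mod_cast hQ.subset hh
  have hcard : ((T ∪ Q.2ᶜ.biUnion B) ∩ Q.1).card < T.card := by
    have h1 := Finset.card_union_le (T ∩ Q.1) (Q.2ᶜ.biUnion fun h => B h ∩ Q.1)
    have h2 : (Q.2ᶜ.biUnion fun h => B h ∩ Q.1).card ≤ _ := Finset.card_biUnion_le
    have h3 := Finset.card_inter_add_card_sdiff T Q.1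
    rw [Finset.union_inter_distrib_right, Finset.biUnion_inter]
    omega
  have hz := mem_degLT Finset.inter_subset_right hcard (condMean_dependsOn Q.1 _ hudep)
  rw [show y * f * (G.density Q.2 * ∏ h ∈ Q.2ᶜ, component (G.φ h) (B h))
      = (y * G.density Q.2) * u by rw [hu]; ring, ← mean_mul_condMean Q.1 hmdep u,
    mul_right_comm, ← pexp_mul_eq_mean hQ hD hP hy (degLT_mono subset_rfl (by omega) hz)]
  exact hyz _ hz

variable (G) in
lemma card_union_le_of_potential_le {D : ℝ} (hD : 2 * D ≤ ζ * m) {X Y : Finset V × Finset H}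
    (hX : X.2.card ≤ m) (hY : Y.2.card ≤ m) (hXD : potential G.N G.t X ≤ D)
    (hYD : potential G.N G.t Y ≤ D) : (X.2 ∪ Y.2).card ≤ m := by
  have h1 := G.expansion X.1 X.2 hX
  have h2 := G.expansion Y.1 Y.2 hY
  refine (Finset.card_union_le _ _).trans ?_
  have h3 : ζ * (X.2.card + Y.2.card) ≤ ζ * m := by linarith
  exact_mod_cast le_of_mul_le_mul_left h3 G.ζ_pos

lemma isClosedPair_inf_of_potential_le {D : ℝ} (hD : 2 * D ≤ ζ * m) {R : Finset V × Finset H}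
    (hQ : IsClosedPair G.N G.t m Q) (hR : IsClosedPair G.N G.t m R)
    (hQD : potential G.N G.t Q ≤ D) (hRD : potential G.N G.t R ≤ D) :
    IsClosedPair G.N G.t m (Q ⊓ R) ∧ potential G.N G.t (Q ⊓ R) ≤ D := by
  have hinf : potential G.N G.t (Q ⊓ R) ≤ D :=
    (potential_inf_le hQ (G.card_union_le_of_potential_le hD hQ.1 hR.1 hQD hRD)).trans hRD
  exact ⟨hQ.inf hR fun X hX hXP =>
    ⟨G.card_union_le_of_potential_le hD hX hQ.1 (hXP.trans hinf) hQD,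
      G.card_union_le_of_potential_le hD hX hR.1 (hXP.trans hinf) hRD⟩, hinf⟩

variable (G) in
/-- The pseudoexpectation is nonnegative on squares of low-degree functions. -/
theorem pexp_sq_nonneg {D : ℕ} (hD : 2 * (D : ℝ) ≤ ζ * m) {x : (V → Ω) → ℝ}
    (hx : x ∈ degLT univ (D + 1)) : 0 ≤ G.pexp (x * x) := by
  classical
  set B : LinearMap.BilinForm ℝ ((V → Ω) → ℝ) := (LinearMap.mul ℝ _).compr₂ G.pexp with hB
  have hBa : ∀ f g, B f g = G.pexp (f * g) := fun f g => rfl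
  set J : Finset (ℕ × (Finset V × Finset H)) := range (D + 2) ×ˢ
    univ.filter fun Q => IsClosedPair G.N G.t m Q ∧ potential G.N G.t Q ≤ D with hJ
  have hmem : ∀ s Q, (s, Q) ∈ J ↔
      s ≤ D + 1 ∧ IsClosedPair G.N G.t m Q ∧ potential G.N G.t Q ≤ D := fun s Q => by
    simp [hJ, Nat.lt_succ_iff]
  rw [← hBa]
  refine nonneg_of_mem_iSup B (fun f g => by rw [hBa, hBa, mul_comm])
    (fun j => toLex (j.1, j.2.1.card + j.2.2.card)) (fun j => degLT j.2.1 j.1) J ?_ ?_ x ?_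
  · rintro ⟨s, Q⟩ hj y hy
    obtain ⟨hs, hQ, hQD⟩ := (hmem s Q).1 hj
    exact pexp_sq_nonneg_of_isClosedPair hQ hD hQD (degLT_mono subset_rfl hs hy)
  · rintro ⟨s, Q⟩ hj y hy hlow ⟨s', Q'⟩ hi hne hkey z hz
    obtain ⟨hs, hQ, hQD⟩ := (hmem s Q).1 hj
    obtain ⟨hs', hQ', hQD'⟩ := (hmem s' Q').1 hi
    have hlow' : ∀ r < s, ∀ w ∈ degLT Q.1 r, B y w = 0 := fun r hr =>
      hlow (r, Q) ((hmem r Q).2 ⟨by omega, hQ, hQD⟩)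
        (Prod.Lex.toLex_lt_toLex.2 (Or.inl hr)) (degLT_mono subset_rfl hr.le)
    rw [Prod.Lex.toLex_le_toLex] at hkey
    suffices h : degLT Q'.1 s' ≤ LinearMap.ker (B y) from h hz
    refine Submodule.span_le.2 ?_
    rintro f ⟨T, hT, hTs, hf⟩
    change B y f = 0
    have hss : s' ≤ s := by rcases hkey with h | h <;> [exact h.le; exact h.1.le]
    by_cases hTQ : T ⊆ Q.1
    · rcases hkey with h | ⟨h1, h2⟩
      · exact hlow' s' h f (mem_degLT hTQ hTs hf)
      · simp only at h1 h2
        subst h1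
        obtain ⟨hI, hID⟩ := isClosedPair_inf_of_potential_le hD hQ hQ' hQD hQD'
        have hlt : Q ⊓ Q' < Q := by
          refine inf_le_left.lt_of_ne fun h => hne ?_
          have hle : Q ≤ Q' := inf_eq_left.1 h
          have h3 := Finset.card_le_card hle.1
          have h4 := Finset.card_le_card hle.2
          rw [Prod.ext (Finset.eq_of_subset_of_card_le hle.1 (by omega))
            (Finset.eq_of_subset_of_card_le hle.2 (by omega))]
        refine hlow (s', Q ⊓ Q') ((hmem _ _).2 ⟨hs, hI, hID⟩) ?_
          (degLT_mono Finset.inter_subset_left le_rfl) f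
          (mem_degLT (Finset.subset_inter hTQ hT) hTs hf)
        refine Prod.Lex.toLex_lt_toLex.2 (Or.inr ⟨rfl, ?_⟩)
        rcases Prod.lt_iff.1 hlt with ⟨h3, h4⟩ | ⟨h3, h4⟩
        · exact Nat.add_lt_add_of_lt_of_le (Finset.card_lt_card h3) (Finset.card_le_card h4)
        · exact Nat.add_lt_add_of_le_of_lt (Finset.card_le_card h3) (Finset.card_lt_card h4)
    · exact pexp_mul_eq_zero hQ hD hQD (by omega) hTQ (degLT_mono subset_rfl hs hy)
        (hlow' T.card (by omega)) hf
  · refine Submodule.span_le.2 ?_ hx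
    rintro f ⟨T, -, hTs, hf⟩
    obtain ⟨R, hTR, hR, hRP⟩ := exists_isClosedPair_ge G.N G.t (m := m) (T, ∅) (by simp)
    have hTD : (T.card : ℝ) ≤ D := by exact_mod_cast Nat.lt_succ_iff.1 hTs
    have hRD : potential G.N G.t R ≤ D := hRP.trans (by simpa [potential] using hTD)
    exact Submodule.mem_iSup_of_mem (D + 1, R) (Submodule.mem_iSup_of_mem
      ((hmem _ _).2 ⟨le_rfl, hR, hRD⟩) (mem_degLT hTR.1 hTs hf))

variable (G) in
lemma pexp_eq_one_of_mul_eq {h : H} (hm : 1 ≤ m)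
    (hsize : ((G.N h).card : ℝ) + G.t h ≤ 2 * (ζ * m)) {f : (V → Ω) → ℝ}
    (hf : DependsOn f (G.N h : Set V)) (hfφ : f * G.φ h = G.φ h) : G.pexp f = 1 := by
  obtain ⟨R, hle, hR, hRP⟩ :=
    exists_isClosedPair_ge G.N G.t (m := m) (G.N h, {h}) (by simpa using hm)
  have hP : potential G.N G.t (G.N h, {h}) = G.t h / 2 := by
    rw [potential_eq_sum]
    simp
  have hsize' : ((G.N h).card : ℝ) + 2 * potential G.N G.t R ≤ 2 * (ζ * m) := by linarith
  have hh : h ∈ R.2 := hle.2 (mem_singleton_self h)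
  have hfd : f * G.density R.2 = 1 * G.density R.2 := by
    rw [one_mul, density, ← Finset.mul_prod_erase _ _ hh, ← mul_assoc, hfφ]
  rw [pexp_eq_mean hR hle.1 hsize' hf, hfd,
    ← pexp_eq_mean hR hle.1 hsize' (f := 1) fun _ _ _ => rfl, pexp_one]

end ExpandingSystem

end System

section FactorGraph

variable {V K Ω : Type} [Fintype V] [DecidableEq V] [Fintype K] [DecidableEq K]
  [Fintype Ω] [DecidableEq Ω] [Nonempty Ω]

/-- The density, relative to the uniform distribution, of a local distribution on a scope. -/
noncomputable def scopeDensity (e : K ↪ V) (ν : (K → Ω) → ℝ) (x : V → Ω) : ℝ :=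
  Fintype.card (K → Ω) * ν (x ∘ e)

lemma mean_scopeDensity_mul (e : K ↪ V) (ν F : (K → Ω) → ℝ) :
    mean (fun x : V → Ω => scopeDensity e ν x * F (x ∘ e)) = ∑ a, ν a * F a := by
  have hq : (Fintype.card (K → Ω) : ℝ) ≠ 0 := by exact_mod_cast Fintype.card_ne_zero
  have h := mean_comp_embedding (Ω := Ω) e fun a => Fintype.card (K → Ω) * ν a * F a
  simp only [scopeDensity]
  rw [h, mean_apply]
  simp only [mul_assoc]
  rw [← Finset.mul_sum, inv_mul_cancel_left₀ hq]

lemma scopeDensity_dependsOn (e : K ↪ V) (ν : (K → Ω) → ℝ) :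
    DependsOn (scopeDensity e ν) (univ.image e : Set V) := fun x y h => by
  have hxy : x ∘ e = y ∘ e := funext fun i => h (e i) (by simp)
  rw [scopeDensity, scopeDensity, hxy]

lemma sum_mul_prod_kern_eq_zero {ν : (K → Ω) → ℝ} {j : ℕ} (hν : kwiseUniformA j ν)
    {A : Finset K} (hA : A.Nonempty) (hAj : A.card ≤ j) (b : K → Ω) :
    ∑ a, ν a * ∏ i ∈ A, kern (b i) (a i) = 0 := by
  have hq : (Fintype.card Ω : ℝ) ≠ 0 := by exact_mod_cast Fintype.card_ne_zero
  have hB : ∀ B ∈ A.powerset,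
      ∑ a, ν a * ∏ i ∈ B, (if b i = a i then (Fintype.card Ω : ℝ) else 0) = 1 := fun B hB => by
    have h := hν B ((Finset.card_le_card (mem_powerset.1 hB)).trans hAj) b
    simp only [Finset.prod_ite_zero, Finset.prod_const, mul_ite, mul_zero]
    rw [← Finset.sum_filter, ← Finset.sum_mul]
    simp only [eq_comm (a := b _)]
    rw [h, ← mul_pow, one_div_mul_cancel hq, one_pow]
  obtain ⟨i₀, hi₀⟩ := hA
  calc ∑ a, ν a * ∏ i ∈ A, kern (b i) (a i)
      = ∑ a, ∑ B ∈ A.powerset, (ν a * ∏ i ∈ B, (if b i = a i then (Fintype.card Ω : ℝ) else 0))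
          * ∏ i ∈ A \ B, (-1) := by
        refine Finset.sum_congr rfl fun a _ => ?_
        simp only [kern, sub_eq_add_neg]
        rw [Finset.prod_add, Finset.mul_sum]
        exact Finset.sum_congr rfl fun B _ => (mul_assoc _ _ _).symm
    _ = ∑ B ∈ A.powerset, (∏ i ∈ B, 1) * ∏ i ∈ A \ B, (-1 : ℝ) := by
        rw [Finset.sum_comm]
        refine Finset.sum_congr rfl fun B hBA => ?_
        rw [← Finset.sum_mul, hB B hBA, Finset.prod_const_one]
    _ = 0 := by
        rw [← Finset.prod_add]
        exact Finset.prod_eq_zero hi₀ (by norm_num)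

lemma component_scopeDensity_eq_zero (e : K ↪ V) {ν : (K → Ω) → ℝ} {j : ℕ}
    (hν : kwiseUniformA j ν) {A : Finset V} (hA : A.Nonempty) (hAe : A ⊆ univ.image e)
    (hAj : A.card ≤ j) : component (scopeDensity e ν) A = 0 := by
  obtain ⟨B, -, rfl⟩ := Finset.subset_image_iff.1 hAe
  rw [Finset.card_image_of_injective _ e.injective] at hAj
  ext x
  simp only [component, Finset.prod_image e.injective.injOn]
  exact (mean_scopeDensity_mul e ν fun a => ∏ i ∈ B, kern (x (e i)) (a i)).trans
    (sum_mul_prod_kern_eq_zero hν (Finset.image_nonempty.1 hA) hAj fun i => x (e i))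

lemma kwiseUniformA.ne_zero {ν : (K → Ω) → ℝ} (hν : kwiseUniformA (Fintype.card K) ν)
    (a : K → Ω) : ν a ≠ 0 := by
  have h := hν univ Finset.card_univ.le a
  have hset : univ.filter (fun x : K → Ω => ∀ i ∈ univ, x i = a i) = {a} := by
    ext x
    simp [funext_iff]
  rw [hset, Finset.sum_singleton] at h
  have hq : (Fintype.card Ω : ℝ) ≠ 0 := by exact_mod_cast Fintype.card_ne_zero
  rw [h]
  positivity

lemma expansion_of_biUnion {H : Type*} [DecidableEq H] {N : H → Finset V} {t : H → ℕ} {ζ : ℝ}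
    {C : Finset H} (hC : ∑ h ∈ C, ((N h).card : ℝ) - (∑ h ∈ C, (t h : ℝ)) / 2 + ζ * C.card
      ≤ (C.biUnion N).card) (W : Finset V) : ζ * C.card ≤ potential N t (W, C) := by
  have hcover : C.biUnion N ⊆ W ∪ C.biUnion fun h => N h \ W := by
    intro v hv
    obtain ⟨h, hh, hv⟩ := mem_biUnion.1 hv
    by_cases hvW : v ∈ W
    · exact mem_union_left _ hvW
    · exact mem_union_right _ (mem_biUnion.2 ⟨h, hh, mem_sdiff.2 ⟨hv, hvW⟩⟩)
  have h1 : (C.biUnion N).card ≤ W.card + ∑ h ∈ C, (N h \ W).card :=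
    (Finset.card_le_card hcover).trans ((Finset.card_union_le _ _).trans
      (Nat.add_le_add_left Finset.card_biUnion_le _))
  have h2 : ((C.biUnion N).card : ℝ) ≤ W.card + ∑ h ∈ C, ((N h \ W).card : ℝ) := by
    exact_mod_cast h1
  have h3 : ∑ h ∈ C, ((N h).card : ℝ)
      = ∑ h ∈ C, ((N h ∩ W).card : ℝ) + ∑ h ∈ C, ((N h \ W).card : ℝ) := by
    rw [← Finset.sum_add_distrib]
    exact Finset.sum_congr rfl fun h _ => by
      exact_mod_cast (Finset.card_inter_add_card_sdiff (N h) W).symm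
  rw [potential_eq_sum, Finset.sum_sub_distrib, ← Finset.sum_div]
  linarith

end FactorGraph

section Indicators

variable {V Ω : Type} [Fintype V] [DecidableEq V] [Fintype Ω] [DecidableEq Ω] [Nonempty Ω]

variable (V Ω) in
/-- The function on assignments defined by a polynomial in the indicators of their letters. -/
noncomputable def evalIndicators : MvPolynomial (V × Ω) ℝ →ₐ[ℝ] (V → Ω) → ℝ :=
  MvPolynomial.aeval fun ic x => if x ic.1 = ic.2 then 1 else 0

lemma evalIndicators_apply (p : MvPolynomial (V × Ω) ℝ) (x : V → Ω) :
    evalIndicators V Ω p x = eval (fun ic : V × Ω => if x ic.1 = ic.2 then (1 : ℝ) else 0) p := by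
  have h : (Pi.evalAlgHom ℝ (fun _ : V → Ω => ℝ) x).comp (evalIndicators V Ω)
      = aeval fun ic : V × Ω => if x ic.1 = ic.2 then (1 : ℝ) else 0 := by
    ext ic
    simp [evalIndicators]
  simpa [aeval_eq_eval] using DFunLike.congr_fun h p

lemma evalIndicators_mem_degLT (p : MvPolynomial (V × Ω) ℝ) :
    evalIndicators V Ω p ∈ degLT univ (p.totalDegree + 1) := by
  rw [p.as_sum, map_sum]
  refine Submodule.sum_mem _ fun d hd => ?_
  have hcard : (d.support.image Prod.fst).card < p.totalDegree + 1 := by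
    refine Nat.lt_succ_iff.2 (Finset.card_image_le.trans (le_trans ?_ (le_totalDegree hd)))
    rw [Finset.card_eq_sum_ones]
    exact Finset.sum_le_sum fun i hi => Nat.one_le_iff_ne_zero.2 (Finsupp.mem_support_iff.1 hi)
  rw [← p.as_sum]
  refine mem_degLT (Finset.subset_univ _) hcard fun x y hxy => ?_
  rw [evalIndicators_apply, evalIndicators_apply, eval_monomial, eval_monomial]
  congr 1
  refine Finset.prod_congr rfl fun ic hic => ?_
  simp only [hxy ic.1 (by exact_mod_cast mem_image_of_mem Prod.fst hic)]

lemma evalIndicators_satisfied {K : Type} [Fintype K] [DecidableEq K] (e : K ↪ V)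
    (ν : (K → Ω) → ℝ) (x : V → Ω) :
    evalIndicators V Ω (∑ a ∈ rsupp ν, ∏ i, X (e i, a i)) x
      = if ν (x ∘ e) = 0 then 0 else 1 := by
  have h : ∀ a : K → Ω, (∏ i, if x (e i) = a i then (1 : ℝ) else 0)
      = if x ∘ e = a then 1 else 0 := fun a => by
    rw [Finset.prod_ite_zero]
    simp [funext_iff]
  simp only [evalIndicators_apply, map_sum, map_prod, eval_X, h]
  simp [rsupp]

end Indicators

end PlantedPseudoexpectation

open PlantedPseudoexpectation

/-- the [KMOW17] machinery with mixed uniformity parameters: expansion of the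
factor graph yields a pseudoexpectation of degree ζ·SMALL/3 weakly satisfying all constraints. -/
theorem stmt3 (n : ℕ) (Ω : Type) [Fintype Ω] [DecidableEq Ω] [Nonempty Ω]
    (ζ : ℝ) (hζ0 : 0 < ζ) (hζ1 : ζ < 1) (SMALL : ℕ) (hSn : SMALL ≤ n)
    -- the factor graph: constraint-vertices `H`, arities `k`, ordered scopes, uniformity
    -- parameters `t`, and local distributions `ν`
    (H : Type) [Fintype H] (k : H → ℕ) (scope : ∀ h : H, Fin (k h) ↪ Fin n)
    (t : H → ℕ) (ht1 : ∀ h, 1 ≤ t h) (ht2 : ∀ h, t h ≤ k h + 1)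
    (ν : ∀ h : H, (Fin (k h) → Ω) → ℝ)
    (hdist : ∀ h, IsDist (ν h))
    (hwise : ∀ h, kwiseUniformA (t h - 1) (ν h))
    (harity : ∀ h, (k h : ℝ) ≤ ζ * SMALL)
    -- the expansion condition: every nonempty constraint-induced subgraph `H'` (given by its
    -- constraint set `C`) with `c(H') ≤ SMALL` has `v ≥ e - T/2 + ζ·c`
    (hexp : ∀ C : Finset H, C.Nonempty → C.card ≤ SMALL →
      (((C.biUnion fun h => Finset.univ.image (scope h)).card : ℝ))
        ≥ ((∑ h ∈ C, k h : ℕ) : ℝ) - ((∑ h ∈ C, t h : ℕ) : ℝ) / 2 + ζ * (C.card : ℝ)) :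
    ∃ E : PEind n Ω (ζ * (SMALL : ℝ) / 3),
      ∀ h : H,
        -- weak satisfaction of the constraint `h`, with pseudovariance zero
        E.pE (∑ a ∈ rsupp (ν h), ∏ i : Fin (k h), MvPolynomial.X (scope h i, a i)) = 1 ∧
        E.pE ((∑ a ∈ rsupp (ν h), ∏ i : Fin (k h), MvPolynomial.X (scope h i, a i)) ^ 2)
          = 1 := by
  classical
  have hN : ∀ h, (univ.image (scope h)).card = k h := fun h => by
    rw [Finset.card_image_of_injective _ (scope h).injective, Finset.card_fin]
  let G : ExpandingSystem (Fin n) H Ω ζ SMALL :=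
    { φ := fun h => scopeDensity (scope h) (ν h)
      N := fun h => univ.image (scope h)
      t := t
      φ_nonneg := fun h x => mul_nonneg (Nat.cast_nonneg _) ((hdist h).1 _)
      φ_dependsOn := fun h => scopeDensity_dependsOn _ _
      mean_φ := fun h => by
        simpa [(hdist h).2] using mean_scopeDensity_mul (scope h) (ν h) fun _ => 1
      component_eq_zero := fun h A hA hAN hAt =>
        component_scopeDensity_eq_zero (scope h) (hwise h) hA hAN (by omega)
      ζ_pos := hζ0
      expansion := fun W C hC => by
        refine expansion_of_biUnion ?_ W
        rcases C.eq_empty_or_nonempty with rfl | hne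
        · simp
        · simpa only [hN, Nat.cast_sum] using hexp C hne hC }
  refine ⟨{ pE := G.pexp ∘ₗ (evalIndicators (Fin n) Ω).toLinearMap
            normalized := ?_
            multilin := fun p q hpq => ?_
            psd := fun p hp => ?_ }, fun h => ?_⟩
  · simpa using G.pexp_one
  · refine congrArg G.pexp (funext fun x => ?_)
    rw [AlgHom.toLinearMap_apply, AlgHom.toLinearMap_apply, evalIndicators_apply,
      evalIndicators_apply, hpq x]
  · rw [LinearMap.comp_apply, AlgHom.toLinearMap_apply, map_pow, sq]
    refine G.pexp_sq_nonneg (D := p.totalDegree) ?_ (evalIndicators_mem_degLT p)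
    have hpos : 0 ≤ ζ * SMALL := by positivity
    linarith
  · have hf := evalIndicators_satisfied (scope h) (ν h)
    simp only [LinearMap.comp_apply, AlgHom.toLinearMap_apply, map_pow]
    set f := evalIndicators (Fin n) Ω
      (∑ a ∈ rsupp (ν h), ∏ i : Fin (k h), MvPolynomial.X (scope h i, a i))
    have hsq : f ^ 2 = f := by
      ext x
      rw [Pi.pow_apply, hf]
      split_ifs <;> norm_num
    rw [hsq, and_self]
    rcases (ht2 h).eq_or_lt with htk | htk
    · have hunif : kwiseUniformA (Fintype.card (Fin (k h))) (ν h) := by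
        have := hwise h
        rw [Fintype.card_fin]
        rwa [htk, Nat.add_sub_cancel] at this
      have hone : f = 1 := funext fun x => by rw [hf, if_neg (hunif.ne_zero _), Pi.one_apply]
      rw [hone, G.pexp_one]
    · have hk : (1 : ℝ) ≤ k h := by exact_mod_cast (ht1 h).trans (Nat.lt_succ_iff.1 htk)
      have htk' : (t h : ℝ) ≤ k h := by exact_mod_cast Nat.lt_succ_iff.1 htk
      refine G.pexp_eq_one_of_mul_eq (h := h) ?_ ?_ (fun x y hxy => ?_) (funext fun x => ?_)
      · rw [Nat.one_le_iff_ne_zero]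
        rintro rfl
        have := harity h
        simp only [Nat.cast_zero, mul_zero] at this
        linarith
      · have := harity h
        change ((univ.image (scope h)).card : ℝ) + t h ≤ _
        rw [hN h]
        linarith
      · have hcomp : x ∘ scope h = y ∘ scope h := funext fun i => hxy _ (by simp [G])
        rw [hf, hf, hcomp]
      · change f x * scopeDensity (scope h) (ν h) x = scopeDensity (scope h) (ν h) x
        rw [hf, scopeDensity]
        split_ifs with h0 <;> simp [h0]
end
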